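/- arXiv:1801.05799 — 9 statements merged into one kernel-verified Lean document; each statement's English description precedes it below -/
import Mathlib

section
/- Let 0 < l ≤ ∞, r > 0 and let x be a measurable function on (0,l). Then for every t ∈ (0,l) one has, as an identity in [0,∞], (1/t)∫_0^t (∫_s^l |x(u)|^r u^{-1} du) ds = (1/t)∫_0^t |x(u)|^r du + ∫_t^l |x(u)|^r u^{-1} du; equivalently (H_r H_r^* x)(t)^r = (H_r x)(t)^r + (H_r^* x)(t)^r. -/
open MeasureTheory Set
open scoped ENNReal

/-- Tonelli on the triangle `0 < s < u < t`. -/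
theorem lintegral_Ioo_lintegral_Ioo_eq_lintegral_mul {f : ℝ → ℝ≥0∞} (hf : Measurable f) (t : ℝ) :
    ∫⁻ s in Ioo (0:ℝ) t, ∫⁻ u in Ioo s t, f u = ∫⁻ u in Ioo (0:ℝ) t, f u * ENNReal.ofReal u := by
  calc ∫⁻ s in Ioo (0:ℝ) t, ∫⁻ u in Ioo s t, f u
      = ∫⁻ s in Ioo (0:ℝ) t, ∫⁻ u in Ioo (0:ℝ) t, (Ioi s).indicator f u := by
        refine setLIntegral_congr_fun measurableSet_Ioo fun s hs => ?_
        have h : Ioo s t = Ioi s ∩ Ioo 0 t := by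
          ext u
          simp only [mem_Ioo, mem_inter_iff, mem_Ioi]
          exact ⟨fun h => ⟨h.1, hs.1.trans h.1, h.2⟩, fun h => ⟨h.1, h.2.2⟩⟩
        simp only [setLIntegral_indicator measurableSet_Ioi, h]
    _ = ∫⁻ u in Ioo (0:ℝ) t, ∫⁻ s in Ioo (0:ℝ) t, (Ioi s).indicator f u := by
        refine lintegral_lintegral_swap (Measurable.aemeasurable ?_)
        exact (hf.comp measurable_snd).indicator
          (measurableSet_lt measurable_fst measurable_snd : MeasurableSet {p : ℝ × ℝ | p.1 < p.2})
    _ = ∫⁻ u in Ioo (0:ℝ) t, f u * ENNReal.ofReal u := by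
        refine setLIntegral_congr_fun measurableSet_Ioo fun u hu => ?_
        have h : Iio u ∩ Ioo 0 t = Ioo 0 u := by
          ext s
          simp only [mem_Ioo, mem_inter_iff, mem_Iio]
          exact ⟨fun h => ⟨h.2.1, h.1⟩, fun h => ⟨h.2, h.1, h.2.trans hu.2⟩⟩
        have h' (s : ℝ) : (Ioi s).indicator f u = (Iio u).indicator (fun _ => f u) s := by
          simp [indicator]
        simp only [h', setLIntegral_indicator measurableSet_Iio, h, setLIntegral_const,
          Real.volume_Ioo, sub_zero]

/-- For `0 < l ≤ ∞`, `r > 0` and `x` measurable on `(0,l)`, for every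
`t ∈ (0,l)` one has `(1/t)∫_0^t (∫_s^l |x(u)|^r u⁻¹ du) ds
  = (1/t)∫_0^t |x(u)|^r du + ∫_t^l |x(u)|^r u⁻¹ du`
as an identity in `[0,∞]`; i.e. `(H_r H_r^* x)(t)^r = (H_r x)(t)^r + (H_r^* x)(t)^r`. -/
theorem stmt0 (l : ℝ≥0∞) (hl : 0 < l) (r : ℝ) (hr : 0 < r)
    (x : ℝ → ℝ) (hx : Measurable x)
    (t : ℝ) (ht : 0 < t) (htl : ENNReal.ofReal t < l) :
    (ENNReal.ofReal t)⁻¹ *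
      ∫⁻ s in Ioo (0:ℝ) t,
        ∫⁻ u in {u : ℝ | s < u ∧ ENNReal.ofReal u < l},
          ENNReal.ofReal (|x u| ^ r) / ENNReal.ofReal u
    = (ENNReal.ofReal t)⁻¹ * (∫⁻ u in Ioo (0:ℝ) t, ENNReal.ofReal (|x u| ^ r))
      + ∫⁻ u in {u : ℝ | t < u ∧ ENNReal.ofReal u < l},
          ENNReal.ofReal (|x u| ^ r) / ENNReal.ofReal u := by
  set f : ℝ → ℝ≥0∞ := fun u => ENNReal.ofReal (|x u| ^ r) / ENNReal.ofReal u with hf_def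
  have hf : Measurable f := by
    have := (continuous_abs.measurable.comp hx).pow_const r
    exact this.ennreal_ofReal.div ENNReal.measurable_ofReal
  set A : Set ℝ := {u : ℝ | t < u ∧ ENNReal.ofReal u < l} with hA_def
  have hA : MeasurableSet A :=
    measurableSet_Ioi.inter (measurableSet_lt ENNReal.measurable_ofReal measurable_const)
  have split (s : ℝ) (hs : s ∈ Ioo 0 t) :
      ∫⁻ u in {u : ℝ | s < u ∧ ENNReal.ofReal u < l}, f u
        = (∫⁻ u in Ioo s t, f u) + ∫⁻ u in A, f u := by
    have hunion : {u : ℝ | s < u ∧ ENNReal.ofReal u < l} = Ioc s t ∪ A := by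
      ext u
      simp only [mem_ofPred_eq, mem_union, mem_Ioc, hA_def]
      constructor
      · rintro ⟨h1, h2⟩
        exact (le_or_gt u t).imp (fun h => ⟨h1, h⟩) (fun h => ⟨h, h2⟩)
      · rintro (⟨h1, h2⟩ | ⟨h1, h2⟩)
        · exact ⟨h1, (ENNReal.ofReal_le_ofReal h2).trans_lt htl⟩
        · exact ⟨hs.2.trans h1, h2⟩
    have hdisj : Disjoint (Ioc s t) A :=
      disjoint_left.2 fun u hu hu' => hu.2.not_gt hu'.1
    rw [hunion, lintegral_union hA hdisj, setLIntegral_congr Ioo_ae_eq_Ioc]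
  have cancel : ∫⁻ u in Ioo (0:ℝ) t, f u * ENNReal.ofReal u
      = ∫⁻ u in Ioo (0:ℝ) t, ENNReal.ofReal (|x u| ^ r) :=
    setLIntegral_congr_fun measurableSet_Ioo fun u hu =>
      ENNReal.div_mul_cancel (ENNReal.ofReal_pos.2 hu.1).ne' ENNReal.ofReal_ne_top
  rw [setLIntegral_congr_fun measurableSet_Ioo split, lintegral_add_right _ measurable_const,
    lintegral_Ioo_lintegral_Ioo_eq_lintegral_mul hf, cancel, setLIntegral_const, Real.volume_Ioo,
    sub_zero, mul_add, mul_comm _ (ENNReal.ofReal t), ← mul_assoc,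
    ENNReal.inv_mul_cancel (ENNReal.ofReal_pos.2 ht).ne' ENNReal.ofReal_ne_top, one_mul]
end

section
/- Let a > 0 and define the weight w_a on (0,∞) by w_a(t) = 1 for 0 < t < a and w_a(t) = 1/(t−a) for t > a. Let x = χ_{(0,a/2)} and y = χ_{(a/2, 5a/4)}. Then ∫_0^∞ x*(t) w_a(t) dt < ∞ and ∫_0^∞ y*(t) w_a(t) dt < ∞, but ∫_0^∞ (x+y)*(t) w_a(t) dt = ∞. In particular the Lorentz class Λ_{1,w_a} is not closed under addition, hence is not a linear space. -/
open MeasureTheory Set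
open scoped ENNReal

/-- The decreasing rearrangement of `x` on the interval `I ⊆ (0,∞)`:
`x*(t) = inf {λ > 0 : m({s ∈ I : |x(s)| > λ}) ≤ t}` (with `inf ∅ = ∞`). -/
noncomputable def rearr (I : Set ℝ) (x : ℝ → ℝ) (t : ℝ) : ℝ≥0∞ :=
  sInf (ENNReal.ofReal ''
    {a : ℝ | 0 < a ∧ volume {s : ℝ | s ∈ I ∧ a < |x s|} ≤ ENNReal.ofReal t})

/-- The weight `w_a(t) = 1` for `0 < t < a` and `w_a(t) = 1/(t-a)` for `t > a`. -/
noncomputable def wA (a t : ℝ) : ℝ := if t < a then 1 else 1 / (t - a)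

theorem rearr_indicator_one {S : Set ℝ} (hS : S ⊆ Ioi 0) (t : ℝ) :
    rearr (Ioi 0) (S.indicator fun _ => (1 : ℝ)) t =
      if ENNReal.ofReal t < volume S then 1 else 0 := by
  have hlt : ∀ l : ℝ, 0 < l → l < 1 →
      {s : ℝ | s ∈ Ioi 0 ∧ l < |S.indicator (fun _ => (1 : ℝ)) s|} = S := by
    intro l hl hl1
    ext s
    by_cases hs : s ∈ S
    · simpa [hs, hl1] using hS hs
    · simp [hs, hl.le]
  have hge : ∀ l : ℝ, 1 ≤ l →
      {s : ℝ | s ∈ Ioi 0 ∧ l < |S.indicator (fun _ => (1 : ℝ)) s|} = ∅ := by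
    intro l hl
    ext s
    by_cases hs : s ∈ S
    · simp [hs, hl]
    · simp [hs, zero_le_one.trans hl]
  unfold rearr
  split_ifs with h
  · apply le_antisymm
    · exact sInf_le ⟨1, ⟨one_pos, by rw [hge 1 le_rfl]; simp⟩, ENNReal.ofReal_one⟩
    · apply le_sInf
      rintro _ ⟨l, ⟨hl, hv⟩, rfl⟩
      by_contra! hl1
      rw [hlt l hl (by simpa using hl1)] at hv
      exact absurd h hv.not_gt
  · refine le_antisymm (ENNReal.le_of_forall_pos_le_add fun ε hε _ => ?_) zero_le
    have hm : 0 < min (ε : ℝ) (1 / 2) := lt_min (by exact_mod_cast hε) (by norm_num)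
    refine le_trans (sInf_le ⟨min (ε : ℝ) (1 / 2), ⟨hm, ?_⟩, rfl⟩) ?_
    · rw [hlt _ hm ((min_le_right _ _).trans_lt (by norm_num))]
      exact not_lt.mp h
    · rw [zero_add, ← ENNReal.ofReal_coe_nnreal]
      exact ENNReal.ofReal_le_ofReal (min_le_left _ _)

theorem lintegral_rearr_indicator_wA_lt_top {a : ℝ} {S : Set ℝ} (hS : S ⊆ Ioi 0)
    (hSa : volume S ≤ ENNReal.ofReal a) :
    (∫⁻ t in Ioi (0 : ℝ), rearr (Ioi 0) (S.indicator fun _ => (1 : ℝ)) t *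
      ENNReal.ofReal (wA a t)) < ⊤ := by
  calc
    _ ≤ ∫⁻ t in Ioi (0 : ℝ), (Iio a).indicator (fun _ => (1 : ℝ≥0∞)) t := by
      refine lintegral_mono fun t => ?_
      rw [rearr_indicator_one hS]
      split_ifs with h
      · have hta : t < a := (ENNReal.ofReal_lt_ofReal_iff'.mp (h.trans_le hSa)).1
        simp [wA, hta]
      · simp
    _ = volume (Iio a ∩ Ioi 0) := by
      rw [lintegral_indicator_const measurableSet_Iio, one_mul,
        Measure.restrict_apply measurableSet_Iio]
    _ < ⊤ := by
      rw [inter_comm, Ioi_inter_Iio, Real.volume_Ioo]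
      exact ENNReal.ofReal_lt_top

theorem lintegral_ofReal_one_div_sub_eq_top {a b : ℝ} (hab : a < b) :
    (∫⁻ t in Ioo a b, ENNReal.ofReal (1 / (t - a))) = ⊤ := by
  by_contra h
  have hint : IntegrableOn (fun t : ℝ => (t - a)⁻¹) (Ioo a b) := by
    refine ⟨by fun_prop, ?_⟩
    rw [hasFiniteIntegral_iff_ofReal]
    · simpa only [one_div] using lt_top_iff_ne_top.mpr h
    · filter_upwards [ae_restrict_mem measurableSet_Ioo] with t ht
      exact inv_nonneg.mpr (sub_nonneg.mpr ht.1.le)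
  rw [← intervalIntegrable_iff_integrableOn_Ioo_of_le hab.le,
    intervalIntegrable_sub_inv_iff] at hint
  rcases hint with h | h
  · exact hab.ne h
  · exact h left_mem_uIcc

theorem lintegral_rearr_indicator_wA_eq_top {a b : ℝ} (ha : 0 < a) (hab : a < b) {S : Set ℝ}
    (hS : S ⊆ Ioi 0) (hSb : ENNReal.ofReal b ≤ volume S) :
    (∫⁻ t in Ioi (0 : ℝ), rearr (Ioi 0) (S.indicator fun _ => (1 : ℝ)) t *
      ENNReal.ofReal (wA a t)) = ⊤ := by
  rw [eq_top_iff, ← lintegral_ofReal_one_div_sub_eq_top hab]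
  calc
    _ ≤ ∫⁻ t in Ioo a b, rearr (Ioi 0) (S.indicator fun _ => (1 : ℝ)) t *
        ENNReal.ofReal (wA a t) := by
      refine setLIntegral_mono' measurableSet_Ioo fun t ht => ?_
      have h : ENNReal.ofReal t < volume S :=
        ((ENNReal.ofReal_lt_ofReal_iff (ha.trans hab)).mpr ht.2).trans_le hSb
      rw [rearr_indicator_one hS, if_pos h, one_mul, wA, if_neg ht.1.not_gt]
    _ ≤ _ := lintegral_mono_set fun t ht => ha.trans ht.1

/-- with `x = χ_{(0,a/2)}` and `y = χ_{(a/2,5a/4)}` one has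
`∫ x* w_a < ∞`, `∫ y* w_a < ∞` but `∫ (x+y)* w_a = ∞`; in particular the Lorentz
class `Λ_{1,w_a}` is not closed under addition. -/
theorem stmt4 (a : ℝ) (ha : 0 < a) :
    (∫⁻ t in Ioi (0:ℝ),
      rearr (Ioi 0) ((Ioo (0:ℝ) (a/2)).indicator (fun _ => (1:ℝ))) t *
        ENNReal.ofReal (wA a t)) < ⊤ ∧
    (∫⁻ t in Ioi (0:ℝ),
      rearr (Ioi 0) ((Ioo (a/2) (5*a/4)).indicator (fun _ => (1:ℝ))) t *
        ENNReal.ofReal (wA a t)) < ⊤ ∧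
    (∫⁻ t in Ioi (0:ℝ),
      rearr (Ioi 0) ((Ioo (0:ℝ) (a/2)).indicator (fun _ => (1:ℝ)) +
          (Ioo (a/2) (5*a/4)).indicator (fun _ => (1:ℝ))) t *
        ENNReal.ofReal (wA a t)) = ⊤ ∧
    ¬ (∀ f g : ℝ → ℝ,
        (∫⁻ t in Ioi (0:ℝ), rearr (Ioi 0) f t * ENNReal.ofReal (wA a t)) < ⊤ →
        (∫⁻ t in Ioi (0:ℝ), rearr (Ioi 0) g t * ENNReal.ofReal (wA a t)) < ⊤ →
        (∫⁻ t in Ioi (0:ℝ), rearr (Ioi 0) (f + g) t * ENNReal.ofReal (wA a t)) < ⊤) := by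
  have hx : Ioo (0 : ℝ) (a / 2) ⊆ Ioi 0 := fun t ht => ht.1
  have hy : Ioo (a / 2) (5 * a / 4) ⊆ Ioi 0 := fun t ht => (half_pos ha).trans ht.1
  have hdisj : Disjoint (Ioo (0 : ℝ) (a / 2)) (Ioo (a / 2) (5 * a / 4)) :=
    Set.disjoint_left.mpr fun t h1 h2 => lt_asymm h1.2 h2.1
  have hxfin := lintegral_rearr_indicator_wA_lt_top (a := a) hx (by
    rw [Real.volume_Ioo]
    exact ENNReal.ofReal_le_ofReal (by linarith))
  have hyfin := lintegral_rearr_indicator_wA_lt_top (a := a) hy (by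
    rw [Real.volume_Ioo]
    exact ENNReal.ofReal_le_ofReal (by linarith))
  have hsum := lintegral_rearr_indicator_wA_eq_top (b := 5 * a / 4) ha (by linarith)
    (union_subset hx hy) (by
      rw [measure_union hdisj measurableSet_Ioo, Real.volume_Ioo, Real.volume_Ioo,
        ← ENNReal.ofReal_add (by linarith) (by linarith)]
      exact ENNReal.ofReal_le_ofReal (by linarith))
  rw [indicator_union_of_disjoint hdisj] at hsum
  exact ⟨hxfin, hyfin, hsum, fun h => (h _ _ hxfin hyfin).ne hsum⟩
end

section
/- Let w : (0,∞) → (0,1] be a nonincreasing continuous function with ∫_0^∞ w(t) dt < ∞, and define w_0 = ∑_{n=0}^∞ ( w·χ_{(2n,2n+1)} + χ_{(2n+1,2n+2)} ) and w_1 = ∑_{n=0}^∞ ( χ_{(2n,2n+1)} + w·χ_{(2n+1,2n+2)} ). Then for all measurable x_0, x_1 ≥ 0 on (0,∞) with x_0 + x_1 = 1 a.e., either ∫_0^∞ x_0*(t) w_0(t) dt = ∞ or ∫_0^∞ x_1*(t) w_1(t) dt = ∞. Consequently the constant function 1, which satisfies ∫_0^∞ 1*(t)·min(w_0,w_1)(t)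 dt = ∫_0^∞ w(t) dt < ∞, does not belong to Λ_{1,w_0} + Λ_{1,w_1}, so the symmetrization of a sum may strictly contain the sum of symmetrizations. -/
open MeasureTheory Set
open scoped ENNReal

/-- `w₀ = ∑_{n=0}^∞ ( w·χ_{(2n,2n+1)} + χ_{(2n+1,2n+2)} )`. -/
noncomputable def w0fun (w : ℝ → ℝ) (t : ℝ) : ℝ :=
  ∑' n : ℕ, ((Ioo (2*(n:ℝ)) (2*(n:ℝ)+1)).indicator w t
    + (Ioo (2*(n:ℝ)+1) (2*(n:ℝ)+2)).indicator (fun _ => (1:ℝ)) t)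

/-- `w₁ = ∑_{n=0}^∞ ( χ_{(2n,2n+1)} + w·χ_{(2n+1,2n+2)} )`. -/
noncomputable def w1fun (w : ℝ → ℝ) (t : ℝ) : ℝ :=
  ∑' n : ℕ, ((Ioo (2*(n:ℝ)) (2*(n:ℝ)+1)).indicator (fun _ => (1:ℝ)) t
    + (Ioo (2*(n:ℝ)+1) (2*(n:ℝ)+2)).indicator w t)

/-- An interval of length one starting at `2 * n + c` determines `n`, up to half-integral shifts. -/
lemma nat_eq_of_mem_Ioo {n m : ℕ} {t c d : ℝ} (hc : c = 0 ∨ c = 1) (hd : d = 0 ∨ d = 1)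
    (h1 : t ∈ Ioo (2 * (n : ℝ) + c) (2 * (n : ℝ) + c + 1))
    (h2 : t ∈ Ioo (2 * (m : ℝ) + d) (2 * (m : ℝ) + d + 1)) : n = m ∧ c = d := by
  obtain ⟨a1, a2⟩ := h1
  obtain ⟨b1, b2⟩ := h2
  have key : ∀ i j : ℕ, (i : ℝ) < t → t < i + 1 → (j : ℝ) < t → t < j + 1 → i = j := by
    intro i j p q r s
    have u1 : (i : ℝ) < j + 1 := by linarith
    have u2 : (j : ℝ) < i + 1 := by linarith
    norm_cast at u1 u2
    omega
  rcases hc with rfl | rfl <;> rcases hd with rfl | rfl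
  · have := key (2 * n) (2 * m) (by push_cast; linarith) (by push_cast; linarith)
      (by push_cast; linarith) (by push_cast; linarith)
    exact ⟨by omega, rfl⟩
  · have := key (2 * n) (2 * m + 1) (by push_cast; linarith) (by push_cast; linarith)
      (by push_cast; linarith) (by push_cast; linarith)
    omega
  · have := key (2 * n + 1) (2 * m) (by push_cast; linarith) (by push_cast; linarith)
      (by push_cast; linarith) (by push_cast; linarith)
    omega
  · have := key (2 * n + 1) (2 * m + 1) (by push_cast; linarith) (by push_cast; linarith)
      (by push_cast; linarith) (by push_cast; linarith)
    exact ⟨by omega, rfl⟩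

lemma tsum_indicator_of_mem_even (f g : ℝ → ℝ) {n : ℕ} {t : ℝ}
    (h : t ∈ Ioo (2 * (n : ℝ)) (2 * (n : ℝ) + 1)) :
    ∑' n : ℕ, ((Ioo (2*(n:ℝ)) (2*(n:ℝ)+1)).indicator f t
      + (Ioo (2*(n:ℝ)+1) (2*(n:ℝ)+2)).indicator g t) = f t := by
  have h' : t ∈ Ioo (2 * (n : ℝ) + 0) (2 * (n : ℝ) + 0 + 1) := by simpa using h
  have odd : ∀ m : ℕ, t ∉ Ioo (2 * (m : ℝ) + 1) (2 * (m : ℝ) + 2) := fun m hm => by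
    have := (nat_eq_of_mem_Ioo (Or.inl rfl) (Or.inr rfl) h'
      (show t ∈ Ioo (2 * (m : ℝ) + 1) (2 * (m : ℝ) + 1 + 1) from
        ⟨hm.1, by linarith [hm.2]⟩)).2
    norm_num at this
  rw [tsum_eq_single n]
  · rw [indicator_of_mem h, indicator_of_notMem (odd n), add_zero]
  · intro m hm
    rw [indicator_of_notMem, indicator_of_notMem (odd m), add_zero]
    exact fun hmem => hm (nat_eq_of_mem_Ioo (Or.inl rfl) (Or.inl rfl) h'
      (by simpa using hmem)).1.symm

lemma tsum_indicator_of_mem_odd (f g : ℝ → ℝ) {n : ℕ} {t : ℝ}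
    (h : t ∈ Ioo (2 * (n : ℝ) + 1) (2 * (n : ℝ) + 2)) :
    ∑' n : ℕ, ((Ioo (2*(n:ℝ)) (2*(n:ℝ)+1)).indicator f t
      + (Ioo (2*(n:ℝ)+1) (2*(n:ℝ)+2)).indicator g t) = g t := by
  have h' : t ∈ Ioo (2 * (n : ℝ) + 1) (2 * (n : ℝ) + 1 + 1) := ⟨h.1, by linarith [h.2]⟩
  have even : ∀ m : ℕ, t ∉ Ioo (2 * (m : ℝ)) (2 * (m : ℝ) + 1) := fun m hm => by
    have := (nat_eq_of_mem_Ioo (Or.inr rfl) (Or.inl rfl) h'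
      (show t ∈ Ioo (2 * (m : ℝ) + 0) (2 * (m : ℝ) + 0 + 1) by simpa using hm)).2
    norm_num at this
  rw [tsum_eq_single n]
  · rw [indicator_of_mem h, indicator_of_notMem (even n), zero_add]
  · intro m hm
    rw [indicator_of_notMem (even m), indicator_of_notMem, zero_add]
    exact fun hmem => hm (nat_eq_of_mem_Ioo (Or.inr rfl) (Or.inr rfl) h'
      ⟨hmem.1, by linarith [hmem.2]⟩).1.symm

/-- A positive real that is not an integer lies in the interior of some `[2n, 2n+1]` or
`[2n+1, 2n+2]`. -/
lemma exists_mem_Ioo_even_or_odd {t : ℝ} (ht : 0 < t) (hint : t ∉ range ((↑) : ℕ → ℝ)) :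
    ∃ n : ℕ, t ∈ Ioo (2 * (n : ℝ)) (2 * (n : ℝ) + 1) ∨
      t ∈ Ioo (2 * (n : ℝ) + 1) (2 * (n : ℝ) + 2) := by
  have h1 : ((⌊t⌋₊ : ℕ) : ℝ) < t :=
    lt_of_le_of_ne (Nat.floor_le ht.le) fun h => hint ⟨_, h⟩
  have h2 := Nat.lt_floor_add_one t
  rcases Nat.even_or_odd' ⌊t⌋₊ with ⟨n, hn | hn⟩ <;> rw [hn] at h1 h2 <;> push_cast at h1 h2
  · exact ⟨n, Or.inl ⟨h1, h2⟩⟩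
  · exact ⟨n, Or.inr ⟨h1, by linarith⟩⟩

/-- A function bounded below by a positive constant on infinitely many disjoint unit intervals has
infinite integral. -/
lemma lintegral_eq_top_of_le_on_Ioo (f : ℝ → ℝ≥0∞) {b : ℝ≥0∞} (hb : b ≠ 0) {c : ℝ}
    (hc : c = 0 ∨ c = 1)
    (hf : ∀ n : ℕ, ∀ t ∈ Ioo (2 * (n : ℝ) + c) (2 * (n : ℝ) + c + 1), b ≤ f t) :
    ∫⁻ t in Ioi (0 : ℝ), f t = ⊤ := by
  set U : Set ℝ := ⋃ n : ℕ, Ioo (2 * (n : ℝ) + c) (2 * (n : ℝ) + c + 1) with hU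
  have hUm : MeasurableSet U := MeasurableSet.iUnion fun _ => measurableSet_Ioo
  have hvol : volume U = ⊤ := by
    rw [hU, measure_iUnion _ fun _ => measurableSet_Ioo]
    · simp only [Real.volume_Ioo, add_sub_cancel_left, ENNReal.ofReal_one]
      exact ENNReal.tsum_const_eq_top_of_ne_zero one_ne_zero
    · exact fun i j hij => Set.disjoint_left.2 fun t hi hj =>
        hij (nat_eq_of_mem_Ioo hc hc hi hj).1
  have hsub : U ⊆ Ioi 0 := by
    refine iUnion_subset fun n t ht => ?_
    have : (0 : ℝ) ≤ n := n.cast_nonneg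
    have h1 := ht.1
    rw [mem_Ioi]
    rcases hc with rfl | rfl <;> linarith
  rw [eq_top_iff]
  calc (⊤ : ℝ≥0∞) = ∫⁻ _ in U, b := by
        rw [setLIntegral_const, hvol, ENNReal.mul_top hb]
    _ ≤ ∫⁻ t in U, f t := setLIntegral_mono' hUm fun t ht => by
        obtain ⟨n, hn⟩ := mem_iUnion.1 ht
        exact hf n t hn
    _ ≤ ∫⁻ t in Ioi (0 : ℝ), f t := lintegral_mono_set hsub

/-- If `|x| ≥ c` on a subset of `I` of infinite measure, then `x* ≥ c` everywhere. -/
lemma le_rearr_of_volume_eq_top {I : Set ℝ} {x : ℝ → ℝ} {c : ℝ}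
    (h : volume {s | s ∈ I ∧ c ≤ |x s|} = ⊤) (t : ℝ) : ENNReal.ofReal c ≤ rearr I x t := by
  refine le_sInf ?_
  rintro _ ⟨a, ⟨-, ha⟩, rfl⟩
  refine ENNReal.ofReal_le_ofReal (not_lt.1 fun hac => ?_)
  have : (⊤ : ℝ≥0∞) ≤ ENNReal.ofReal t := by
    rw [← h]
    exact le_trans (measure_mono fun s hs => And.intro hs.1 (hac.trans_le hs.2)) ha
  exact ENNReal.ofReal_ne_top (top_le_iff.1 this)

lemma rearr_one (t : ℝ) : rearr (Ioi 0) (fun _ => (1 : ℝ)) t = 1 := by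
  refine le_antisymm (sInf_le ⟨1, ⟨one_pos, by simp⟩, by simp⟩) ?_
  rw [← ENNReal.ofReal_one]
  refine le_rearr_of_volume_eq_top ?_ t
  simp only [abs_one, le_refl, and_true]
  exact Real.volume_Ioi

/-- If `x₀ + x₁ = 1` a.e. on the half-line, then one of `|x₀|`, `|x₁|` is at least
`1/2` on a set of infinite measure. -/
lemma volume_half_le_eq_top_or {x₀ x₁ : ℝ → ℝ}
    (h : ∀ᵐ t ∂(volume.restrict (Ioi (0:ℝ))), x₀ t + x₁ t = 1) :
    volume {s | s ∈ Ioi (0 : ℝ) ∧ 1 / 2 ≤ |x₀ s|} = ⊤ ∨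
      volume {s | s ∈ Ioi (0 : ℝ) ∧ 1 / 2 ≤ |x₁ s|} = ⊤ := by
  rw [← ENNReal.add_eq_top, eq_top_iff, ← Real.volume_Ioi (a := 0)]
  refine le_trans (measure_mono_ae ?_) (measure_union_le _ _)
  filter_upwards [(ae_restrict_iff' measurableSet_Ioi).1 h] with s hs hpos
  have hs := hs hpos
  rcases le_or_gt (1 / 2) |x₀ s| with h0 | h0
  · exact Or.inl ⟨hpos, h0⟩
  · refine Or.inr ⟨hpos, ?_⟩
    have := le_abs_self (x₀ s)
    have := le_abs_self (x₁ s)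
    linarith

/-- One of the two Lorentz integrals is infinite for every decomposition of the constant `1`. -/
lemma lintegral_rearr_eq_top_or (w : ℝ → ℝ) {x₀ x₁ : ℝ → ℝ}
    (h : ∀ᵐ t ∂(volume.restrict (Ioi (0:ℝ))), x₀ t + x₁ t = 1) :
    (∫⁻ t in Ioi (0:ℝ), rearr (Ioi 0) x₀ t * ENNReal.ofReal (w0fun w t)) = ⊤ ∨
      (∫⁻ t in Ioi (0:ℝ), rearr (Ioi 0) x₁ t * ENNReal.ofReal (w1fun w t)) = ⊤ := by
  have hb : ENNReal.ofReal (1 / 2) ≠ 0 := by simp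
  refine (volume_half_le_eq_top_or h).imp (fun h0 => ?_) fun h1 => ?_
  · refine lintegral_eq_top_of_le_on_Ioo _ hb (Or.inr rfl) fun n t ht => ?_
    have : w0fun w t = 1 :=
      tsum_indicator_of_mem_odd _ _ (n := n) ⟨ht.1, by linarith [ht.2]⟩
    rw [this, ENNReal.ofReal_one, mul_one]
    exact le_rearr_of_volume_eq_top h0 t
  · refine lintegral_eq_top_of_le_on_Ioo _ hb (Or.inl rfl) fun n t ht => ?_
    have : w1fun w t = 1 :=
      tsum_indicator_of_mem_even _ _ (n := n) (by simpa using ht)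
    rw [this, ENNReal.ofReal_one, mul_one]
    exact le_rearr_of_volume_eq_top h1 t

lemma min_w0fun_w1fun {w : ℝ → ℝ} {t : ℝ} (ht : 0 < t) (hw : w t ≤ 1)
    (hint : t ∉ range ((↑) : ℕ → ℝ)) : min (w0fun w t) (w1fun w t) = w t := by
  obtain ⟨n, hn | hn⟩ := exists_mem_Ioo_even_or_odd ht hint
  · rw [w0fun, w1fun, tsum_indicator_of_mem_even _ _ hn, tsum_indicator_of_mem_even _ _ hn,
      min_eq_left hw]
  · rw [w0fun, w1fun, tsum_indicator_of_mem_odd _ _ hn, tsum_indicator_of_mem_odd _ _ hn,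
      min_eq_right hw]

/-- for every decomposition `x₀ + x₁ = 1` a.e. with `x₀, x₁ ≥ 0` one of
`∫ x₀* w₀`, `∫ x₁* w₁` is infinite; consequently the constant function `1`, which
satisfies `∫ 1*·min(w₀,w₁) = ∫ w < ∞`, does not belong to `Λ_{1,w₀} + Λ_{1,w₁}`. -/
theorem stmt6 (w : ℝ → ℝ)
    (hw_anti : AntitoneOn w (Ioi 0)) (hw_cont : ContinuousOn w (Ioi 0))
    (hw_pos : ∀ t > (0:ℝ), 0 < w t) (hw_le : ∀ t > (0:ℝ), w t ≤ 1)
    (hw_int : (∫⁻ t in Ioi (0:ℝ), ENNReal.ofReal (w t)) < ⊤) :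
    (∀ x₀ x₁ : ℝ → ℝ, Measurable x₀ → Measurable x₁ →
      (∀ᵐ t ∂(volume.restrict (Ioi (0:ℝ))), 0 ≤ x₀ t ∧ 0 ≤ x₁ t ∧ x₀ t + x₁ t = 1) →
      (∫⁻ t in Ioi (0:ℝ), rearr (Ioi 0) x₀ t * ENNReal.ofReal (w0fun w t)) = ⊤ ∨
      (∫⁻ t in Ioi (0:ℝ), rearr (Ioi 0) x₁ t * ENNReal.ofReal (w1fun w t)) = ⊤) ∧
    (∫⁻ t in Ioi (0:ℝ),
        rearr (Ioi 0) (fun _ => (1:ℝ)) t *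
          ENNReal.ofReal (min (w0fun w t) (w1fun w t)))
      = ∫⁻ t in Ioi (0:ℝ), ENNReal.ofReal (w t) ∧
    ¬ ∃ x₀ x₁ : ℝ → ℝ, Measurable x₀ ∧ Measurable x₁ ∧
        (∀ᵐ t ∂(volume.restrict (Ioi (0:ℝ))), x₀ t + x₁ t = 1) ∧
        (∫⁻ t in Ioi (0:ℝ), rearr (Ioi 0) x₀ t * ENNReal.ofReal (w0fun w t)) < ⊤ ∧
        (∫⁻ t in Ioi (0:ℝ), rearr (Ioi 0) x₁ t * ENNReal.ofReal (w1fun w t)) < ⊤ := by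
  refine ⟨fun x₀ x₁ _ _ h => lintegral_rearr_eq_top_or w (h.mono fun _ ht => ht.2.2), ?_, ?_⟩
  · refine setLIntegral_congr_fun_ae measurableSet_Ioi ?_
    filter_upwards [(countable_range ((↑) : ℕ → ℝ)).ae_notMem volume] with t hint ht
    rw [rearr_one, one_mul, min_w0fun_w1fun ht (hw_le t ht) hint]
  · rintro ⟨x₀, x₁, -, -, h, h0, h1⟩
    rcases lintegral_rearr_eq_top_or w h with h' | h'
    · exact h0.ne h'
    · exact h1.ne h'
end

section
/- Let w : (0,∞) → (0,1] be a nonincreasing continuous function with ∫_0^∞ w(t) dt < ∞, and define w_0 = ∑_{n=0}^∞ ( w·χ_{(2n,2n+1)} + χ_{(2n+1,2n+2)} ). Let x_0 = χ_{∪_{n=0}^∞ (2n,2n+1)}. Then ∫_0^∞ x_0(t) w_0(t) dt ≤ ∫_0^∞ w(t) dt < ∞ (so x_0 ∈ L^1(w_0)), while for every n ∈ ℕ and every r > 0 one has ∫_{2n}^∞ x_0(s)^r s^{-1} ds = ∞, i.e., H_r^* x_0(t) = ∞ for all t. Hence for no r > 0 is the operator H_r^* bounded on L^1(w_0). -/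
open MeasureTheory Set
open scoped ENNReal

/-- `x₀ = χ_{∪ₙ (2n,2n+1)}`. -/
noncomputable def x0fun : ℝ → ℝ :=
  ({t : ℝ | ∃ n : ℕ, 2*(n:ℝ) < t ∧ t < 2*(n:ℝ)+1}).indicator (fun _ => (1:ℝ))

lemma measurableSet_x0_support :
    MeasurableSet {t : ℝ | ∃ n : ℕ, 2*(n:ℝ) < t ∧ t < 2*(n:ℝ)+1} := by
  have h : {t : ℝ | ∃ n : ℕ, 2*(n:ℝ) < t ∧ t < 2*(n:ℝ)+1}
      = ⋃ n : ℕ, Ioo (2*(n:ℝ)) (2*(n:ℝ)+1) := by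
    ext t
    simp
  rw [h]
  exact MeasurableSet.iUnion fun _ => measurableSet_Ioo

lemma measurable_x0fun : Measurable x0fun :=
  measurable_const.indicator measurableSet_x0_support

lemma x0fun_nonneg (t : ℝ) : 0 ≤ x0fun t :=
  indicator_nonneg (fun _ _ => zero_le_one) t

lemma x0fun_eq_one {n : ℕ} {t : ℝ} (ht : t ∈ Ioo (2*(n:ℝ)) (2*(n:ℝ)+1)) : x0fun t = 1 :=
  indicator_of_mem (show t ∈ {t : ℝ | ∃ n : ℕ, 2*(n:ℝ) < t ∧ t < 2*(n:ℝ)+1} from ⟨n, ht⟩) _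

lemma w0fun_eq {w : ℝ → ℝ} {n : ℕ} {t : ℝ} (ht : t ∈ Ioo (2*(n:ℝ)) (2*(n:ℝ)+1)) :
    w0fun w t = w t := by
  obtain ⟨h1, h2⟩ := ht
  have hodd : ∀ m : ℕ, t ∉ Ioo (2*(m:ℝ)+1) (2*(m:ℝ)+2) := by
    rintro m ⟨h3, h4⟩
    have h5 : 2 * m + 1 < 2 * n + 1 := by exact_mod_cast h3.trans h2
    have h6 : 2 * n < 2 * m + 2 := by exact_mod_cast h1.trans h4
    omega
  rw [w0fun, tsum_eq_single n]
  · rw [indicator_of_mem (show t ∈ Ioo (2*(n:ℝ)) (2*(n:ℝ)+1) from ⟨h1, h2⟩), indicator_of_notMem (hodd n), add_zero]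
  · intro m hm
    have heven : t ∉ Ioo (2*(m:ℝ)) (2*(m:ℝ)+1) := by
      rintro ⟨h3, h4⟩
      have h5 : 2 * m < 2 * n + 1 := by exact_mod_cast h3.trans h2
      have h6 : 2 * n < 2 * m + 1 := by exact_mod_cast h1.trans h4
      omega
    rw [indicator_of_notMem heven, indicator_of_notMem (hodd m), add_zero]

lemma x0fun_mul_w0fun_le (w : ℝ → ℝ) (t : ℝ) :
    ENNReal.ofReal (x0fun t) * ENNReal.ofReal (w0fun w t) ≤ ENNReal.ofReal (w t) := by
  by_cases ht : ∃ n : ℕ, 2*(n:ℝ) < t ∧ t < 2*(n:ℝ)+1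
  · obtain ⟨n, hn⟩ := ht
    rw [x0fun_eq_one hn, w0fun_eq hn, ENNReal.ofReal_one, one_mul]
  · have h : x0fun t = 0 := indicator_of_notMem
      (show t ∉ {t : ℝ | ∃ n : ℕ, 2*(n:ℝ) < t ∧ t < 2*(n:ℝ)+1} from ht) _
    simp [h]

lemma tsum_inv_two_mul_add_eq_top (N : ℕ) :
    ∑' n : ℕ, ENNReal.ofReal (1 / (2*((n + N : ℕ):ℝ)+1)) = ⊤ := by
  by_contra h
  have hs := ENNReal.summable_toReal h
  have hs2 : Summable fun n : ℕ => (2*(N:ℝ)+2) * (1 / (2*((n + N : ℕ):ℝ)+1)) := by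
    refine Summable.mul_left _ (hs.congr fun n => ?_)
    exact ENNReal.toReal_ofReal (by positivity)
  refine Real.not_summable_one_div_natCast ((summable_nat_add_iff 1).1 ?_)
  refine Summable.of_nonneg_of_le (fun n => by positivity) (fun n => ?_) hs2
  rw [mul_one_div, div_le_div_iff₀ (by positivity) (by positivity)]
  push_cast
  nlinarith [mul_nonneg (Nat.cast_nonneg (α := ℝ) N) (Nat.cast_nonneg (α := ℝ) n)]

lemma lintegral_x0fun_rpow_div_eq_top (r t : ℝ) :
    (∫⁻ s in Ioi t, ENNReal.ofReal (x0fun s ^ r) / ENNReal.ofReal s) = ⊤ := by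
  obtain ⟨N, hN⟩ := exists_nat_ge t
  have hsub : (⋃ n : ℕ, Ioo (2*((n + N : ℕ):ℝ)) (2*((n + N : ℕ):ℝ)+1)) ⊆ Ioi t := by
    refine iUnion_subset fun n s hs => ?_
    have h1 := hs.1
    push_cast at h1
    have hn : (0:ℝ) ≤ n := n.cast_nonneg
    have hN0 : (0:ℝ) ≤ N := N.cast_nonneg
    exact show t < s by linarith
  have hdisj : Pairwise (Function.onFun Disjoint
      fun n : ℕ => Ioo (2*((n + N : ℕ):ℝ)) (2*((n + N : ℕ):ℝ)+1)) := by
    intro m n hmn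
    refine Set.disjoint_left.2 ?_
    rintro s ⟨h1, h2⟩ ⟨h3, h4⟩
    have h5 : 2 * (m + N) < 2 * (n + N) + 1 := by exact_mod_cast h1.trans h4
    have h6 : 2 * (n + N) < 2 * (m + N) + 1 := by exact_mod_cast h3.trans h2
    omega
  refine top_le_iff.1 (le_trans ?_ (lintegral_mono_set hsub))
  rw [lintegral_iUnion (fun _ => measurableSet_Ioo) hdisj, ← tsum_inv_two_mul_add_eq_top N]
  refine ENNReal.tsum_le_tsum fun n => ?_
  calc ENNReal.ofReal (1 / (2*((n + N : ℕ):ℝ)+1))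
      = ∫⁻ _ in Ioo (2*((n + N : ℕ):ℝ)) (2*((n + N : ℕ):ℝ)+1),
          ENNReal.ofReal (1 / (2*((n + N : ℕ):ℝ)+1)) := by simp
    _ ≤ _ := by
      refine setLIntegral_mono' measurableSet_Ioo fun s hs => ?_
      have hs0 : 0 < s := lt_of_le_of_lt (by positivity) hs.1
      rw [x0fun_eq_one hs, Real.one_rpow, ← ENNReal.ofReal_div_of_pos hs0]
      exact ENNReal.ofReal_le_ofReal (one_div_le_one_div_of_le hs0 hs.2.le)

/-- `∫ x₀ w₀ ≤ ∫ w < ∞` (so `x₀ ∈ L¹(w₀)`), while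
`∫_{2n}^∞ x₀(s)^r s⁻¹ ds = ∞` for all `n` and all `r > 0` (i.e. `H_r^* x₀ ≡ ∞`);
hence for no `r > 0` is `H_r^*` bounded on `L¹(w₀)`. -/
theorem stmt7 (w : ℝ → ℝ)
    (hw_anti : AntitoneOn w (Ioi 0)) (hw_cont : ContinuousOn w (Ioi 0))
    (hw_pos : ∀ t > (0:ℝ), 0 < w t) (hw_le : ∀ t > (0:ℝ), w t ≤ 1)
    (hw_int : (∫⁻ t in Ioi (0:ℝ), ENNReal.ofReal (w t)) < ⊤) :
    (∫⁻ t in Ioi (0:ℝ), ENNReal.ofReal (x0fun t) * ENNReal.ofReal (w0fun w t))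
        ≤ (∫⁻ t in Ioi (0:ℝ), ENNReal.ofReal (w t)) ∧
    (∫⁻ t in Ioi (0:ℝ), ENNReal.ofReal (x0fun t) * ENNReal.ofReal (w0fun w t)) < ⊤ ∧
    (∀ r > (0:ℝ), ∀ n : ℕ,
      (∫⁻ s in Ioi (2*(n:ℝ)), ENNReal.ofReal (x0fun s ^ r) / ENNReal.ofReal s) = ⊤) ∧
    (∀ r > (0:ℝ), ∀ t > (0:ℝ),
      (∫⁻ s in Ioi t, ENNReal.ofReal (x0fun s ^ r) / ENNReal.ofReal s) = ⊤) ∧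
    (∀ r > (0:ℝ), ¬ ∃ C : ℝ≥0∞, C < ⊤ ∧ ∀ x : ℝ → ℝ, Measurable x →
      (∫⁻ t in Ioi (0:ℝ),
          (∫⁻ s in Ioi t, ENNReal.ofReal (|x s| ^ r) / ENNReal.ofReal s) ^ (1/r) *
            ENNReal.ofReal (w0fun w t))
        ≤ C * ∫⁻ t in Ioi (0:ℝ), ENNReal.ofReal |x t| * ENNReal.ofReal (w0fun w t)) := by
  have hle : (∫⁻ t in Ioi (0:ℝ), ENNReal.ofReal (x0fun t) * ENNReal.ofReal (w0fun w t))
      ≤ ∫⁻ t in Ioi (0:ℝ), ENNReal.ofReal (w t) :=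
    lintegral_mono fun t => x0fun_mul_w0fun_le w t
  refine ⟨hle, hle.trans_lt hw_int, fun r _ n => lintegral_x0fun_rpow_div_eq_top r _,
    fun r _ t _ => lintegral_x0fun_rpow_div_eq_top r t, ?_⟩
  rintro r hr ⟨C, hC, hbound⟩
  have h := hbound x0fun measurable_x0fun
  simp only [abs_of_nonneg (x0fun_nonneg _), lintegral_x0fun_rpow_div_eq_top,
    ENNReal.top_rpow_of_pos (one_div_pos.2 hr)] at h
  refine (h.trans_lt (ENNReal.mul_lt_top hC (hle.trans_lt hw_int))).ne (top_le_iff.1 ?_)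
  have hsub : Ioo (0:ℝ) 1 ⊆ Ioi 0 := fun _ ht => ht.1
  refine le_trans ?_ (lintegral_mono_set hsub)
  calc (⊤ : ℝ≥0∞) = ∫⁻ _ in Ioo (0:ℝ) 1, ⊤ := by simp
    _ ≤ _ := by
      refine setLIntegral_mono' measurableSet_Ioo fun t ht => ?_
      have hw0 : w0fun w t = w t := w0fun_eq (n := 0) (by simpa using ht)
      rw [hw0, ENNReal.top_mul (ENNReal.ofReal_pos.2 (hw_pos t ht.1)).ne']
end

section
/- Let w : (0,∞) → (0,1] be a nonincreasing continuous function with ∫_0^∞ w(t) dt < ∞, and define w_0 = ∑_{n=0}^∞ ( w·χ_{(2n,2n+1)} + χ_{(2n+1,2n+2)} ). Let r ≥ 1. Then ∫_1^∞ t^{-1/r} w_0(t) dt = ∞; consequently the nonnegative nonincreasing function χ_{(0,1)} belongs to L^1(w_0) while ∫_0^∞ H_r(χ_{(0,1)})(t) w_0(t) dt = ∞, so the operator H_r is not bounded on the cone of nonnegative nonincreasing functions in L^1(w_0). -/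
open MeasureTheory Set
open scoped ENNReal

lemma w0fun_eq_of_mem_Ioo_zero_one (w : ℝ → ℝ) {t : ℝ} (ht : t ∈ Ioo (0:ℝ) 1) :
    w0fun w t = w t := by
  rw [w0fun, tsum_eq_single 0]
  · have h : t ∉ Ioo (1:ℝ) 2 := fun h => by linarith [h.1, ht.2]
    simp [ht, h]
  · intro m hm
    have hm : (1:ℝ) ≤ m := by exact_mod_cast Nat.one_le_iff_ne_zero.2 hm
    rw [indicator_of_notMem, indicator_of_notMem, add_zero]
    · intro h; linarith [h.1, ht.2]
    · intro h; linarith [h.1, ht.2]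

lemma w0fun_eq_one_of_mem_Ioo (w : ℝ → ℝ) (n : ℕ) {t : ℝ}
    (ht : t ∈ Ioo (2*(n:ℝ)+1) (2*(n:ℝ)+2)) : w0fun w t = 1 := by
  rw [w0fun, tsum_eq_single n]
  · rw [indicator_of_notMem (fun h => by linarith [h.2, ht.1]), indicator_of_mem ht, zero_add]
  · intro m hm
    rcases lt_or_gt_of_ne hm with h | h
    · have h : (m:ℝ) + 1 ≤ n := by exact_mod_cast h
      rw [indicator_of_notMem, indicator_of_notMem, add_zero]
      · intro h'; linarith [h'.2, ht.1]
      · intro h'; linarith [h'.2, ht.1]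
    · have h : (n:ℝ) + 1 ≤ m := by exact_mod_cast h
      rw [indicator_of_notMem, indicator_of_notMem, add_zero]
      · intro h'; linarith [h'.1, ht.2]
      · intro h'; linarith [h'.1, ht.2]

lemma tsum_ofReal_inv_two_mul_add_two :
    ∑' n : ℕ, ENNReal.ofReal (2*(n:ℝ)+2)⁻¹ = ⊤ := by
  by_contra h
  have hs := (ENNReal.summable_toReal h).mul_left 2
  refine Real.not_summable_natCast_inv ((summable_nat_add_iff 1).1 (hs.congr fun n => ?_))
  rw [ENNReal.toReal_ofReal (by positivity)]
  push_cast
  field_simp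

lemma lintegral_rpow_mul_w0fun_eq_top (w : ℝ → ℝ) {r : ℝ} (hr : 1 ≤ r) :
    (∫⁻ t in Ioi (1:ℝ),
      ENNReal.ofReal (t ^ (-(1/r))) * ENNReal.ofReal (w0fun w t)) = ⊤ := by
  have hdisj : Pairwise (Function.onFun Disjoint
      fun n : ℕ => Ioo (2*(n:ℝ)+1) (2*(n:ℝ)+2)) := by
    refine (pairwise_disjoint_on _).2 fun m n hmn => ?_
    have hmn : (m:ℝ) + 1 ≤ n := by exact_mod_cast hmn
    exact Set.disjoint_left.2 fun t h h' => by linarith [h.2, h'.1]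
  have hsub : (⋃ n : ℕ, Ioo (2*(n:ℝ)+1) (2*(n:ℝ)+2)) ⊆ Ioi 1 :=
    iUnion_subset fun n t ht => by
      have : (0:ℝ) ≤ n := n.cast_nonneg
      exact mem_Ioi.2 (by linarith [ht.1])
  refine top_unique (le_trans ?_ (lintegral_mono_set hsub))
  rw [lintegral_iUnion (fun _ => measurableSet_Ioo) hdisj, ← tsum_ofReal_inv_two_mul_add_two]
  refine ENNReal.tsum_le_tsum fun n => ?_
  have hn : (0:ℝ) ≤ n := n.cast_nonneg
  calc ENNReal.ofReal (2*(n:ℝ)+2)⁻¹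
      = ∫⁻ _ in Ioo (2*(n:ℝ)+1) (2*(n:ℝ)+2), ENNReal.ofReal (2*(n:ℝ)+2)⁻¹ := by
        rw [setLIntegral_const, Real.volume_Ioo]
        norm_num
    _ ≤ _ := by
        refine setLIntegral_mono' measurableSet_Ioo fun t ht => ?_
        have h1 : 1 ≤ t := by linarith [ht.1]
        rw [w0fun_eq_one_of_mem_Ioo w n ht, ENNReal.ofReal_one, mul_one]
        refine ENNReal.ofReal_le_ofReal ?_
        calc (2*(n:ℝ)+2)⁻¹ ≤ t⁻¹ := inv_anti₀ (by linarith) ht.2.le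
          _ = t ^ (-1:ℝ) := (Real.rpow_neg_one t).symm
          _ ≤ t ^ (-(1/r)) := by
            refine Real.rpow_le_rpow_of_exponent_le h1 (neg_le_neg ?_)
            exact (div_le_one (by linarith)).2 hr

lemma ofReal_rpow_le_hardy_indicator {r t : ℝ} (hr : 1 ≤ r) (ht : 1 < t) :
    ENNReal.ofReal (t ^ (-(1/r))) ≤
      ((ENNReal.ofReal t)⁻¹ *
        ∫⁻ s in Ioo (0:ℝ) t,
          ENNReal.ofReal (|(Ioo (0:ℝ) 1).indicator (fun _ => (1:ℝ)) s| ^ r)) ^ (1/r) := by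
  have ht0 : 0 < t := by linarith
  have hI : 1 ≤ ∫⁻ s in Ioo (0:ℝ) t,
      ENNReal.ofReal (|(Ioo (0:ℝ) 1).indicator (fun _ => (1:ℝ)) s| ^ r) := by
    calc (1:ℝ≥0∞) = ∫⁻ _ in Ioo (0:ℝ) 1, 1 := by
          rw [setLIntegral_const, Real.volume_Ioo]
          norm_num
      _ ≤ ∫⁻ s in Ioo (0:ℝ) 1,
            ENNReal.ofReal (|(Ioo (0:ℝ) 1).indicator (fun _ => (1:ℝ)) s| ^ r) := by
          refine setLIntegral_mono' measurableSet_Ioo fun s hs => ?_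
          rw [indicator_of_mem hs]
          simp
      _ ≤ _ := lintegral_mono_set (Ioo_subset_Ioo_right ht.le)
  have hr0 : 0 ≤ 1/r := by positivity
  rw [Real.rpow_neg ht0.le, ENNReal.ofReal_inv_of_pos (by positivity),
    ← ENNReal.ofReal_rpow_of_pos ht0, ← ENNReal.inv_rpow]
  exact ENNReal.rpow_le_rpow (le_mul_of_one_le_right' hI) hr0

/-- for `r ≥ 1` one has `∫_1^∞ t^{-1/r} w₀(t) dt = ∞`; consequently
`χ_{(0,1)} ∈ L¹(w₀)` while `∫_0^∞ H_r(χ_{(0,1)})(t) w₀(t) dt = ∞`, so `H_r` is not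
bounded on the cone of nonnegative nonincreasing functions in `L¹(w₀)`. -/
theorem stmt8 (w : ℝ → ℝ)
    (hw_anti : AntitoneOn w (Ioi 0)) (hw_cont : ContinuousOn w (Ioi 0))
    (hw_pos : ∀ t > (0:ℝ), 0 < w t) (hw_le : ∀ t > (0:ℝ), w t ≤ 1)
    (hw_int : (∫⁻ t in Ioi (0:ℝ), ENNReal.ofReal (w t)) < ⊤)
    (r : ℝ) (hr : 1 ≤ r) :
    (∫⁻ t in Ioi (1:ℝ),
        ENNReal.ofReal (t ^ (-(1/r))) * ENNReal.ofReal (w0fun w t)) = ⊤ ∧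
    (∫⁻ t in Ioi (0:ℝ),
        ENNReal.ofReal ((Ioo (0:ℝ) 1).indicator (fun _ => (1:ℝ)) t) *
          ENNReal.ofReal (w0fun w t)) < ⊤ ∧
    (∫⁻ t in Ioi (0:ℝ),
        ((ENNReal.ofReal t)⁻¹ *
            ∫⁻ s in Ioo (0:ℝ) t,
              ENNReal.ofReal (|(Ioo (0:ℝ) 1).indicator (fun _ => (1:ℝ)) s| ^ r)) ^ (1/r) *
          ENNReal.ofReal (w0fun w t)) = ⊤ := by
  refine ⟨lintegral_rpow_mul_w0fun_eq_top w hr, ?_, ?_⟩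
  · refine lt_of_le_of_lt (setLIntegral_mono' measurableSet_Ioi fun t _ => ?_) hw_int
    by_cases ht : t ∈ Ioo (0:ℝ) 1
    · rw [w0fun_eq_of_mem_Ioo_zero_one w ht, indicator_of_mem ht, ENNReal.ofReal_one, one_mul]
    · simp [indicator_of_notMem ht]
  · refine top_unique ?_
    rw [← lintegral_rpow_mul_w0fun_eq_top w hr]
    refine le_trans ?_ (lintegral_mono_set (Ioi_subset_Ioi zero_le_one))
    refine setLIntegral_mono' measurableSet_Ioi fun t ht => ?_
    gcongr
    exact ofReal_rpow_le_hardy_indicator hr ht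
end

section
/- For n ≥ 1 let A_n=(2^{-n},2^{-n+1}), B_n=(2^{-n},3·2^{-n-1}), C_n=(3·2^{-n-1},2^{-n+1}), a_n=(3/2)^n, and define weights on (0,1): w = ∑_{n≥1}(χ_{B_n} + a_n χ_{C_n}) and v = ∑_{n≥1} a_n χ_{A_n}. Then: (a) w(2t) ≤ w(t) for a.e. t ∈ (0,1/2), and hence ∫_0^1 |x(t/2)| w(t) dt ≤ 2 ∫_0^1 |x(t)| w(t) dt for every measurable x on (0,1) (extending x(t/2) by 0 for t ≥ 1); (b) for every nonincreasing x : (0,1) → [0,∞), ∫_0^1 x(t) v(t) dt ≤ 4 ∫_0^1 x(t) w(t) dt. Since moreover w ≤ v pointwise, a nonincreasing x ≥ 0 satisfies ∫_0^1 x w < ∞ if and only if ∫_0^1 x v < ∞; i.e., the symmetrizations of L^1(w) and L^1(v) coincide: (L^1(w))^{(*)} = Λ_{1,v}. -/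
open MeasureTheory Set
open scoped ENNReal

/-- `w = ∑_{n≥1} (χ_{B_n} + a_n χ_{C_n})` with `B_n = (2^{-n}, 3·2^{-n-1})`,
`C_n = (3·2^{-n-1}, 2^{-n+1})`, `a_n = (3/2)^n` (here summed over `n+1`, `n : ℕ`). -/
noncomputable def wgt (t : ℝ) : ℝ :=
  ∑' n : ℕ,
    ((Ioo ((2:ℝ)^(-(n:ℤ)-1)) (3*(2:ℝ)^(-(n:ℤ)-2))).indicator (fun _ => (1:ℝ)) t
      + (Ioo (3*(2:ℝ)^(-(n:ℤ)-2)) ((2:ℝ)^(-(n:ℤ)))).indicator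
          (fun _ => ((3:ℝ)/2)^(n+1)) t)

/-- `v = ∑_{n≥1} a_n χ_{A_n}` with `A_n = (2^{-n}, 2^{-n+1})`, `a_n = (3/2)^n`. -/
noncomputable def vgt (t : ℝ) : ℝ :=
  ∑' n : ℕ,
    (Ioo ((2:ℝ)^(-(n:ℤ)-1)) ((2:ℝ)^(-(n:ℤ)))).indicator (fun _ => ((3:ℝ)/2)^(n+1)) t

theorem zpow_neg_nat_eq (n : ℕ) : (2:ℝ)^(-(n:ℤ)) = 4 * (2:ℝ)^(-(n:ℤ)-2) := by
  rw [zpow_sub₀ two_ne_zero]; norm_num; ring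

theorem zpow_neg_nat_sub_one_eq (n : ℕ) :
    (2:ℝ)^(-(n:ℤ)-1) = 2 * (2:ℝ)^(-(n:ℤ)-2) := by
  rw [zpow_sub₀ two_ne_zero, zpow_sub₀ two_ne_zero]; norm_num; ring

theorem zpow_neg_succ_eq (n : ℕ) :
    (2:ℝ)^(-((n+1:ℕ):ℤ)) = 2 * (2:ℝ)^(-(n:ℤ)-2) := by
  rw [← zpow_neg_nat_sub_one_eq]; congr 1; push_cast; ring

theorem zpow_neg_succ_sub_two_eq (n : ℕ) :
    (2:ℝ)^(-((n+1:ℕ):ℤ)-2) = (2:ℝ)^(-(n:ℤ)-2) / 2 := by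
  have := zpow_neg_nat_eq (n+1)
  rw [zpow_neg_succ_eq] at this
  linarith

/-- The dyadic interval `(2^{-n-1}, 2^{-n})`. -/
def dyadicIoo (n : ℕ) : Set ℝ := Ioo ((2:ℝ)^(-(n:ℤ)-1)) ((2:ℝ)^(-(n:ℤ)))

/-- The left half of `dyadicIoo n`. -/
def dyadicLeft (n : ℕ) : Set ℝ := Ioo ((2:ℝ)^(-(n:ℤ)-1)) (3*(2:ℝ)^(-(n:ℤ)-2))

/-- The right half of `dyadicIoo n`. -/
def dyadicRight (n : ℕ) : Set ℝ := Ioo (3*(2:ℝ)^(-(n:ℤ)-2)) ((2:ℝ)^(-(n:ℤ)))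

/-- The `n`-th term of the series defining `wgt`. -/
noncomputable def wgtTerm (n : ℕ) (t : ℝ) : ℝ :=
  (dyadicLeft n).indicator (fun _ => (1:ℝ)) t
    + (dyadicRight n).indicator (fun _ => ((3:ℝ)/2)^(n+1)) t

/-- The `n`-th term of the series defining `vgt`. -/
noncomputable def vgtTerm (n : ℕ) (t : ℝ) : ℝ :=
  (dyadicIoo n).indicator (fun _ => ((3:ℝ)/2)^(n+1)) t

theorem wgt_eq_tsum (t : ℝ) : wgt t = ∑' n, wgtTerm n t := rfl

theorem vgt_eq_tsum (t : ℝ) : vgt t = ∑' n, vgtTerm n t := rfl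

theorem zpow_neg_nat_sub_two_pos (n : ℕ) : 0 < (2:ℝ)^(-(n:ℤ)-2) := by positivity

theorem dyadicLeft_subset (n : ℕ) : dyadicLeft n ⊆ dyadicIoo n := by
  have := zpow_neg_nat_sub_two_pos n
  refine Ioo_subset_Ioo_right ?_
  rw [zpow_neg_nat_eq]; linarith

theorem dyadicRight_subset (n : ℕ) : dyadicRight n ⊆ dyadicIoo n := by
  have := zpow_neg_nat_sub_two_pos n
  refine Ioo_subset_Ioo_left ?_
  rw [zpow_neg_nat_sub_one_eq]; linarith

theorem dyadicIoo_subset (n : ℕ) : dyadicIoo n ⊆ Ioo 0 1 := by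
  refine Ioo_subset_Ioo (by positivity) ?_
  exact zpow_le_one_of_nonpos₀ one_le_two (by simp)

theorem disjoint_dyadicLeft_dyadicRight (n : ℕ) :
    Disjoint (dyadicLeft n) (dyadicRight n) := by
  rw [Set.disjoint_left]
  rintro t ⟨-, h⟩ ⟨h', -⟩
  exact lt_asymm h h'

theorem eq_of_mem_dyadicIoo {m n : ℕ} {t : ℝ} (hm : t ∈ dyadicIoo m)
    (hn : t ∈ dyadicIoo n) : m = n := by
  have key : ∀ {m n : ℕ}, t ∈ dyadicIoo m → t ∈ dyadicIoo n → m ≤ n := by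
    intro m n hm hn
    have := (zpow_lt_zpow_iff_right₀ (one_lt_two (α := ℝ))).1 (hn.1.trans hm.2)
    omega
  exact le_antisymm (key hm hn) (key hn hm)

theorem wgtTerm_nonneg (n : ℕ) (t : ℝ) : 0 ≤ wgtTerm n t :=
  add_nonneg (indicator_nonneg (fun _ _ => zero_le_one) _)
    (indicator_nonneg (fun _ _ => by positivity) _)

theorem vgtTerm_nonneg (n : ℕ) (t : ℝ) : 0 ≤ vgtTerm n t :=
  indicator_nonneg (fun _ _ => by positivity) _

theorem wgtTerm_le_vgtTerm (n : ℕ) (t : ℝ) : wgtTerm n t ≤ vgtTerm n t := by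
  have ha : (1:ℝ) ≤ ((3:ℝ)/2)^(n+1) := one_le_pow₀ (by norm_num)
  unfold wgtTerm vgtTerm
  by_cases hB : t ∈ dyadicLeft n
  · rw [indicator_of_mem hB, indicator_of_mem (dyadicLeft_subset n hB), indicator_of_notMem
      (Set.disjoint_left.1 (disjoint_dyadicLeft_dyadicRight n) hB)]
    simpa using ha
  · rw [indicator_of_notMem hB, zero_add]
    exact indicator_le_indicator_of_subset (dyadicRight_subset n) (fun _ => by positivity) t

theorem summable_vgtTerm (t : ℝ) : Summable fun n => vgtTerm n t := by
  refine summable_of_hasFiniteSupport (Set.Subsingleton.finite ?_)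
  intro m hm n hn
  exact eq_of_mem_dyadicIoo (mem_of_indicator_ne_zero hm) (mem_of_indicator_ne_zero hn)

theorem summable_wgtTerm (t : ℝ) : Summable fun n => wgtTerm n t :=
  (summable_vgtTerm t).of_nonneg_of_le (fun n => wgtTerm_nonneg n t)
    fun n => wgtTerm_le_vgtTerm n t

theorem wgt_le_vgt (t : ℝ) : wgt t ≤ vgt t :=
  (summable_wgtTerm t).tsum_le_tsum (fun n => wgtTerm_le_vgtTerm n t) (summable_vgtTerm t)

theorem wgtTerm_two_mul_le (n : ℕ) (t : ℝ) : wgtTerm n (2*t) ≤ wgtTerm (n+1) t := by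
  have hL : 2 * t ∈ dyadicLeft n ↔ t ∈ dyadicLeft (n+1) := by
    simp only [dyadicLeft, mem_Ioo, zpow_neg_nat_sub_one_eq, zpow_neg_succ_sub_two_eq]
    constructor <;> rintro ⟨h, h'⟩ <;> constructor <;> linarith
  have hR : 2 * t ∈ dyadicRight n ↔ t ∈ dyadicRight (n+1) := by
    simp only [dyadicRight, mem_Ioo, zpow_neg_nat_eq, zpow_neg_succ_sub_two_eq]
    constructor <;> rintro ⟨h, h'⟩ <;> constructor <;> linarith
  have ha : ((3:ℝ)/2)^(n+1) ≤ ((3:ℝ)/2)^(n+1+1) :=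
    pow_le_pow_right₀ (by norm_num) (Nat.le_succ _)
  refine add_le_add ?_ ?_
  · by_cases h : t ∈ dyadicLeft (n+1)
    · rw [indicator_of_mem h, indicator_of_mem (hL.2 h)]
    · rw [indicator_of_notMem h, indicator_of_notMem (mt hL.1 h)]
  · by_cases h : t ∈ dyadicRight (n+1)
    · rwa [indicator_of_mem h, indicator_of_mem (hR.2 h)]
    · rw [indicator_of_notMem h, indicator_of_notMem (mt hR.1 h)]

theorem wgt_two_mul_le (t : ℝ) : wgt (2*t) ≤ wgt t := by
  rw [wgt_eq_tsum, wgt_eq_tsum, (summable_wgtTerm t).tsum_eq_zero_add]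
  have := (summable_wgtTerm (2*t)).tsum_le_tsum (fun n => wgtTerm_two_mul_le n t)
    ((summable_nat_add_iff 1).2 (summable_wgtTerm t))
  linarith [wgtTerm_nonneg 0 t]

theorem lintegral_comp_half_mul_wgt_le (f : ℝ → ℝ≥0∞) :
    ∫⁻ t in Ioo (0:ℝ) 1, f (t/2) * ENNReal.ofReal (wgt t)
      ≤ 2 * ∫⁻ t in Ioo (0:ℝ) 1, f t * ENNReal.ofReal (wgt t) := by
  have himg : (fun t : ℝ => 2 * t) '' Ioo 0 (1/2) = Ioo 0 1 := by
    rw [Set.image_mul_left_Ioo two_pos]; norm_num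
  rw [← himg, lintegral_image_eq_lintegral_abs_deriv_mul (f' := fun _ => 2) measurableSet_Ioo
    (fun t _ => by simpa using ((hasDerivAt_id t).const_mul 2).hasDerivWithinAt)
    (fun a _ b _ h => by simpa using h), himg, lintegral_const_mul' _ _ (by simp)]
  simp only [abs_two, ENNReal.ofReal_ofNat]
  gcongr 2 * ?_
  calc _ ≤ ∫⁻ t in Ioo (0:ℝ) (1/2), f t * ENNReal.ofReal (wgt t) := by
        refine lintegral_mono fun t => ?_
        simp only [mul_div_cancel_left₀ t (two_ne_zero (α := ℝ))]
        gcongr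
        exact wgt_two_mul_le t
    _ ≤ _ := lintegral_mono_set (Ioo_subset_Ioo_right (by norm_num))

theorem setLIntegral_mul_ofReal_indicator {s : Set ℝ} (hs : MeasurableSet s)
    (hs' : s ⊆ Ioo 0 1) (f : ℝ → ℝ≥0∞) (c : ℝ) :
    ∫⁻ t in Ioo (0:ℝ) 1, f t * ENNReal.ofReal (s.indicator (fun _ => c) t)
      = ENNReal.ofReal c * ∫⁻ t in s, f t := by
  have : ∀ t, f t * ENNReal.ofReal (s.indicator (fun _ => c) t)
      = s.indicator (fun t => ENNReal.ofReal c * f t) t := by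
    intro t
    by_cases h : t ∈ s <;> simp [h, mul_comm]
  simp_rw [this]
  rw [setLIntegral_indicator hs, inter_eq_self_of_subset_left hs',
    lintegral_const_mul' _ _ ENNReal.ofReal_ne_top]

theorem lintegral_mul_vgt_eq_tsum {f : ℝ → ℝ≥0∞}
    (hf : AEMeasurable f (volume.restrict (Ioo 0 1))) :
    ∫⁻ t in Ioo (0:ℝ) 1, f t * ENNReal.ofReal (vgt t)
      = ∑' n : ℕ, ENNReal.ofReal (((3:ℝ)/2)^(n+1)) * ∫⁻ t in dyadicIoo n, f t := by
  have hm : ∀ n, Measurable fun t => ENNReal.ofReal (vgtTerm n t) := fun n =>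
    (measurable_const.indicator measurableSet_Ioo).ennreal_ofReal
  simp_rw [vgt_eq_tsum,
    ENNReal.ofReal_tsum_of_nonneg (fun n => vgtTerm_nonneg n _) (summable_vgtTerm _),
    ← ENNReal.tsum_mul_left]
  rw [lintegral_tsum fun n => hf.fun_mul (hm n).aemeasurable]
  exact tsum_congr fun n =>
    setLIntegral_mul_ofReal_indicator measurableSet_Ioo (dyadicIoo_subset n) f _

theorem lintegral_mul_wgt_eq_tsum {f : ℝ → ℝ≥0∞}
    (hf : AEMeasurable f (volume.restrict (Ioo 0 1))) :
    ∫⁻ t in Ioo (0:ℝ) 1, f t * ENNReal.ofReal (wgt t)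
      = ∑' n : ℕ, ((∫⁻ t in dyadicLeft n, f t)
        + ENNReal.ofReal (((3:ℝ)/2)^(n+1)) * ∫⁻ t in dyadicRight n, f t) := by
  have hl : ∀ n, Measurable ((dyadicLeft n).indicator fun _ => (1:ℝ)) := fun n =>
    measurable_const.indicator measurableSet_Ioo
  have hr : ∀ n, Measurable ((dyadicRight n).indicator fun _ => ((3:ℝ)/2)^(n+1)) := fun n =>
    measurable_const.indicator measurableSet_Ioo
  have hm : ∀ n, Measurable fun t => ENNReal.ofReal (wgtTerm n t) := fun n =>
    ((hl n).add (hr n)).ennreal_ofReal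
  simp_rw [wgt_eq_tsum,
    ENNReal.ofReal_tsum_of_nonneg (fun n => wgtTerm_nonneg n _) (summable_wgtTerm _),
    ← ENNReal.tsum_mul_left]
  rw [lintegral_tsum fun n => hf.fun_mul (hm n).aemeasurable]
  refine tsum_congr fun n => ?_
  have hsplit : ∀ t, f t * ENNReal.ofReal (wgtTerm n t)
      = f t * ENNReal.ofReal ((dyadicLeft n).indicator (fun _ => (1:ℝ)) t)
        + f t * ENNReal.ofReal ((dyadicRight n).indicator (fun _ => ((3:ℝ)/2)^(n+1)) t) := by
    intro t
    rw [wgtTerm, ENNReal.ofReal_add (indicator_nonneg (fun _ _ => zero_le_one) _)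
      (indicator_nonneg (fun _ _ => by positivity) _), mul_add]
  simp_rw [hsplit]
  rw [lintegral_add_left' (hf.fun_mul (hl n).ennreal_ofReal.aemeasurable),
    setLIntegral_mul_ofReal_indicator (s := dyadicLeft n) measurableSet_Ioo
      ((dyadicLeft_subset n).trans (dyadicIoo_subset n)),
    setLIntegral_mul_ofReal_indicator (s := dyadicRight n) measurableSet_Ioo
      ((dyadicRight_subset n).trans (dyadicIoo_subset n)), ENNReal.ofReal_one, one_mul]

theorem lintegral_dyadicIoo_le (f : ℝ → ℝ≥0∞) (n : ℕ) :
    ∫⁻ t in dyadicIoo n, f t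
      ≤ (∫⁻ t in dyadicLeft n, f t) + ∫⁻ t in dyadicRight n, f t := by
  unfold dyadicIoo dyadicLeft dyadicRight
  simp only [restrict_Ioo_eq_restrict_Ioc]
  exact (lintegral_mono_set Ioc_subset_Ioc_union_Ioc).trans (lintegral_union_le _ _ _)

/-- The left half of a dyadic interval lies to the right of the adjacent half interval
`dyadicRight (n+1)` and is twice as long. -/
theorem lintegral_dyadicLeft_le {f : ℝ → ℝ≥0∞} (hf : AntitoneOn f (Ioo 0 1)) (n : ℕ) :
    ∫⁻ t in dyadicLeft n, f t ≤ 2 * ∫⁻ t in dyadicRight (n+1), f t := by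
  set h : ℝ := (2:ℝ)^(-(n:ℤ)-2) with hh
  have hpos : 0 < h := zpow_neg_nat_sub_two_pos n
  have hL : dyadicLeft n = Ioo (2*h) (3*h) := by
    rw [dyadicLeft, zpow_neg_nat_sub_one_eq]
  have hR : dyadicRight (n+1) = Ioo (3*(h/2)) (2*h) := by
    rw [dyadicRight, zpow_neg_succ_eq, zpow_neg_succ_sub_two_eq]
  have hc : 2 * h ∈ Ioo (0:ℝ) 1 := by
    have : (2:ℝ)^(-(n:ℤ)) ≤ 1 := zpow_le_one_of_nonpos₀ one_le_two (by simp)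
    rw [zpow_neg_nat_eq, ← hh] at this
    constructor <;> linarith
  calc ∫⁻ t in dyadicLeft n, f t
      ≤ ∫⁻ _ in dyadicLeft n, f (2*h) := by
        refine setLIntegral_mono' measurableSet_Ioo fun t ht => ?_
        refine hf hc (dyadicIoo_subset n (dyadicLeft_subset n ht)) ?_
        rw [hL] at ht
        exact ht.1.le
    _ = 2 * ∫⁻ _ in dyadicRight (n+1), f (2*h) := by
        rw [setLIntegral_const, setLIntegral_const, hL, hR, Real.volume_Ioo, Real.volume_Ioo,
          show 3*h - 2*h = 2 * (2*h - 3*(h/2)) by ring, ENNReal.ofReal_mul zero_le_two,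
          ENNReal.ofReal_ofNat, mul_left_comm]
    _ ≤ 2 * ∫⁻ t in dyadicRight (n+1), f t := by
        gcongr 2 * ?_
        refine setLIntegral_mono' measurableSet_Ioo fun t ht => ?_
        refine hf (dyadicIoo_subset _ (dyadicRight_subset _ ht)) hc ?_
        rw [hR] at ht
        exact ht.2.le

theorem lintegral_mul_vgt_le {f : ℝ → ℝ≥0∞} (hf : AntitoneOn f (Ioo 0 1)) :
    ∫⁻ t in Ioo (0:ℝ) 1, f t * ENNReal.ofReal (vgt t)
      ≤ 4 * ∫⁻ t in Ioo (0:ℝ) 1, f t * ENNReal.ofReal (wgt t) := by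
  have hm := aemeasurable_restrict_of_antitoneOn (μ := volume) measurableSet_Ioo hf
  set R : ℕ → ℝ≥0∞ := fun n =>
    ENNReal.ofReal (((3:ℝ)/2)^(n+1)) * ∫⁻ t in dyadicRight n, f t with hR
  have hterm : ∀ n, ENNReal.ofReal (((3:ℝ)/2)^(n+1)) * ∫⁻ t in dyadicIoo n, f t
      ≤ 2 * R (n+1) + R n := by
    intro n
    have ha : ((3:ℝ)/2)^(n+1) ≤ ((3:ℝ)/2)^(n+1+1) :=
      pow_le_pow_right₀ (by norm_num) (Nat.le_succ _)
    calc _ ≤ ENNReal.ofReal (((3:ℝ)/2)^(n+1)) *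
          ((∫⁻ t in dyadicLeft n, f t) + ∫⁻ t in dyadicRight n, f t) := by
          gcongr
          exact lintegral_dyadicIoo_le f n
      _ ≤ ENNReal.ofReal (((3:ℝ)/2)^(n+1+1)) * (2 * ∫⁻ t in dyadicRight (n+1), f t) + R n := by
          rw [mul_add]
          gcongr ?_ + _
          exact mul_le_mul' (ENNReal.ofReal_le_ofReal ha) (lintegral_dyadicLeft_le hf n)
      _ = _ := by rw [mul_left_comm]
  have hsum : ∑' n, R n ≤ ∫⁻ t in Ioo (0:ℝ) 1, f t * ENNReal.ofReal (wgt t) := by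
    rw [lintegral_mul_wgt_eq_tsum hm]
    exact ENNReal.tsum_le_tsum fun n => le_add_self
  calc _ ≤ ∑' n, (2 * R (n+1) + R n) := by
        rw [lintegral_mul_vgt_eq_tsum hm]
        exact ENNReal.tsum_le_tsum hterm
    _ = 2 * ∑' n, R (n+1) + ∑' n, R n := by rw [ENNReal.tsum_add, ENNReal.tsum_mul_left]
    _ ≤ 2 * ∑' n, R n + ∑' n, R n := by
        gcongr 2 * ?_ + _
        exact ENNReal.tsum_comp_le_tsum_of_injective (add_left_injective 1) R
    _ = 3 * ∑' n, R n := by ring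
    _ ≤ _ := by
        gcongr
        norm_num

theorem lintegral_mul_wgt_lt_top_iff {f : ℝ → ℝ≥0∞} (hf : AntitoneOn f (Ioo 0 1)) :
    ∫⁻ t in Ioo (0:ℝ) 1, f t * ENNReal.ofReal (wgt t) < ⊤ ↔
      ∫⁻ t in Ioo (0:ℝ) 1, f t * ENNReal.ofReal (vgt t) < ⊤ := by
  refine ⟨fun h => (lintegral_mul_vgt_le hf).trans_lt (ENNReal.mul_lt_top (by simp) h),
    fun h => (lintegral_mono fun t => ?_).trans_lt h⟩
  gcongr
  exact wgt_le_vgt t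

theorem antitone_rearr (I : Set ℝ) (x : ℝ → ℝ) : Antitone (rearr I x) := by
  intro s t hst
  refine sInf_le_sInf (image_mono ?_)
  rintro a ⟨ha, hle⟩
  exact ⟨ha, hle.trans (ENNReal.ofReal_le_ofReal hst)⟩

theorem antitoneOn_ofReal_comp {x : ℝ → ℝ} {s : Set ℝ} (hx : AntitoneOn x s) :
    AntitoneOn (fun t => ENNReal.ofReal (x t)) s :=
  fun _ ha _ hb hab => ENNReal.ofReal_le_ofReal (hx ha hb hab)

/-- (a) `w(2t) ≤ w(t)` a.e. on `(0,1/2)` and `∫_0^1 |x(t/2)| w(t) dt ≤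
2∫_0^1 |x(t)| w(t) dt`; (b) for nonincreasing `x ≥ 0` on `(0,1)`,
`∫_0^1 x v ≤ 4 ∫_0^1 x w`; moreover `w ≤ v` on `(0,1)`, so nonincreasing `x ≥ 0`
satisfy `∫ x w < ∞ ↔ ∫ x v < ∞` and the symmetrizations of `L¹(w)` and `L¹(v)`
coincide: `(L¹(w))^{(*)} = Λ_{1,v}`. -/
theorem stmt9 :
    (∀ᵐ t ∂(volume.restrict (Ioo (0:ℝ) (1/2))), wgt (2*t) ≤ wgt t) ∧
    (∀ x : ℝ → ℝ, Measurable x →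
      (∫⁻ t in Ioo (0:ℝ) 1, ENNReal.ofReal |x (t/2)| * ENNReal.ofReal (wgt t))
        ≤ 2 * ∫⁻ t in Ioo (0:ℝ) 1, ENNReal.ofReal |x t| * ENNReal.ofReal (wgt t)) ∧
    (∀ x : ℝ → ℝ, (∀ t ∈ Ioo (0:ℝ) 1, 0 ≤ x t) → AntitoneOn x (Ioo 0 1) →
      (∫⁻ t in Ioo (0:ℝ) 1, ENNReal.ofReal (x t) * ENNReal.ofReal (vgt t))
        ≤ 4 * ∫⁻ t in Ioo (0:ℝ) 1, ENNReal.ofReal (x t) * ENNReal.ofReal (wgt t)) ∧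
    (∀ t ∈ Ioo (0:ℝ) 1, wgt t ≤ vgt t) ∧
    (∀ x : ℝ → ℝ, (∀ t ∈ Ioo (0:ℝ) 1, 0 ≤ x t) → AntitoneOn x (Ioo 0 1) →
      ((∫⁻ t in Ioo (0:ℝ) 1, ENNReal.ofReal (x t) * ENNReal.ofReal (wgt t)) < ⊤ ↔
        (∫⁻ t in Ioo (0:ℝ) 1, ENNReal.ofReal (x t) * ENNReal.ofReal (vgt t)) < ⊤)) ∧
    (∀ x : ℝ → ℝ, Measurable x →
      ((∫⁻ t in Ioo (0:ℝ) 1, rearr (Ioo 0 1) x t * ENNReal.ofReal (wgt t)) < ⊤ ↔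
        (∫⁻ t in Ioo (0:ℝ) 1, rearr (Ioo 0 1) x t * ENNReal.ofReal (vgt t)) < ⊤)) := by
  exact ⟨ae_of_all _ wgt_two_mul_le,
    fun x _ => lintegral_comp_half_mul_wgt_le fun t => ENNReal.ofReal |x t|,
    fun x _ hx => lintegral_mul_vgt_le (antitoneOn_ofReal_comp hx),
    fun t _ => wgt_le_vgt t,
    fun x _ hx => lintegral_mul_wgt_lt_top_iff (antitoneOn_ofReal_comp hx),
    fun x _ => lintegral_mul_wgt_lt_top_iff ((antitone_rearr _ x).antitoneOn _)⟩
end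

section
/- For n ≥ 1 let B_n=(2^{-n},3·2^{-n-1}), C_n=(3·2^{-n-1},2^{-n+1}), a_n=(3/2)^n, and define the weight on (0,1): w = ∑_{n≥1}(χ_{B_n} + a_n χ_{C_n}). Then for every n ≥ 1 and every t ∈ (2^{-n},2^{-n+1}) one has Hw(t) = (1/t)∫_0^t w(s) ds ≥ (1/2)(3/2)^{n+1}; consequently sup_{0<t<1} Hw(t)/w(t) = ∞, i.e., Hw ∉ L^∞(1/w), so the Hardy operator H is not bounded on L^∞(1/w) (the Köthe dual of L^1(w)). -/
open MeasureTheory Set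
open scoped ENNReal

lemma two_zpow_neg_sub_one (n : ℤ) : (2:ℝ)^(-n-1) = 2 * (2:ℝ)^(-n-2) := by
  rw [← zpow_one_add₀ (two_ne_zero)]
  congr 1
  ring

lemma two_zpow_neg (n : ℤ) : (2:ℝ)^(-n) = 4 * (2:ℝ)^(-n-2) := by
  rw [show (4:ℝ) = 2 ^ (2:ℤ) by norm_num, ← zpow_add₀ (two_ne_zero)]
  congr 1
  ring

lemma two_zpow_neg_natCast_sub_two (n : ℕ) : (2:ℝ)^(-(n:ℤ)-2) = (1/2)^n / 4 := by
  rw [zpow_sub₀ two_ne_zero, zpow_neg, zpow_natCast, one_div, inv_pow]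
  norm_num

/-- A point lies in at most one dyadic interval `(2^{-n-1}, 2^{-n})`. -/
lemma eq_of_mem_dyadic {t : ℝ} {k j : ℕ}
    (hk : t ∈ Ioo ((2:ℝ)^(-(k:ℤ)-1)) ((2:ℝ)^(-(k:ℤ))))
    (hj : t ∈ Ioo ((2:ℝ)^(-(j:ℤ)-1)) ((2:ℝ)^(-(j:ℤ)))) : k = j := by
  have h1 := (zpow_lt_zpow_iff_right₀ (one_lt_two (α := ℝ))).1 (hk.1.trans hj.2)
  have h2 := (zpow_lt_zpow_iff_right₀ (one_lt_two (α := ℝ))).1 (hj.1.trans hk.2)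
  omega

lemma left_subset_dyadic (k : ℕ) :
    Ioo ((2:ℝ)^(-(k:ℤ)-1)) (3*(2:ℝ)^(-(k:ℤ)-2)) ⊆
      Ioo ((2:ℝ)^(-(k:ℤ)-1)) ((2:ℝ)^(-(k:ℤ))) := by
  have h : (0:ℝ) < (2:ℝ)^(-(k:ℤ)-2) := by positivity
  apply Ioo_subset_Ioo_right
  rw [two_zpow_neg (k:ℤ)]
  linarith

lemma right_subset_dyadic (k : ℕ) :
    Ioo (3*(2:ℝ)^(-(k:ℤ)-2)) ((2:ℝ)^(-(k:ℤ))) ⊆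
      Ioo ((2:ℝ)^(-(k:ℤ)-1)) ((2:ℝ)^(-(k:ℤ))) := by
  have h : (0:ℝ) < (2:ℝ)^(-(k:ℤ)-2) := by positivity
  apply Ioo_subset_Ioo_left
  rw [two_zpow_neg_sub_one (k:ℤ)]
  linarith

lemma wgt_eq_of_mem_dyadic {t : ℝ} {k : ℕ}
    (hk : t ∈ Ioo ((2:ℝ)^(-(k:ℤ)-1)) ((2:ℝ)^(-(k:ℤ)))) :
    wgt t = (Ioo ((2:ℝ)^(-(k:ℤ)-1)) (3*(2:ℝ)^(-(k:ℤ)-2))).indicator (fun _ => (1:ℝ)) t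
      + (Ioo (3*(2:ℝ)^(-(k:ℤ)-2)) ((2:ℝ)^(-(k:ℤ)))).indicator
          (fun _ => ((3:ℝ)/2)^(k+1)) t := by
  apply tsum_eq_single k
  intro j hj
  rw [indicator_of_notMem, indicator_of_notMem, add_zero]
  · exact fun h => hj (eq_of_mem_dyadic (right_subset_dyadic j h) hk)
  · exact fun h => hj (eq_of_mem_dyadic (left_subset_dyadic j h) hk)

lemma wgt_of_mem_left {t : ℝ} {k : ℕ}
    (hk : t ∈ Ioo ((2:ℝ)^(-(k:ℤ)-1)) (3*(2:ℝ)^(-(k:ℤ)-2))) : wgt t = 1 := by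
  rw [wgt_eq_of_mem_dyadic (left_subset_dyadic k hk), indicator_of_mem hk,
    indicator_of_notMem, add_zero]
  exact fun h => lt_asymm h.1 hk.2

lemma wgt_of_mem_right {t : ℝ} {k : ℕ}
    (hk : t ∈ Ioo (3*(2:ℝ)^(-(k:ℤ)-2)) ((2:ℝ)^(-(k:ℤ)))) : wgt t = (3/2)^(k+1) := by
  rw [wgt_eq_of_mem_dyadic (right_subset_dyadic k hk), indicator_of_mem hk,
    indicator_of_notMem, zero_add]
  exact fun h => lt_asymm hk.1 h.2

lemma lintegral_wgt_right (k : ℕ) :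
    ∫⁻ s in Ioo (3*(2:ℝ)^(-(k:ℤ)-2)) ((2:ℝ)^(-(k:ℤ))), ENNReal.ofReal (wgt s)
      = ENNReal.ofReal (3/8 * (3/4)^k) := by
  rw [setLIntegral_congr_fun (g := fun _ => ENNReal.ofReal ((3/2)^(k+1))) measurableSet_Ioo
    (fun s hs => by simp only [wgt_of_mem_right hs]), setLIntegral_const, Real.volume_Ioo,
    ← ENNReal.ofReal_mul (by positivity), two_zpow_neg (k:ℤ), two_zpow_neg_natCast_sub_two,
    show (3/4:ℝ) = 3/2 * (1/2) by norm_num, mul_pow]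
  congr 1
  ring

lemma le_lintegral_wgt {n : ℕ} {t : ℝ} (ht : (2:ℝ)^(-(n:ℤ)-1) < t) :
    ENNReal.ofReal (3/2 * (3/4)^(n+1)) ≤ ∫⁻ s in Ioo (0:ℝ) t, ENNReal.ofReal (wgt s) := by
  let R : ℕ → Set ℝ := fun k =>
    Ioo (3*(2:ℝ)^(-((n+1+k:ℕ):ℤ)-2)) ((2:ℝ)^(-((n+1+k:ℕ):ℤ)))
  have hdisj : Pairwise (Function.onFun Disjoint R) := by
    intro i j hij
    rw [Function.onFun, Set.disjoint_left]
    intro s hi hj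
    have := eq_of_mem_dyadic (right_subset_dyadic _ hi) (right_subset_dyadic _ hj)
    omega
  have hsub : (⋃ k, R k) ⊆ Ioo 0 t := by
    refine iUnion_subset fun k s hs =>
      ⟨lt_trans (by positivity) hs.1, hs.2.trans (lt_of_le_of_lt ?_ ht)⟩
    apply zpow_le_zpow_right₀ one_le_two
    push_cast
    linarith
  have hsum : HasSum (fun k : ℕ => (3/8 * (3/4)^(n+1+k) : ℝ)) (3/2 * (3/4)^(n+1)) := by
    have h := (hasSum_geometric_of_lt_one (r := (3/4:ℝ)) (by norm_num) (by norm_num)).mul_left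
      (3/8 * (3/4)^(n+1))
    rw [show (3/8 * (3/4)^(n+1) * (1 - 3/4)⁻¹ : ℝ) = 3/2 * (3/4)^(n+1) by norm_num; ring] at h
    simpa only [pow_add (3/4 : ℝ) (n+1), mul_assoc] using h
  calc ENNReal.ofReal (3/2 * (3/4)^(n+1))
      = ∑' k : ℕ, ENNReal.ofReal (3/8 * (3/4)^(n+1+k)) := by
        rw [← hsum.tsum_eq, ENNReal.ofReal_tsum_of_nonneg (fun k => by positivity) hsum.summable]
    _ = ∑' k, ∫⁻ s in R k, ENNReal.ofReal (wgt s) :=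
        tsum_congr fun k => (lintegral_wgt_right (n+1+k)).symm
    _ = ∫⁻ s in ⋃ k, R k, ENNReal.ofReal (wgt s) :=
        (lintegral_iUnion (fun _ => measurableSet_Ioo) hdisj _).symm
    _ ≤ ∫⁻ s in Ioo (0:ℝ) t, ENNReal.ofReal (wgt s) := lintegral_mono_set hsub

lemma le_hardy_wgt (n : ℕ) {t : ℝ} (ht : t ∈ Ioo ((2:ℝ)^(-(n:ℤ)-1)) ((2:ℝ)^(-(n:ℤ)))) :
    ENNReal.ofReal ((1/2) * ((3:ℝ)/2)^(n+2))
      ≤ (ENNReal.ofReal t)⁻¹ * ∫⁻ s in Ioo (0:ℝ) t, ENNReal.ofReal (wgt s) := by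
  have h0 : 0 < t := lt_trans (by positivity) ht.1
  refine le_trans ?_ (mul_le_mul_right (le_lintegral_wgt ht.1) _)
  rw [← ENNReal.ofReal_inv_of_pos h0, ← ENNReal.ofReal_mul (by positivity)]
  apply ENNReal.ofReal_le_ofReal
  rw [inv_mul_eq_div, le_div_iff₀ h0]
  have h2 : t ≤ (1/2)^n := by
    have := ht.2.le
    rwa [two_zpow_neg (n:ℤ), two_zpow_neg_natCast_sub_two, mul_div_cancel₀ _ four_ne_zero] at this
  calc (1/2) * ((3:ℝ)/2)^(n+2) * t ≤ (1/2) * ((3:ℝ)/2)^(n+2) * (1/2)^n := by gcongr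
    _ = 3/2 * (3/4)^(n+1) := by
      rw [show (3/4:ℝ) = 3/2 * (1/2) by norm_num, mul_pow]
      ring

lemma exists_lt_ofReal_half_mul_pow {C : ℝ≥0∞} (hC : C < ⊤) :
    ∃ n : ℕ, C < ENNReal.ofReal ((1/2) * ((3:ℝ)/2)^(n+2)) := by
  obtain ⟨n, hn⟩ := pow_unbounded_of_one_lt (2 * C.toReal) (show (1:ℝ) < 3/2 by norm_num)
  refine ⟨n, (ENNReal.lt_ofReal_iff_toReal_lt hC.ne).2 ?_⟩
  have : ((3:ℝ)/2)^n ≤ (3/2)^(n+2) := pow_le_pow_right₀ (by norm_num) (by omega)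
  linarith

lemma left_endpoint_lt (n : ℕ) : (2:ℝ)^(-(n:ℤ)-1) < 3*(2:ℝ)^(-(n:ℤ)-2) := by
  have h : (0:ℝ) < (2:ℝ)^(-(n:ℤ)-2) := by positivity
  rw [two_zpow_neg_sub_one (n:ℤ)]
  linarith

lemma dyadic_subset_unit (n : ℕ) :
    Ioo ((2:ℝ)^(-(n:ℤ)-1)) ((2:ℝ)^(-(n:ℤ))) ⊆ Ioo 0 1 := by
  apply Ioo_subset_Ioo (by positivity)
  exact zpow_le_one_of_nonpos₀ one_le_two (by omega)

/-- for every `n ≥ 1` and `t ∈ (2^{-n}, 2^{-n+1})` one has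
`Hw(t) = (1/t)∫_0^t w ≥ (1/2)(3/2)^{n+1}` (here written for index `n+1`, `n : ℕ`);
consequently `sup_{0<t<1} Hw(t)/w(t) = ∞`, i.e. `Hw ∉ L^∞(1/w)`, so the Hardy
operator is not bounded on `L^∞(1/w)`. -/
theorem stmt10 :
    (∀ n : ℕ, ∀ t ∈ Ioo ((2:ℝ)^(-(n:ℤ)-1)) ((2:ℝ)^(-(n:ℤ))),
      ENNReal.ofReal ((1/2) * ((3:ℝ)/2)^(n+2))
        ≤ (ENNReal.ofReal t)⁻¹ * ∫⁻ s in Ioo (0:ℝ) t, ENNReal.ofReal (wgt s)) ∧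
    (⨆ t ∈ Ioo (0:ℝ) 1,
      ((ENNReal.ofReal t)⁻¹ * ∫⁻ s in Ioo (0:ℝ) t, ENNReal.ofReal (wgt s)) /
        ENNReal.ofReal (wgt t)) = ⊤ ∧
    ¬ ∃ C : ℝ≥0∞, C < ⊤ ∧
      ∀ᵐ t ∂(volume.restrict (Ioo (0:ℝ) 1)),
        ((ENNReal.ofReal t)⁻¹ * ∫⁻ s in Ioo (0:ℝ) t, ENNReal.ofReal (wgt s))
          ≤ C * ENNReal.ofReal (wgt t) := by
  refine ⟨fun n t ht => le_hardy_wgt n ht, ?_, ?_⟩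
  · refine ENNReal.eq_top_of_forall_nnreal_le fun C => ?_
    obtain ⟨n, hn⟩ := exists_lt_ofReal_half_mul_pow (ENNReal.coe_lt_top (r := C))
    obtain ⟨t, ht⟩ := nonempty_Ioo.2 (left_endpoint_lt n)
    have htd := left_subset_dyadic n ht
    refine le_trans (hn.le.trans ?_) (le_iSup₂ t (dyadic_subset_unit n htd))
    rw [wgt_of_mem_left ht, ENNReal.ofReal_one, div_one]
    exact le_hardy_wgt n htd
  · rintro ⟨C, hC, h⟩
    obtain ⟨n, hn⟩ := exists_lt_ofReal_half_mul_pow hC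
    have hpos : volume (Ioo ((2:ℝ)^(-(n:ℤ)-1)) (3*(2:ℝ)^(-(n:ℤ)-2))) ≠ 0 :=
      (Measure.measure_Ioo_pos _).2 (left_endpoint_lt n) |>.ne'
    refine hpos (measure_mono_null (fun t ht => ?_) ((ae_restrict_iff' measurableSet_Ioo).1 h))
    have htd := left_subset_dyadic n ht
    refine fun hle => (hn.trans_le (le_hardy_wgt n htd)).not_ge ?_
    simpa only [wgt_of_mem_left ht, ENNReal.ofReal_one, mul_one] using
      hle (dyadic_subset_unit n htd)
end

section
/- Let I = (0,1) or I = (0,∞), let 0 < p_1, p_2 < ∞ and 0 < q_1, q_2 ≤ ∞, and suppose that either p_1 < p_2, or p_1 = p_2 and q_1 > q_2. Then M(L^{p_1,q_1}(I), L^{p_2,q_2}(I)) = {0}: any measurable x on I such that x·y ∈ L^{p_2,q_2}(I) for every y ∈ L^{p_1,q_1}(I) satisfies x = 0 a.e. -/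
open MeasureTheory Set
open scoped ENNReal

open Classical in
/-- The Lorentz `L^{p,q}(I)` quasinorm
`‖x‖_{p,q} = (∫_0^{m(I)} (t^{1/p} x*(t))^q dt/t)^{1/q}` for `q < ∞` and
`‖x‖_{p,∞} = sup_{0<t<m(I)} t^{1/p} x*(t)`. -/
noncomputable def lorentzNorm (I : Set ℝ) (p q : ℝ≥0∞) (x : ℝ → ℝ) : ℝ≥0∞ :=
  if q = ⊤ then
    ⨆ t ∈ {t : ℝ | 0 < t ∧ ENNReal.ofReal t < volume I},
      ENNReal.ofReal t ^ (p⁻¹).toReal * rearr I x t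
  else
    (∫⁻ t in {t : ℝ | 0 < t ∧ ENNReal.ofReal t < volume I},
        (ENNReal.ofReal t ^ (p⁻¹).toReal * rearr I x t) ^ q.toReal /
          ENNReal.ofReal t) ^ (q⁻¹).toReal

/-- The distribution function of the set `A`, i.e. `s ↦ m(A ∩ (-∞, s))`. -/
noncomputable def cumul (A : Set ℝ) (s : ℝ) : ℝ := volume.real (A ∩ Iio s)

lemma cumul_mono {A : Set ℝ} (hA : volume A ≠ ⊤) : Monotone (cumul A) := fun _ _ h =>
  measureReal_mono (inter_subset_inter_right _ (Iio_subset_Iio h))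
    (measure_ne_top_of_subset inter_subset_left hA)

lemma continuous_cumul {A : Set ℝ} (hA : volume A ≠ ⊤) : Continuous (cumul A) := by
  refine (LipschitzWith.of_le_add fun s t => ?_).continuous
  rcases le_total s t with h | h
  · exact (cumul_mono hA h).trans (le_add_of_nonneg_right dist_nonneg)
  · have hsub : A ∩ Iio s ⊆ (A ∩ Iio t) ∪ Ico t s := fun u hu => by
      rcases lt_or_ge u t with hut | hut
      · exact Or.inl ⟨hu.1, hut⟩
      · exact Or.inr ⟨hut, hu.2⟩
    have hfin : volume ((A ∩ Iio t) ∪ Ico t s) ≠ ⊤ :=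
      measure_union_ne_top (measure_ne_top_of_subset inter_subset_left hA) (by simp)
    calc cumul A s ≤ volume.real ((A ∩ Iio t) ∪ Ico t s) := measureReal_mono hsub hfin
      _ ≤ cumul A t + volume.real (Ico t s) := measureReal_union_le _ _
      _ = cumul A t + dist s t := by
        rw [Real.volume_real_Ico_of_le h, Real.dist_eq, abs_of_nonneg (by linarith)]

lemma exists_cumul_eq {A : Set ℝ} {R c : ℝ} (hA : A ⊆ Ioo 0 R) (hc : 0 ≤ c)
    (hcM : c ≤ volume.real A) : ∃ s, cumul A s = c := by
  have hfin : volume A ≠ ⊤ := measure_ne_top_of_subset hA (by simp)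
  have h0 : cumul A 0 = 0 := by
    have : A ∩ Iio 0 = ∅ := by
      ext s; simp only [mem_inter_iff, mem_Iio, mem_empty_iff_false, iff_false, not_and, not_lt]
      exact fun hs => (hA hs).1.le
    simp [cumul, this]
  have hR : cumul A R = volume.real A := by
    have : A ∩ Iio R = A := inter_eq_left.2 fun s hs => (hA hs).2
    simp [cumul, this]
  exact mem_range_of_exists_le_of_exists_ge (continuous_cumul hfin) ⟨0, h0.trans_le hc⟩
    ⟨R, hcM.trans_eq hR.symm⟩

lemma volume_cumul_lt_le {A : Set ℝ} {R c : ℝ} (hA : A ⊆ Ioo 0 R) (hc : 0 ≤ c)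
    (hcM : c ≤ volume.real A) : volume {s | s ∈ A ∧ cumul A s < c} ≤ ENNReal.ofReal c := by
  have hfin : volume A ≠ ⊤ := measure_ne_top_of_subset hA (by simp)
  obtain ⟨s₀, rfl⟩ := exists_cumul_eq hA hc hcM
  rw [cumul, ofReal_measureReal (measure_ne_top_of_subset inter_subset_left hfin)]
  exact measure_mono fun s hs => ⟨hs.1, (cumul_mono hfin).reflect_lt hs.2⟩

lemma le_volume_cumul_mem_Ioc {A : Set ℝ} {R c : ℝ} (hA : A ⊆ Ioo 0 R) (hc : 0 ≤ c)
    (hcM : c < volume.real A) :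
    ENNReal.ofReal c ≤ volume {s | s ∈ A ∧ cumul A s ∈ Ioc 0 c} := by
  have hfin : volume A ≠ ⊤ := measure_ne_top_of_subset hA (by simp)
  have hM : 0 < volume.real A := hc.trans_lt hcM
  have hzero : volume {s | s ∈ A ∧ cumul A s ≤ 0} = 0 := by
    refine le_antisymm
      (ge_of_tendsto (x := nhdsWithin (0 : ℝ) (Ioi 0)) (f := ENNReal.ofReal) ?_ ?_) zero_le
    · exact (ENNReal.continuous_ofReal.tendsto' 0 0 (by simp)).mono_left nhdsWithin_le_nhds
    · filter_upwards [Ioo_mem_nhdsGT hM] with d hd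
      exact (measure_mono fun s (hs : s ∈ A ∧ cumul A s ≤ 0) =>
          (⟨hs.1, hs.2.trans_lt hd.1⟩ : s ∈ A ∧ cumul A s < d)).trans
        (volume_cumul_lt_le hA hd.1.le hd.2.le)
  obtain ⟨s₀, hs₀⟩ := exists_cumul_eq hA hc hcM.le
  have hsub : A ∩ Iio s₀ ⊆ {s | s ∈ A ∧ cumul A s ∈ Ioc 0 c} ∪ {s | s ∈ A ∧ cumul A s ≤ 0} :=
    fun s hs => by
      rcases le_or_gt (cumul A s) 0 with h | h
      · exact Or.inr ⟨hs.1, h⟩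
      · exact Or.inl ⟨hs.1, h, (cumul_mono hfin hs.2.le).trans_eq hs₀⟩
  calc ENNReal.ofReal c = volume (A ∩ Iio s₀) := by
        rw [← hs₀, cumul, ofReal_measureReal (measure_ne_top_of_subset inter_subset_left hfin)]
    _ ≤ _ := measure_mono hsub
    _ ≤ _ := measure_union_le _ _
    _ = _ := by rw [hzero, add_zero]

/-- A function supported on `A` whose decreasing rearrangement is `g`. -/
noncomputable def transplant (A : Set ℝ) (g : ℝ → ℝ) : ℝ → ℝ :=
  A.indicator fun s => g (cumul A s)

/-- A function on `(0, M]` that can serve as a decreasing rearrangement. -/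
structure IsProfile (M : ℝ) (g : ℝ → ℝ) : Prop where
  measurable : Measurable g
  pos : ∀ t ∈ Ioc 0 M, 0 < g t
  antitoneOn : AntitoneOn g (Ioc 0 M)
  continuousOn : ContinuousOn g (Ioc 0 M)

/-- The function `t ↦ t^a g(t)` lies in `L^q((0, M), dt/t)`. -/
def WeightedMem (a : ℝ) (q : ℝ≥0∞) (M : ℝ) (g : ℝ → ℝ) : Prop :=
  if q = ⊤ then ∃ K, ∀ t ∈ Ioo 0 M, t ^ a * g t ≤ K
  else IntegrableOn (fun t => (t ^ a * g t) ^ q.toReal / t) (Ioo 0 M)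

lemma measurable_transplant {A : Set ℝ} (hA : MeasurableSet A) (hfin : volume A ≠ ⊤)
    {g : ℝ → ℝ} (hg : Measurable g) : Measurable (transplant A g) :=
  (hg.comp (continuous_cumul hfin).measurable).indicator hA

lemma rearr_transplant_le {I A : Set ℝ} {R t : ℝ} {g : ℝ → ℝ} (hA : A ⊆ Ioo 0 R)
    (hg : IsProfile (volume.real A) g) (ht : t ∈ Ioo 0 (volume.real A)) :
    rearr I (transplant A g) t ≤ ENNReal.ofReal (g t) := by
  have hfin : volume A ≠ ⊤ := measure_ne_top_of_subset hA (by simp)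
  have hgt : 0 < g t := hg.pos t (Ioo_subset_Ioc_self ht)
  refine sInf_le ⟨g t, ⟨hgt, ?_⟩, rfl⟩
  refine (measure_mono ?_).trans (volume_cumul_lt_le hA ht.1.le ht.2.le)
  rintro s ⟨-, hs⟩
  have hsA : s ∈ A := by
    by_contra h
    simp only [transplant, indicator_of_notMem h, abs_zero] at hs
    exact hs.not_gt hgt
  refine ⟨hsA, ?_⟩
  by_contra! h
  have hmem : cumul A s ∈ Ioc 0 (volume.real A) :=
    ⟨ht.1.trans_le h, measureReal_mono inter_subset_left hfin⟩
  simp only [transplant, indicator_of_mem hsA, abs_of_pos (hg.pos _ hmem)] at hs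
  exact hs.not_ge (hg.antitoneOn (Ioo_subset_Ioc_self ht) hmem h)

lemma rearr_transplant_eq_zero {I A : Set ℝ} {t : ℝ} {g : ℝ → ℝ} (hfin : volume A ≠ ⊤)
    (ht : volume.real A ≤ t) : rearr I (transplant A g) t = 0 := by
  refine le_antisymm (ge_of_tendsto (x := nhdsWithin (0 : ℝ) (Ioi 0)) (f := ENNReal.ofReal)
    ((ENNReal.continuous_ofReal.tendsto' 0 0 (by simp)).mono_left nhdsWithin_le_nhds) ?_) zero_le
  filter_upwards [self_mem_nhdsWithin] with a ha
  refine sInf_le ⟨a, ⟨ha, ?_⟩, rfl⟩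
  calc _ ≤ volume A := measure_mono ?_
    _ = ENNReal.ofReal (volume.real A) := (ofReal_measureReal hfin).symm
    _ ≤ _ := ENNReal.ofReal_le_ofReal ht
  rintro s ⟨-, hs⟩
  by_contra h
  simp only [transplant, indicator_of_notMem h, abs_zero] at hs
  exact hs.not_gt ha

lemma le_rearr_mul_transplant {I A : Set ℝ} {R t ε : ℝ} {g x : ℝ → ℝ} (hA : A ⊆ Ioo 0 R)
    (hAI : A ⊆ I) (hx : ∀ s ∈ A, ε ≤ |x s|)
    (hg : IsProfile (volume.real A) g) (ht : t ∈ Ioo 0 (volume.real A)) :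
    ENNReal.ofReal (ε * g t) ≤ rearr I (fun s => x s * transplant A g s) t := by
  refine le_sInf ?_
  rintro _ ⟨a, ⟨-, ha⟩, rfl⟩
  refine ENNReal.ofReal_le_ofReal ?_
  have htI : Ioo t (volume.real A) ∈ nhdsWithin t (Ioi t) := Ioo_mem_nhdsGT ht.2
  have hcont : ContinuousAt g t :=
    (hg.continuousOn.mono Ioo_subset_Ioc_self).continuousAt (Ioo_mem_nhds ht.1 ht.2)
  refine le_of_tendsto (x := nhdsWithin t (Ioi t)) (f := fun u => ε * g u)
    ((hcont.tendsto.mono_left nhdsWithin_le_nhds).const_mul ε) ?_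
  filter_upwards [htI] with u hu
  have hu0 : 0 < u := ht.1.trans hu.1
  by_contra! hlt
  refine (ENNReal.ofReal_lt_ofReal_iff hu0).2 hu.1 |>.not_ge ?_
  refine (le_volume_cumul_mem_Ioc hA hu0.le hu.2).trans ((measure_mono ?_).trans ha)
  rintro s ⟨hsA, hs⟩
  refine ⟨hAI hsA, hlt.trans_le ?_⟩
  have hmem : cumul A s ∈ Ioc 0 (volume.real A) := ⟨hs.1, hs.2.trans hu.2.le⟩
  simp only [transplant, indicator_of_mem hsA, abs_mul, abs_of_pos (hg.pos _ hmem)]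
  exact mul_le_mul (hx s hsA) (hg.antitoneOn hmem ⟨hu0, hu.2.le⟩ hs.2)
    (hg.pos _ ⟨hu0, hu.2.le⟩).le (abs_nonneg _)

lemma ofReal_weighted {t a q c : ℝ} (ht : 0 < t) (hc : 0 ≤ c) (hq : 0 ≤ q) :
    (ENNReal.ofReal t ^ a * ENNReal.ofReal c) ^ q / ENNReal.ofReal t =
      ENNReal.ofReal ((t ^ a * c) ^ q / t) := by
  rw [ENNReal.ofReal_rpow_of_pos ht, ← ENNReal.ofReal_mul (by positivity),
    ENNReal.ofReal_rpow_of_nonneg (by positivity) hq, ENNReal.ofReal_div_of_pos ht]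

lemma integrableOn_weighted_iff {M a q : ℝ} {g : ℝ → ℝ} (hg : IsProfile M g) :
    IntegrableOn (fun t => (t ^ a * g t) ^ q / t) (Ioo 0 M) ↔
      ∫⁻ t in Ioo 0 M, ENNReal.ofReal ((t ^ a * g t) ^ q / t) < ⊤ := by
  have hm : Measurable fun t => (t ^ a * g t) ^ q / t := by
    have := hg.measurable
    fun_prop
  have hnn : 0 ≤ᵐ[volume.restrict (Ioo 0 M)] fun t => (t ^ a * g t) ^ q / t := by
    refine (ae_restrict_iff' measurableSet_Ioo).2 (.of_forall fun t ht => ?_)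
    have h1 := ht.1
    have h2 := hg.pos t (Ioo_subset_Ioc_self ht)
    simp only [Pi.zero_apply]
    positivity
  rw [IntegrableOn, Integrable, hasFiniteIntegral_iff_ofReal hnn]
  exact and_iff_right hm.aestronglyMeasurable

lemma lorentzNorm_transplant_ne_top {I A : Set ℝ} {R : ℝ} {p q : ℝ≥0∞} {g : ℝ → ℝ} (hq : 0 < q)
    (hA : A ⊆ Ioo 0 R) (hg : IsProfile (volume.real A) g)
    (hmem : WeightedMem (p⁻¹).toReal q (volume.real A) g) :
    lorentzNorm I p q (transplant A g) ≠ ⊤ := by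
  have hfin : volume A ≠ ⊤ := measure_ne_top_of_subset hA (by simp)
  unfold lorentzNorm
  unfold WeightedMem at hmem
  split_ifs at hmem ⊢ with hqt
  · obtain ⟨K, hK⟩ := hmem
    refine ne_top_of_le_ne_top (b := ENNReal.ofReal K) ENNReal.ofReal_ne_top
      (iSup₂_le fun t ht => ?_)
    rcases lt_or_ge t (volume.real A) with h | h
    · refine (mul_le_mul_right (rearr_transplant_le hA hg ⟨ht.1, h⟩) _).trans ?_
      rw [ENNReal.ofReal_rpow_of_pos ht.1, ← ENNReal.ofReal_mul (Real.rpow_nonneg ht.1.le _)]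
      exact ENNReal.ofReal_le_ofReal (hK t ⟨ht.1, h⟩)
    · simp [rearr_transplant_eq_zero hfin h]
  · have hq0 : 0 < q.toReal := ENNReal.toReal_pos hq.ne' hqt
    refine ENNReal.rpow_ne_top_of_nonneg ENNReal.toReal_nonneg ?_
    rw [integrableOn_weighted_iff hg] at hmem
    refine ne_top_of_le_ne_top hmem.ne ?_
    have hT : MeasurableSet {t : ℝ | 0 < t ∧ ENNReal.ofReal t < volume I} :=
      measurableSet_Ioi.inter (measurableSet_lt ENNReal.measurable_ofReal measurable_const)
    rw [← lintegral_indicator hT, ← lintegral_indicator measurableSet_Ioo]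
    refine lintegral_mono fun t => ?_
    by_cases ht : 0 < t ∧ ENNReal.ofReal t < volume I
    swap
    · rw [indicator_of_notMem (s := {t : ℝ | 0 < t ∧ ENNReal.ofReal t < volume I}) ht]
      exact zero_le
    rw [indicator_of_mem (s := {t : ℝ | 0 < t ∧ ENNReal.ofReal t < volume I}) ht]
    rcases lt_or_ge t (volume.real A) with h | h
    · have htM : t ∈ Ioo 0 (volume.real A) := ⟨ht.1, h⟩
      rw [indicator_of_mem htM, ← ofReal_weighted ht.1 (hg.pos t ⟨ht.1, h.le⟩).le hq0.le]
      gcongr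
      exact rearr_transplant_le hA hg htM
    · simp [rearr_transplant_eq_zero hfin h, hq0]

lemma weightedMem_of_lorentzNorm_ne_top {I A : Set ℝ} {R ε : ℝ} {p q : ℝ≥0∞} {g x : ℝ → ℝ}
    (hq : 0 < q) (hA : A ⊆ Ioo 0 R) (hAI : A ⊆ I) (hε : 0 < ε) (hx : ∀ s ∈ A, ε ≤ |x s|)
    (hg : IsProfile (volume.real A) g)
    (hnorm : lorentzNorm I p q (fun s => x s * transplant A g s) ≠ ⊤) :
    WeightedMem (p⁻¹).toReal q (volume.real A) g := by
  have hfin : volume A ≠ ⊤ := measure_ne_top_of_subset hA (by simp)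
  have hsub : Ioo 0 (volume.real A) ⊆ {t : ℝ | 0 < t ∧ ENNReal.ofReal t < volume I} :=
    fun t ht => ⟨ht.1, ((ENNReal.ofReal_lt_iff_lt_toReal ht.1.le hfin).2 ht.2).trans_le
      (measure_mono hAI)⟩
  have key : ∀ t ∈ Ioo 0 (volume.real A), ENNReal.ofReal ε * ENNReal.ofReal (g t) ≤
      rearr I (fun s => x s * transplant A g s) t := fun t ht => by
    rw [← ENNReal.ofReal_mul hε.le]
    exact le_rearr_mul_transplant hA hAI hx hg ht
  have hε' : ENNReal.ofReal ε ≠ 0 := (ENNReal.ofReal_pos.2 hε).ne'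
  unfold lorentzNorm at hnorm
  unfold WeightedMem
  split_ifs at hnorm ⊢ with hqt
  · set S := ⨆ t ∈ {t : ℝ | 0 < t ∧ ENNReal.ofReal t < volume I},
      ENNReal.ofReal t ^ (p⁻¹).toReal * rearr I (fun s => x s * transplant A g s) t with hS
    refine ⟨S.toReal / ε, fun t ht => ?_⟩
    have h1 : ENNReal.ofReal t ^ (p⁻¹).toReal * (ENNReal.ofReal ε * ENNReal.ofReal (g t)) ≤ S :=
      (mul_le_mul_right (key t ht) _).trans (le_iSup₂_of_le t (hsub ht) le_rfl)
    rw [ENNReal.ofReal_rpow_of_pos ht.1, ← ENNReal.ofReal_mul hε.le,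
      ← ENNReal.ofReal_mul (Real.rpow_nonneg ht.1.le _), ENNReal.ofReal_le_iff_le_toReal hnorm]
      at h1
    rw [le_div_iff₀ hε]
    linarith
  · have hq0 : 0 < q.toReal := ENNReal.toReal_pos hq.ne' hqt
    rw [integrableOn_weighted_iff hg]
    have hpow : 0 < (q⁻¹).toReal := by
      rw [ENNReal.toReal_inv]
      positivity
    have hint := (ENNReal.rpow_lt_top_iff_of_pos hpow).1 hnorm.lt_top
    have hle : ENNReal.ofReal ε ^ q.toReal *
        ∫⁻ t in Ioo 0 (volume.real A),
          ENNReal.ofReal ((t ^ (p⁻¹).toReal * g t) ^ q.toReal / t) < ⊤ := by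
      rw [← lintegral_const_mul' _ _ (by finiteness)]
      refine lt_of_le_of_lt ((setLIntegral_mono' measurableSet_Ioo fun t ht => ?_).trans
        (lintegral_mono_set hsub)) hint
      rw [← ofReal_weighted ht.1 (hg.pos t ⟨ht.1, ht.2.le⟩).le hq0.le, ← mul_div_assoc,
        ← ENNReal.mul_rpow_of_nonneg _ _ hq0.le, mul_left_comm]
      gcongr
      exact key t ht
    refine ENNReal.lt_top_of_mul_ne_top_right hle.ne ?_
    simp [hε', ENNReal.rpow_eq_zero_iff]

lemma isProfile_rpow {M b : ℝ} (hb : 0 ≤ b) : IsProfile M fun t => t ^ (-b) where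
  measurable := by fun_prop
  pos t ht := Real.rpow_pos_of_pos ht.1 _
  antitoneOn s hs t _ hst := Real.rpow_le_rpow_of_nonpos hs.1 hst (by linarith)
  continuousOn t ht := (Real.continuousAt_rpow_const t _ (Or.inl ht.1.ne')).continuousWithinAt

lemma weightedMem_rpow_iff {M a b : ℝ} {q : ℝ≥0∞} (hq : 0 < q) (hM : 0 < M) (hab : a ≠ b) :
    WeightedMem a q M (fun t => t ^ (-b)) ↔ b < a := by
  have hmul : ∀ t ∈ Ioo 0 M, t ^ a * t ^ (-b) = t ^ (a - b) := fun t ht => by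
    rw [← Real.rpow_add ht.1, sub_eq_add_neg]
  unfold WeightedMem
  split_ifs with hqt
  · constructor
    · rintro ⟨K, hK⟩
      by_contra! h
      have hneg : a - b < 0 := sub_neg.2 (lt_of_le_of_ne h hab)
      have htend : Filter.Tendsto (fun t : ℝ => t ^ (a - b)) (nhdsWithin 0 (Ioi 0)) Filter.atTop :=
        tendsto_rpow_neg_nhdsGT_zero hneg
      obtain ⟨t, ht, htK⟩ := ((Filter.Eventually.and (Ioo_mem_nhdsGT hM)
        (htend.eventually_gt_atTop K))).exists
      exact htK.not_ge (hmul t ht ▸ hK t ht)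
    · refine fun h => ⟨M ^ (a - b), fun t ht => ?_⟩
      rw [hmul t ht]
      exact Real.rpow_le_rpow ht.1.le ht.2.le (by linarith)
  · have hq0 : 0 < q.toReal := ENNReal.toReal_pos hq.ne' hqt
    rw [integrableOn_congr_fun (g := fun t => t ^ ((a - b) * q.toReal - 1)) _ measurableSet_Ioo,
      intervalIntegral.integrableOn_Ioo_rpow_iff hM]
    · constructor
      · intro h
        nlinarith
      · intro h
        nlinarith
    · intro t ht
      simp only
      rw [hmul t ht, ← Real.rpow_mul ht.1.le, Real.rpow_sub ht.1, Real.rpow_one]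

/-- `t ↦ t^{-a} (C + log (M / t))^{-b}` with `C = b / a`, which makes it decreasing. -/
noncomputable def logProfile (a b M t : ℝ) : ℝ := t ^ (-a) * (b / a + Real.log (M / t)) ^ (-b)

lemma add_log_div_pos {c M t : ℝ} (hc : 0 < c) (ht : t ∈ Ioc 0 M) : 0 < c + Real.log (M / t) := by
  have : 0 ≤ Real.log (M / t) := Real.log_nonneg ((one_le_div ht.1).2 ht.2)
  linarith

lemma isProfile_logProfile {a b M : ℝ} (ha : 0 < a) (hb : 0 < b) :
    IsProfile M (logProfile a b M) where
  measurable := by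
    unfold logProfile
    fun_prop
  pos t ht := mul_pos (Real.rpow_pos_of_pos ht.1 _)
    (Real.rpow_pos_of_pos (add_log_div_pos (by positivity) ht) _)
  antitoneOn s hs t ht hst := by
    have hs0 := hs.1
    have ht0 := ht.1
    have hM : 0 < M := ht0.trans_le ht.2
    have hLs := add_log_div_pos (div_pos hb ha) hs
    have hLt := add_log_div_pos (div_pos hb ha) ht
    have hlog : 0 ≤ Real.log (M / t) := Real.log_nonneg ((one_le_div ht.1).2 ht.2)
    rw [← Real.log_le_log_iff (by unfold logProfile; positivity) (by unfold logProfile; positivity)]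
    unfold logProfile
    rw [Real.log_mul (by positivity) (by positivity), Real.log_mul (by positivity) (by positivity),
      Real.log_rpow ht0, Real.log_rpow hs0, Real.log_rpow hLt, Real.log_rpow hLs]
    set u := b / a + Real.log (M / t) with hu
    set v := b / a + Real.log (M / s) with hv
    have hd : v - u = Real.log t - Real.log s := by
      rw [hu, hv, Real.log_div hM.ne' ht0.ne', Real.log_div hM.ne' hs0.ne']
      ring
    have hd0 : 0 ≤ v - u := hd ▸ sub_nonneg.2 (Real.log_le_log hs0 hst)
    have h1 : Real.log v - Real.log u ≤ v / u - 1 := by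
      rw [← Real.log_div hLs.ne' hLt.ne']
      exact Real.log_le_sub_one_of_pos (by positivity)
    have h2 : b * (v / u - 1) ≤ a * (v - u) := by
      have hbu : b ≤ a * u := by
        have : a * (b / a) = b := by field_simp
        nlinarith [mul_nonneg ha.le hlog]
      have hvu : v / u - 1 = (v - u) / u := by field_simp
      rw [hvu, ← mul_div_assoc, div_le_iff₀ hLt]
      nlinarith
    nlinarith
  continuousOn t ht := by
    have h1 := add_log_div_pos (div_pos hb ha) ht
    have hM : 0 < M := ht.1.trans_le ht.2
    have h2 : M / t ≠ 0 := (div_pos hM ht.1).ne'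
    unfold logProfile
    refine ContinuousAt.continuousWithinAt (.mul ?_ (.rpow_const ?_ (Or.inl h1.ne')))
    · exact Real.continuousAt_rpow_const t _ (Or.inl ht.1.ne')
    · exact continuousAt_const.add
        ((continuousAt_const.div continuousAt_id ht.1.ne').log h2)

lemma integrableOn_log_rpow_div_iff {c r M : ℝ} (hc : 0 < c) (hM : 0 < M) :
    IntegrableOn (fun t => (c + Real.log (M / t)) ^ r / t) (Ioo 0 M) ↔ r < -1 := by
  have himg : (fun u => M * Real.exp (c - u)) '' Ioi c = Ioo 0 M := by
    ext t
    constructor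
    · rintro ⟨u, hu, rfl⟩
      have : Real.exp (c - u) < 1 := Real.exp_lt_one_iff.2 (sub_neg.2 hu)
      exact ⟨by positivity, by nlinarith⟩
    · intro ht
      have := ht.1
      refine ⟨c + Real.log (M / t), ?_, ?_⟩
      · exact lt_add_of_pos_right c (Real.log_pos ((one_lt_div ht.1).2 ht.2))
      · simp only [sub_add_cancel_left, Real.exp_neg]
        rw [Real.exp_log (by positivity)]
        field_simp
  rw [← himg, integrableOn_image_iff_integrableOn_abs_deriv_smul
    (f' := fun u => -(M * Real.exp (c - u))) measurableSet_Ioi, ← integrableOn_Ioi_rpow_iff hc]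
  · refine integrableOn_congr_fun (fun u _ => ?_) measurableSet_Ioi
    have hpos : 0 < M * Real.exp (c - u) := by positivity
    simp only [abs_neg, abs_of_pos hpos, smul_eq_mul]
    rw [mul_div_cancel₀ _ hpos.ne', div_mul_cancel_left₀ hM.ne', ← Real.exp_neg, Real.log_exp]
    congr 1
    ring
  · intro u _
    have := (((hasDerivAt_id u).const_sub c).exp.const_mul M).hasDerivWithinAt (s := Ioi c)
    simpa using this
  · intro u _ v _ huv
    have := Real.exp_injective (mul_left_cancel₀ hM.ne' huv)
    linarith

lemma rpow_mul_logProfile {a b M t : ℝ} (ht : 0 < t) :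
    t ^ a * logProfile a b M t = (b / a + Real.log (M / t)) ^ (-b) := by
  rw [logProfile, ← mul_assoc, ← Real.rpow_add ht, add_neg_cancel, Real.rpow_zero, one_mul]

lemma weightedMem_logProfile_iff {a b M : ℝ} {q : ℝ≥0∞} (ha : 0 < a) (hb : 0 < b) (hM : 0 < M) :
    WeightedMem a q M (logProfile a b M) ↔ q = ⊤ ∨ 1 < b * q.toReal := by
  unfold WeightedMem
  split_ifs with hqt
  · simp only [hqt, true_or, iff_true]
    refine ⟨(b / a) ^ (-b), fun t ht => ?_⟩
    rw [rpow_mul_logProfile ht.1]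
    refine Real.rpow_le_rpow_of_nonpos (by positivity) ?_ (by linarith)
    exact le_add_of_nonneg_right (Real.log_nonneg ((one_le_div ht.1).2 ht.2.le))
  · simp only [hqt, false_or]
    rw [integrableOn_congr_fun
      (g := fun t => (b / a + Real.log (M / t)) ^ (-b * q.toReal) / t) _ measurableSet_Ioo,
      integrableOn_log_rpow_div_iff (div_pos hb ha) hM]
    · constructor <;> intro h <;> linarith
    · intro t ht
      simp only
      rw [rpow_mul_logProfile ht.1,
        ← Real.rpow_mul (add_log_div_pos (div_pos hb ha) (Ioo_subset_Ioc_self ht)).le]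

lemma exists_isProfile {p₁ p₂ q₁ q₂ : ℝ≥0∞} {M : ℝ} (hM : 0 < M)
    (hp₁ : 0 < p₁) (hp₁' : p₁ ≠ ⊤) (hp₂' : p₂ ≠ ⊤) (hq₁ : 0 < q₁) (hq₂ : 0 < q₂)
    (hcase : p₁ < p₂ ∨ (p₁ = p₂ ∧ q₂ < q₁)) :
    ∃ g, IsProfile M g ∧ WeightedMem (p₁⁻¹).toReal q₁ M g ∧ ¬ WeightedMem (p₂⁻¹).toReal q₂ M g := by
  rcases hcase with h | ⟨rfl, h⟩
  · have hlt : (p₂⁻¹).toReal < (p₁⁻¹).toReal :=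
      (ENNReal.toReal_lt_toReal (ENNReal.inv_ne_top.2 (hp₁.trans h).ne')
        (ENNReal.inv_ne_top.2 hp₁.ne')).2 (ENNReal.inv_lt_inv.2 h)
    obtain ⟨b, hb₂, hb₁⟩ := exists_between hlt
    refine ⟨fun t => t ^ (-b), isProfile_rpow (ENNReal.toReal_nonneg.trans hb₂.le),
      (weightedMem_rpow_iff hq₁ hM hb₁.ne').2 hb₁, fun hmem => ?_⟩
    exact hb₂.not_gt ((weightedMem_rpow_iff hq₂ hM hb₂.ne).1 hmem)
  · have hp : 0 < (p₁⁻¹).toReal :=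
      ENNReal.toReal_pos (ENNReal.inv_ne_zero.2 hp₁') (ENNReal.inv_ne_top.2 hp₁.ne')
    have hq₂' : q₂ ≠ ⊤ := h.ne_top
    have hq : 0 < q₂.toReal := ENNReal.toReal_pos hq₂.ne' hq₂'
    refine ⟨logProfile (p₁⁻¹).toReal (q₂.toReal)⁻¹ M, isProfile_logProfile hp (inv_pos.2 hq),
      (weightedMem_logProfile_iff hp (inv_pos.2 hq) hM).2 ?_, fun hmem => ?_⟩
    · refine or_iff_not_imp_left.2 fun hq₁' => ?_
      rw [inv_mul_eq_div, one_lt_div hq]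
      exact (ENNReal.toReal_lt_toReal hq₂' hq₁').2 h
    · rcases (weightedMem_logProfile_iff hp (inv_pos.2 hq) hM).1 hmem with h' | h'
      · exact hq₂' h'
      · rw [inv_mul_cancel₀ hq.ne'] at h'
        exact lt_irrefl _ h'

lemma exists_subset_le_abs {I : Set ℝ} {x : ℝ → ℝ} (hI : MeasurableSet I) (hI0 : I ⊆ Ioi 0)
    (hx : Measurable x) (hne : ¬ ∀ᵐ t ∂(volume.restrict I), x t = 0) :
    ∃ A ⊆ I, MeasurableSet A ∧ 0 < volume A ∧ (∃ R, A ⊆ Ioo 0 R) ∧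
      ∃ ε > 0, ∀ s ∈ A, ε ≤ |x s| := by
  let A : ℕ → Set ℝ := fun n => I ∩ (Iio (n : ℝ) ∩ {s | 1 / ((n : ℝ) + 1) ≤ |x s|})
  have hAm : ∀ n, MeasurableSet (A n) := fun n =>
    hI.inter (measurableSet_Iio.inter (measurableSet_le measurable_const hx.abs))
  obtain ⟨n, hn⟩ : ∃ n, volume (A n) ≠ 0 := by
    by_contra! h
    refine hne ((ae_restrict_iff' hI).2 ?_)
    refine measure_mono_null (fun s hs => ?_) (measure_iUnion_null h)
    obtain ⟨hsI, hs0⟩ : s ∈ I ∧ x s ≠ 0 := by simpa using hs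
    obtain ⟨k, hk⟩ := exists_nat_one_div_lt (abs_pos.2 hs0)
    obtain ⟨m, hm⟩ := exists_nat_gt s
    refine mem_iUnion.2 ⟨max k m, hsI, hm.trans_le (by simp), le_trans ?_ hk.le⟩
    apply one_div_le_one_div_of_le (by positivity)
    gcongr
    simp
  exact ⟨A n, inter_subset_left, hAm n, pos_iff_ne_zero.2 hn,
    ⟨n, fun s hs => ⟨hI0 hs.1, hs.2.1⟩⟩, 1 / ((n : ℝ) + 1), by positivity, fun s hs => hs.2.2⟩

/-- if `p₁ < p₂`, or `p₁ = p₂` and `q₁ > q₂`, then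
`M(L^{p₁,q₁}(I), L^{p₂,q₂}(I)) = {0}`. -/
theorem stmt12 (I : Set ℝ) (hI : I = Ioo (0:ℝ) 1 ∨ I = Ioi (0:ℝ))
    (p₁ p₂ q₁ q₂ : ℝ≥0∞)
    (hp₁ : 0 < p₁) (hp₁' : p₁ ≠ ⊤) (hp₂ : 0 < p₂) (hp₂' : p₂ ≠ ⊤)
    (hq₁ : 0 < q₁) (hq₂ : 0 < q₂)
    (hcase : p₁ < p₂ ∨ (p₁ = p₂ ∧ q₂ < q₁))
    (x : ℝ → ℝ) (hx : Measurable x)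
    (hmul : ∀ y : ℝ → ℝ, Measurable y → lorentzNorm I p₁ q₁ y ≠ ⊤ →
      lorentzNorm I p₂ q₂ (fun t => x t * y t) ≠ ⊤) :
    ∀ᵐ t ∂(volume.restrict I), x t = 0 := by
  by_contra hne
  have hIm : MeasurableSet I := by
    rcases hI with rfl | rfl
    exacts [measurableSet_Ioo, measurableSet_Ioi]
  have hI0 : I ⊆ Ioi 0 := by
    rcases hI with rfl | rfl
    exacts [Ioo_subset_Ioi_self, subset_rfl]
  obtain ⟨A, hAI, hAm, hA0, ⟨R, hAR⟩, ε, hε, hAx⟩ := exists_subset_le_abs hIm hI0 hx hne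
  have hfin : volume A ≠ ⊤ := measure_ne_top_of_subset hAR (by simp)
  obtain ⟨g, hg, hg₁, hg₂⟩ := exists_isProfile (ENNReal.toReal_pos hA0.ne' hfin)
    hp₁ hp₁' hp₂' hq₁ hq₂ hcase
  exact hg₂ (weightedMem_of_lorentzNorm_ne_top hq₂ hAR hAI hε hAx hg
    (hmul _ (measurable_transplant hAm hfin hg.measurable)
      (lorentzNorm_transplant_ne_top hq₁ hAR hg hg₁)))
end

section
/- Let I = (0,1) or I = (0,∞), let 0 < p_1, p_2 < ∞ and 0 < q_1, q_2 ≤ ∞, and suppose that either p_1 > p_2, or p_1 = p_2 and q_1 ≤ q_2. Define p_3, q_3 by 1/p_3 = 1/p_2 − 1/p_1 and 1/q_3 = 1/q_2 − 1/q_1 if q_1 > q_2, q_3 = ∞ if q_1 ≤ q_2 (with the convention L^{∞,∞} = L^∞). Then M(L^{p_1,q_1}(I), L^{p_2,q_2}(I)) = L^{p_3,q_3}(I): a measurable x on I satisfies x·y ∈ L^{p_2,q_2}(I) for every y ∈ L^{p_1,q_1}(I) if and only if x ∈ L^{p_3,q_3}(I). -/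
open MeasureTheory Set
open scoped ENNReal

/-- The `ℓ^q` functional on `[0,∞]`-valued sequences: the supremum if `q = ∞`, and the
unnormalized sum `∑ f^q` if `q < ∞`. -/
noncomputable def seqSum (q : ℝ≥0∞) (f : ℤ → ℝ≥0∞) : ℝ≥0∞ :=
  open Classical in if q = ⊤ then ⨆ k, f k else ∑' k, f k ^ q.toReal

lemma seqSum_top (f : ℤ → ℝ≥0∞) : seqSum ⊤ f = ⨆ k, f k := if_pos rfl

lemma seqSum_of_ne_top {q : ℝ≥0∞} (hq : q ≠ ⊤) (f : ℤ → ℝ≥0∞) :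
    seqSum q f = ∑' k, f k ^ q.toReal := if_neg hq

lemma seqSum_mono (q : ℝ≥0∞) {f g : ℤ → ℝ≥0∞} (h : ∀ k, f k ≤ g k) :
    seqSum q f ≤ seqSum q g := by
  unfold seqSum
  split_ifs
  · exact iSup_mono h
  · exact ENNReal.tsum_le_tsum fun k => ENNReal.rpow_le_rpow (h k) ENNReal.toReal_nonneg

lemma seqSum_const_mul_ne_top {q : ℝ≥0∞} {f : ℤ → ℝ≥0∞} {c : ℝ≥0∞} (hc : c ≠ ⊤)
    (h : seqSum q f ≠ ⊤) : seqSum q (fun k => c * f k) ≠ ⊤ := by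
  by_cases hq : q = ⊤
  · subst hq
    rw [seqSum_top] at h ⊢
    rw [← ENNReal.mul_iSup]
    exact ENNReal.mul_ne_top hc h
  · rw [seqSum_of_ne_top hq] at h ⊢
    simp_rw [ENNReal.mul_rpow_of_nonneg _ _ ENNReal.toReal_nonneg]
    rw [ENNReal.tsum_mul_left]
    exact ENNReal.mul_ne_top (ENNReal.rpow_ne_top_of_nonneg ENNReal.toReal_nonneg hc) h

lemma seqSum_shift (q : ℝ≥0∞) (f : ℤ → ℝ≥0∞) (m : ℤ) :
    seqSum q (fun k => f (k + m)) = seqSum q f := by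
  unfold seqSum
  split_ifs
  · exact (Equiv.addRight m).iSup_comp (g := f)
  · exact (Equiv.addRight m).tsum_eq (fun k => f k ^ q.toReal)

/-- A weighted shift comparison which transfers finiteness. -/
lemma seqSum_ne_top_of_le {q : ℝ≥0∞} {f g : ℤ → ℝ≥0∞} {c : ℝ≥0∞} (hc : c ≠ ⊤) (m : ℤ)
    (h : ∀ k, f k ≤ c * g (k + m)) (hg : seqSum q g ≠ ⊤) : seqSum q f ≠ ⊤ := by
  refine ne_top_of_le_ne_top ?_ (seqSum_mono q h)
  exact seqSum_const_mul_ne_top hc (by rwa [seqSum_shift])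

lemma le_seqSum {q : ℝ≥0∞} (hq : q ≠ ⊤) (f : ℤ → ℝ≥0∞) (k : ℤ) :
    f k ^ q.toReal ≤ seqSum q f := by
  rw [seqSum_of_ne_top hq]
  exact ENNReal.le_tsum (f := fun k => f k ^ q.toReal) k

lemma toReal_pos_of_ne {q : ℝ≥0∞} (hq0 : 0 < q) (hq : q ≠ ⊤) : 0 < q.toReal :=
  ENNReal.toReal_pos hq0.ne' hq

/-- `ℓ^q ⊆ ℓ^∞`. -/
lemma iSup_ne_top_of_seqSum {q : ℝ≥0∞} (hq0 : 0 < q) {f : ℤ → ℝ≥0∞} (h : seqSum q f ≠ ⊤) :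
    ⨆ k, f k ≠ ⊤ := by
  by_cases hq : q = ⊤
  · subst hq
    rwa [seqSum_top] at h
  · have hr := toReal_pos_of_ne hq0 hq
    refine ne_top_of_le_ne_top
      (ENNReal.rpow_ne_top_of_nonneg (inv_nonneg.2 hr.le) h) (iSup_le fun k => ?_)
    rw [ENNReal.le_rpow_inv_iff hr]
    exact le_seqSum hq f k

lemma ne_top_of_seqSum {q : ℝ≥0∞} (hq0 : 0 < q) {f : ℤ → ℝ≥0∞} (h : seqSum q f ≠ ⊤) (k : ℤ) :
    f k ≠ ⊤ :=
  ne_top_of_le_ne_top (iSup_ne_top_of_seqSum hq0 h) (le_iSup f k)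

/-- `ℓ^p ⊆ ℓ^q` for `p ≤ q`. -/
lemma seqSum_ne_top_of_exponent_le {p q : ℝ≥0∞} (hp0 : 0 < p) (hpq : p ≤ q) {f : ℤ → ℝ≥0∞}
    (h : seqSum p f ≠ ⊤) : seqSum q f ≠ ⊤ := by
  by_cases hq : q = ⊤
  · subst hq
    rw [seqSum_top]
    exact iSup_ne_top_of_seqSum hp0 h
  · have hp : p ≠ ⊤ := ne_top_of_le_ne_top hq hpq
    have hM := iSup_ne_top_of_seqSum hp0 h
    have hle : p.toReal ≤ q.toReal := ENNReal.toReal_mono hq hpq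
    rw [seqSum_of_ne_top hp] at h
    rw [seqSum_of_ne_top hq]
    refine ne_top_of_le_ne_top
      (ENNReal.mul_ne_top (ENNReal.rpow_ne_top_of_nonneg (sub_nonneg.2 hle) hM) h) ?_
    rw [← ENNReal.tsum_mul_left]
    refine ENNReal.tsum_le_tsum fun k => ?_
    calc f k ^ q.toReal = f k ^ (q.toReal - p.toReal) * f k ^ p.toReal := by
          rw [← ENNReal.rpow_add_of_nonneg _ _ (sub_nonneg.2 hle) ENNReal.toReal_nonneg,
            sub_add_cancel]
      _ ≤ _ := by
          gcongr
          exact le_iSup f k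

/-- The relation between the exponents `q₁`, `q₂`, `q₃` in the multiplier theorem. -/
def MultiplierExponent (q₁ q₂ q₃ : ℝ≥0∞) : Prop :=
  (q₂ < q₁ ∧ q₃⁻¹ = q₂⁻¹ - q₁⁻¹) ∨ (q₁ ≤ q₂ ∧ q₃ = ⊤)

lemma exponent_eq_of_top {q₂ q₃ : ℝ≥0∞} (h : q₃⁻¹ = q₂⁻¹ - (⊤ : ℝ≥0∞)⁻¹) : q₃ = q₂ := by
  rw [ENNReal.inv_top, tsub_zero] at h
  exact inv_inj.1 h

lemma exponent_pos {q₂ q₁ q₃ : ℝ≥0∞} (hq₂ : 0 < q₂) (h : q₃⁻¹ = q₂⁻¹ - q₁⁻¹) : 0 < q₃ := by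
  rw [← ENNReal.inv_ne_top.trans pos_iff_ne_zero.symm, h]
  exact ne_top_of_le_ne_top (ENNReal.inv_ne_top.2 hq₂.ne') tsub_le_self

lemma exponent_ne_top {q₂ q₁ q₃ : ℝ≥0∞} (hlt : q₂ < q₁) (h : q₃⁻¹ = q₂⁻¹ - q₁⁻¹) : q₃ ≠ ⊤ := by
  rw [← ENNReal.inv_ne_zero, h]
  exact (tsub_pos_of_lt (ENNReal.inv_lt_inv.2 hlt)).ne'

lemma exponent_toReal {q₂ q₁ q₃ : ℝ≥0∞} (hq₂ : 0 < q₂) (hlt : q₂ < q₁)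
    (h : q₃⁻¹ = q₂⁻¹ - q₁⁻¹) : q₃.toReal⁻¹ = q₂.toReal⁻¹ - q₁.toReal⁻¹ := by
  rw [← ENNReal.toReal_inv, h, ENNReal.toReal_sub_of_le (ENNReal.inv_le_inv.2 hlt.le)
    (ENNReal.inv_ne_top.2 hq₂.ne'), ENNReal.toReal_inv, ENNReal.toReal_inv]

/-- Hölder's inequality and the inclusions of `ℓ^q` spaces: `ℓ^{q₃} · ℓ^{q₁} ⊆ ℓ^{q₂}`. -/
lemma seqSum_mul_ne_top {q₁ q₂ q₃ : ℝ≥0∞} (hq₁ : 0 < q₁) (hq₂ : 0 < q₂)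
    (hq₃ : MultiplierExponent q₁ q₂ q₃) {a b : ℤ → ℝ≥0∞}
    (ha : seqSum q₃ a ≠ ⊤) (hb : seqSum q₁ b ≠ ⊤) : seqSum q₂ (fun k => a k * b k) ≠ ⊤ := by
  rcases hq₃ with ⟨hlt, h⟩ | ⟨hle, rfl⟩
  · by_cases hq₁t : q₁ = ⊤
    · subst hq₁t
      obtain rfl := exponent_eq_of_top h
      rw [seqSum_top] at hb
      refine seqSum_ne_top_of_le hb 0 (fun k => ?_) ha
      rw [add_zero, mul_comm]
      gcongr
      exact le_iSup b k
    · have hq₂t : q₂ ≠ ⊤ := hlt.ne_top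
      have hq₃t := exponent_ne_top hlt h
      have hr₁ := toReal_pos_of_ne hq₁ hq₁t
      have hr₂ := toReal_pos_of_ne hq₂ hq₂t
      have hr₃ := toReal_pos_of_ne (exponent_pos hq₂ h) hq₃t
      have hr := exponent_toReal hq₂ hlt h
      rw [seqSum_of_ne_top hq₃t] at ha
      rw [seqSum_of_ne_top hq₁t] at hb
      rw [seqSum_of_ne_top hq₂t]
      refine ne_top_of_le_ne_top (ENNReal.add_ne_top.2 ⟨ha, hb⟩) ?_
      rw [← ENNReal.tsum_add]
      refine ENNReal.tsum_le_tsum fun k => ?_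
      set m := max (a k ^ q₃.toReal) (b k ^ q₁.toReal)
      calc (a k * b k) ^ q₂.toReal
          ≤ (m ^ q₃.toReal⁻¹ * m ^ q₁.toReal⁻¹) ^ q₂.toReal := by
            gcongr
            · rw [ENNReal.le_rpow_inv_iff hr₃]
              exact le_max_left _ _
            · rw [ENNReal.le_rpow_inv_iff hr₁]
              exact le_max_right _ _
        _ = m := by
            rw [← ENNReal.rpow_add_of_nonneg _ _ (by positivity) (by positivity), hr,
              sub_add_cancel, ENNReal.rpow_inv_rpow hr₂.ne']
        _ ≤ _ := max_le le_self_add le_add_self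
  · rw [seqSum_top] at ha
    refine seqSum_ne_top_of_le ha 0 (fun k => ?_) (seqSum_ne_top_of_exponent_le hq₁ hle hb)
    rw [add_zero]
    gcongr
    exact le_iSup a k

/-- If `a ∉ ℓ^{q₃}` and `q₁ < ∞`, then multiplication by `a` is not bounded from `ℓ^{q₁}`
to `ℓ^{q₂}`. -/
lemma exists_seqSum_mul_ge {q₁ q₂ q₃ : ℝ≥0∞} (hq₁ : 0 < q₁) (hq₁t : q₁ ≠ ⊤) (hq₂ : 0 < q₂)
    (hq₃ : MultiplierExponent q₁ q₂ q₃) {a : ℤ → ℝ≥0∞} (hfin : ∀ k, a k ≠ ⊤)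
    (ha : seqSum q₃ a = ⊤) {ε R : ℝ≥0∞} (hε : ε ≠ 0) (hεt : ε ≠ ⊤) (hR : R ≠ ⊤) :
    ∃ b : ℤ → ℝ≥0∞, seqSum q₁ b ≤ ε ∧ R ≤ seqSum q₂ (fun k => a k * b k) := by
  have hr₁ := toReal_pos_of_ne hq₁ hq₁t
  rcases hq₃ with ⟨hlt, h⟩ | ⟨hle, rfl⟩
  · have hq₂t : q₂ ≠ ⊤ := hlt.ne_top
    have hq₃t := exponent_ne_top hlt h
    have hr₂ := toReal_pos_of_ne hq₂ hq₂t
    have hr₃ := toReal_pos_of_ne (exponent_pos hq₂ h) hq₃t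
    have hr := exponent_toReal hq₂ hlt h
    set r₁ := q₁.toReal with hr₁def
    set r₂ := q₂.toReal with hr₂def
    set r₃ := q₃.toReal with hr₃def
    have hθ : 0 < r₂ / r₃ := by positivity
    have hsum : r₂ / r₃ + r₂ / r₁ = 1 := by
      have : r₂ * r₃⁻¹ = 1 - r₂ * r₁⁻¹ := by rw [hr, mul_sub, mul_inv_cancel₀ hr₂.ne']
      rw [div_eq_mul_inv, div_eq_mul_inv, this, sub_add_cancel]
    rw [seqSum_of_ne_top hq₃t] at ha
    set Q : ℝ≥0∞ := max 1 ((R / ε ^ (r₂ / r₁)) ^ (r₂ / r₃)⁻¹) with hQ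
    have hεr : ε ^ (r₂ / r₁) ≠ 0 := (ENNReal.rpow_pos (pos_iff_ne_zero.2 hε) hεt).ne'
    have hεrt : ε ^ (r₂ / r₁) ≠ ⊤ := ENNReal.rpow_ne_top_of_nonneg (by positivity) hεt
    have hQt : Q < ⊤ := max_lt ENNReal.one_lt_top
      (ENNReal.rpow_lt_top_of_nonneg (by positivity) (ENNReal.div_ne_top hR hεr))
    obtain ⟨F, hF⟩ : ∃ F : Finset ℤ, Q < ∑ k ∈ F, a k ^ r₃ := by
      rw [ENNReal.tsum_eq_iSup_sum] at ha
      rw [← ha] at hQt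
      exact lt_iSup_iff.1 hQt
    set A := ∑ k ∈ F, a k ^ r₃ with hA
    have hAt : A ≠ ⊤ := ENNReal.sum_ne_top.2 fun k _ =>
      ENNReal.rpow_ne_top_of_nonneg hr₃.le (hfin k)
    have hA0 : A ≠ 0 := (zero_lt_one.trans_le ((le_max_left _ _).trans hF.le)).ne'
    refine ⟨fun k => if k ∈ F then (a k ^ r₃ * (ε / A)) ^ r₁⁻¹ else 0, ?_, ?_⟩
    · rw [seqSum_of_ne_top hq₁t, tsum_eq_sum (s := F)]
      · calc _ = ∑ k ∈ F, a k ^ r₃ * (ε / A) := by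
              refine Finset.sum_congr rfl fun k hk => ?_
              simp only [if_pos hk]
              exact ENNReal.rpow_inv_rpow hr₁.ne' _
          _ = ε := by rw [← Finset.sum_mul, ← hA, ENNReal.mul_div_cancel hA0 hAt]
          _ ≤ ε := le_rfl
      · intro k hk
        simp only [if_neg hk]
        exact ENNReal.zero_rpow_of_pos hr₁
    · rw [seqSum_of_ne_top hq₂t]
      refine le_trans ?_ (ENNReal.sum_le_tsum F)
      have key : ∀ k ∈ F, (a k * (if k ∈ F then (a k ^ r₃ * (ε / A)) ^ r₁⁻¹ else 0)) ^ r₂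
          = a k ^ r₃ * (ε / A) ^ (r₂ / r₁) := by
        intro k hk
        rw [if_pos hk, ENNReal.mul_rpow_of_nonneg _ _ hr₂.le, ← ENNReal.rpow_mul,
          inv_mul_eq_div, ENNReal.mul_rpow_of_nonneg _ _ (by positivity), ← mul_assoc,
          ← ENNReal.rpow_mul, ← ENNReal.rpow_add_of_nonneg _ _ hr₂.le (by positivity)]
        congr 2
        calc r₂ + r₃ * (r₂ / r₁) = r₃ * (r₂ / r₃ + r₂ / r₁) := by field_simp
          _ = r₃ := by rw [hsum, mul_one]
      rw [Finset.sum_congr rfl key, ← Finset.sum_mul, ← hA,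
        ENNReal.div_rpow_of_nonneg _ _ (by positivity)]
      have hAs : A = A ^ (r₂ / r₃) * A ^ (r₂ / r₁) := by
        rw [← ENNReal.rpow_add_of_nonneg _ _ (by positivity) (by positivity), hsum,
          ENNReal.rpow_one]
      have hAp0 : A ^ (r₂ / r₁) ≠ 0 := (ENNReal.rpow_pos (pos_iff_ne_zero.2 hA0) hAt).ne'
      have hApt : A ^ (r₂ / r₁) ≠ ⊤ := ENNReal.rpow_ne_top_of_nonneg (by positivity) hAt
      calc R = R / ε ^ (r₂ / r₁) * ε ^ (r₂ / r₁) := (ENNReal.div_mul_cancel hεr hεrt).symm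
        _ ≤ A ^ (r₂ / r₃) * ε ^ (r₂ / r₁) := by
            gcongr
            have h1 : (R / ε ^ (r₂ / r₁)) ^ (r₂ / r₃)⁻¹ ≤ A := (le_max_right _ _).trans hF.le
            rwa [ENNReal.rpow_inv_le_iff hθ] at h1
        _ = A ^ (r₂ / r₃) * A ^ (r₂ / r₁) * (ε ^ (r₂ / r₁) / A ^ (r₂ / r₁)) := by
            rw [mul_assoc, ENNReal.mul_div_cancel hAp0 hApt]
        _ = A * (ε ^ (r₂ / r₁) / A ^ (r₂ / r₁)) := by rw [← hAs]
  · rw [seqSum_top] at ha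
    set δ := ε ^ q₁.toReal⁻¹
    have hδ0 : δ ≠ 0 := (ENNReal.rpow_pos (pos_iff_ne_zero.2 hε) hεt).ne'
    have hδt : δ ≠ ⊤ := ENNReal.rpow_ne_top_of_nonneg (by positivity) hεt
    set S : ℝ≥0∞ := max R (R ^ q₂.toReal⁻¹)
    have hSt : S ≠ ⊤ := (max_lt hR.lt_top
      (ENNReal.rpow_lt_top_of_nonneg (inv_nonneg.2 ENNReal.toReal_nonneg) hR)).ne
    obtain ⟨j, hj⟩ : ∃ j, S / δ < a j := by
      have hlt : S / δ < ⨆ k, a k := by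
        rw [ha]
        exact (ENNReal.div_ne_top hSt hδ0).lt_top
      exact lt_iSup_iff.1 hlt
    have hS : S ≤ a j * δ := by
      rw [← ENNReal.div_le_iff hδ0 hδt]
      exact hj.le
    refine ⟨fun k => if k = j then δ else 0, ?_, ?_⟩
    · rw [seqSum_of_ne_top hq₁t, tsum_eq_single j]
      · simp only [if_true]
        exact (ENNReal.rpow_inv_rpow hr₁.ne' ε).le
      · intro k hk
        simp only [if_neg hk]
        exact ENNReal.zero_rpow_of_pos hr₁
    · by_cases hq₂t : q₂ = ⊤
      · subst hq₂t
        rw [seqSum_top]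
        refine le_trans ?_ (le_iSup _ j)
        simp only [if_true]
        exact (le_max_left _ _).trans hS
      · refine le_trans ?_ (le_seqSum hq₂t _ j)
        simp only [if_true]
        rw [← ENNReal.rpow_inv_le_iff (toReal_pos_of_ne hq₂ hq₂t)]
        exact (le_max_right _ _).trans hS

/-- If `a ∉ ℓ^{q₃}`, then `a` is not a multiplier from `ℓ^{q₁}` to `ℓ^{q₂}`. -/
lemma exists_seqSum_mul_eq_top {q₁ q₂ q₃ : ℝ≥0∞} (hq₁ : 0 < q₁) (hq₂ : 0 < q₂)
    (hq₃ : MultiplierExponent q₁ q₂ q₃) {a : ℤ → ℝ≥0∞} (hfin : ∀ k, a k ≠ ⊤)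
    (ha : seqSum q₃ a = ⊤) :
    ∃ b : ℤ → ℝ≥0∞, seqSum q₁ b ≠ ⊤ ∧ seqSum q₂ (fun k => a k * b k) = ⊤ := by
  by_cases hq₁t : q₁ = ⊤
  · subst hq₁t
    refine ⟨fun _ => 1, by simp [seqSum_top], ?_⟩
    have : q₃ = q₂ := by
      rcases hq₃ with ⟨-, h⟩ | ⟨hle, rfl⟩
      · exact exponent_eq_of_top h
      · exact (top_le_iff.1 hle).symm
    simpa [← this] using ha
  · have hr₁ := toReal_pos_of_ne hq₁ hq₁t
    have hpow : ∀ n : ℕ, (2⁻¹ : ℝ≥0∞) ^ n ≠ 0 := fun n => by simp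
    have hpowt : ∀ n : ℕ, (2⁻¹ : ℝ≥0∞) ^ n ≠ ⊤ := fun n => by simp
    choose b hb hab using fun n : ℕ => exists_seqSum_mul_ge hq₁ hq₁t hq₂ hq₃ hfin ha
      (hpow n) (hpowt n) (ENNReal.natCast_ne_top n)
    refine ⟨fun k => (∑' n, b n k ^ q₁.toReal) ^ q₁.toReal⁻¹, ?_, ?_⟩
    · rw [seqSum_of_ne_top hq₁t]
      simp_rw [ENNReal.rpow_inv_rpow hr₁.ne']
      rw [ENNReal.tsum_comm]
      refine ne_top_of_le_ne_top (b := ∑' n : ℕ, (2⁻¹ : ℝ≥0∞) ^ n) (by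
        rw [ENNReal.tsum_geometric, ENNReal.one_sub_inv_two, inv_inv]
        exact ENNReal.ofNat_ne_top) (ENNReal.tsum_le_tsum fun n => ?_)
      rw [← seqSum_of_ne_top hq₁t]
      exact hb n
    · refine ENNReal.eq_top_of_forall_nnreal_le fun r => ?_
      obtain ⟨n, hn⟩ := exists_nat_ge r
      calc (r : ℝ≥0∞) ≤ (n : ℝ≥0∞) := by exact_mod_cast hn
        _ ≤ _ := hab n
        _ ≤ _ := seqSum_mono _ fun k => by
          gcongr
          rw [ENNReal.le_rpow_inv_iff hr₁]
          exact ENNReal.le_tsum (f := fun n => b n k ^ q₁.toReal) n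

lemma rearr_le {I : Set ℝ} {x : ℝ → ℝ} {t a : ℝ} (ha : 0 < a)
    (h : volume {s : ℝ | s ∈ I ∧ a < |x s|} ≤ ENNReal.ofReal t) :
    rearr I x t ≤ ENNReal.ofReal a :=
  sInf_le ⟨a, ⟨ha, h⟩, rfl⟩

lemma exists_of_rearr_lt {I : Set ℝ} {x : ℝ → ℝ} {t : ℝ} {c : ℝ≥0∞} (h : rearr I x t < c) :
    ∃ a : ℝ, 0 < a ∧ volume {s : ℝ | s ∈ I ∧ a < |x s|} ≤ ENNReal.ofReal t ∧
      ENNReal.ofReal a < c := by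
  obtain ⟨-, ⟨a, ⟨ha, hv⟩, rfl⟩, hlt⟩ := sInf_lt_iff.1 h
  exact ⟨a, ha, hv, hlt⟩

lemma rearr_anti (I : Set ℝ) (x : ℝ → ℝ) {s t : ℝ} (h : s ≤ t) : rearr I x t ≤ rearr I x s :=
  sInf_le_sInf (image_mono fun _ ha => ⟨ha.1, ha.2.trans (ENNReal.ofReal_le_ofReal h)⟩)

lemma rearr_eq_zero {I : Set ℝ} (x : ℝ → ℝ) {t : ℝ} (h : volume I ≤ ENNReal.ofReal t) :
    rearr I x t = 0 := by
  refine le_antisymm (ENNReal.le_of_forall_pos_le_add fun ε hε _ => ?_) zero_le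
  rw [zero_add, ← ENNReal.ofReal_coe_nnreal]
  exact rearr_le (by exact_mod_cast hε) ((measure_mono fun s hs => hs.1).trans h)

/-- `(xy)*(s + t) ≤ x*(s) y*(t)`, for points where the factors are finite. -/
lemma rearr_mul_le {I : Set ℝ} {x y : ℝ → ℝ} {s t : ℝ} (hs : 0 ≤ s) (ht : 0 ≤ t)
    (hx : rearr I x s ≠ ⊤) (hy : rearr I y t ≠ ⊤) :
    rearr I (fun u => x u * y u) (s + t) ≤ rearr I x s * rearr I y t := by
  refine ENNReal.le_mul_of_forall_lt (Or.inr hy) (Or.inl hx) fun u hu v hv => ?_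
  obtain ⟨a, ha, hav, hau⟩ := exists_of_rearr_lt hu
  obtain ⟨b, hb, hbv, hbu⟩ := exists_of_rearr_lt hv
  calc rearr I (fun u => x u * y u) (s + t) ≤ ENNReal.ofReal (a * b) := by
        refine rearr_le (mul_pos ha hb) ?_
        rw [ENNReal.ofReal_add hs ht]
        refine (measure_mono ?_).trans ((measure_union_le _ _).trans (add_le_add hav hbv))
        rintro z ⟨hz, hlt⟩
        by_contra hcon
        simp only [mem_union, mem_ofPred_eq, not_or, not_and, not_lt] at hcon
        rw [abs_mul] at hlt
        exact absurd (mul_le_mul (hcon.1 hz) (hcon.2 hz) (abs_nonneg _) ha.le) hlt.not_ge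
    _ = ENNReal.ofReal a * ENNReal.ofReal b := ENNReal.ofReal_mul ha.le
    _ ≤ u * v := mul_le_mul' hau.le hbu.le

lemma two_rpow_ne_zero (u : ℝ) : (2 : ℝ≥0∞) ^ u ≠ 0 :=
  (ENNReal.rpow_pos (by norm_num) ENNReal.ofNat_ne_top).ne'

lemma two_rpow_ne_top (u : ℝ) : (2 : ℝ≥0∞) ^ u ≠ ⊤ :=
  ENNReal.rpow_ne_top_of_ne_zero (by norm_num) ENNReal.ofNat_ne_top

lemma two_rpow_add (u v : ℝ) : (2 : ℝ≥0∞) ^ (u + v) = 2 ^ u * 2 ^ v :=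
  ENNReal.rpow_add u v (by norm_num) ENNReal.ofNat_ne_top

lemma two_rpow_mul_neg (u : ℝ) : (2 : ℝ≥0∞) ^ u * 2 ^ (-u) = 1 := by
  rw [← two_rpow_add, add_neg_cancel, ENNReal.rpow_zero]

lemma ofReal_two_rpow (u : ℝ) : ENNReal.ofReal ((2 : ℝ) ^ u) = 2 ^ u := by
  rw [← ENNReal.ofReal_rpow_of_pos two_pos, ENNReal.ofReal_ofNat]

/-- The dyadic samples `2^{kr} x*(2^k)` of a weighted decreasing rearrangement. -/
noncomputable def dyadicSample (I : Set ℝ) (r : ℝ) (x : ℝ → ℝ) (k : ℤ) : ℝ≥0∞ :=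
  (2 : ℝ≥0∞) ^ ((k : ℝ) * r) * rearr I x ((2 : ℝ) ^ (k : ℝ))

lemma rearr_eq_two_rpow_mul_dyadicSample (I : Set ℝ) (r : ℝ) (x : ℝ → ℝ) (k : ℤ) :
    rearr I x ((2 : ℝ) ^ (k : ℝ)) = 2 ^ (-((k : ℝ) * r)) * dyadicSample I r x k := by
  rw [dyadicSample, ← mul_assoc, mul_comm _ ((2 : ℝ≥0∞) ^ ((k : ℝ) * r)), two_rpow_mul_neg,
    one_mul]

/-- The dyadic interval `[2^k, 2^{k+1})`. -/
def dyadicIco (k : ℤ) : Set ℝ := Ico ((2 : ℝ) ^ (k : ℝ)) ((2 : ℝ) ^ ((k : ℝ) + 1))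

lemma two_rpow_succ (k : ℤ) : (2 : ℝ) ^ ((k : ℝ) + 1) = 2 * (2 : ℝ) ^ (k : ℝ) := by
  rw [Real.rpow_add two_pos, Real.rpow_one, mul_comm]

lemma volume_dyadicIco (k : ℤ) : volume (dyadicIco k) = (2 : ℝ≥0∞) ^ (k : ℝ) := by
  rw [dyadicIco, Real.volume_Ico, two_rpow_succ, ← ofReal_two_rpow]
  congr 1
  ring

lemma measurableSet_dyadicIco (k : ℤ) : MeasurableSet (dyadicIco k) := measurableSet_Ico

lemma pos_of_mem_dyadicIco {k : ℤ} {t : ℝ} (ht : t ∈ dyadicIco k) : 0 < t :=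
  (Real.rpow_pos_of_pos two_pos _).trans_le ht.1

lemma iUnion_dyadicIco : ⋃ k, dyadicIco k = Ioi (0 : ℝ) := by
  ext t
  simp only [mem_iUnion, mem_Ioi]
  refine ⟨fun ⟨k, hk⟩ => pos_of_mem_dyadicIco hk, fun ht => ?_⟩
  obtain ⟨k, hk⟩ := exists_mem_Ico_zpow ht one_lt_two
  refine ⟨k, ?_⟩
  rw [dyadicIco, Real.rpow_intCast]
  have : (2 : ℝ) ^ ((k : ℝ) + 1) = 2 ^ (k + 1) := by
    rw [← Real.rpow_intCast]
    push_cast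
    rfl
  rwa [this]

lemma pairwise_disjoint_dyadicIco : Pairwise (Function.onFun Disjoint dyadicIco) := by
  have hmono : Monotone fun k : ℤ => (2 : ℝ) ^ (k : ℝ) := fun a b h =>
    Real.rpow_le_rpow_of_exponent_le one_le_two (by exact_mod_cast h)
  convert hmono.pairwise_disjoint_on_Ico_succ using 3 with k
  simp [dyadicIco]

lemma ofReal_rpow_mul_rearr_le {I : Set ℝ} {r : ℝ} (hr : 0 ≤ r) (x : ℝ → ℝ) {k : ℤ} {t : ℝ}
    (ht : t ∈ dyadicIco k) :
    ENNReal.ofReal t ^ r * rearr I x t ≤ 2 ^ r * dyadicSample I r x k := by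
  rw [dyadicSample, ← mul_assoc, ← two_rpow_add]
  gcongr
  · calc ENNReal.ofReal t ^ r ≤ (ENNReal.ofReal (2 ^ ((k : ℝ) + 1))) ^ r := by
          gcongr
          exact ht.2.le
      _ = 2 ^ (r + k * r) := by
          rw [ofReal_two_rpow, ← ENNReal.rpow_mul]
          congr 1
          ring
  · exact rearr_anti I x ht.1

lemma dyadicSample_succ_le {I : Set ℝ} {r : ℝ} (hr : 0 ≤ r) (x : ℝ → ℝ) {k : ℤ} {t : ℝ}
    (ht : t ∈ dyadicIco k) :
    dyadicSample I r x (k + 1) ≤ 2 ^ r * (ENNReal.ofReal t ^ r * rearr I x t) := by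
  rw [dyadicSample, ← mul_assoc]
  push_cast
  gcongr
  · calc (2 : ℝ≥0∞) ^ (((k : ℝ) + 1) * r) = 2 ^ r * ENNReal.ofReal (2 ^ (k : ℝ)) ^ r := by
          rw [ofReal_two_rpow, ← ENNReal.rpow_mul, ← two_rpow_add]
          congr 1
          ring
      _ ≤ _ := by
          gcongr
          exact ht.1
  · exact rearr_anti I x ht.2.le

/-- The Lorentz integrand vanishes beyond the measure of `I`, so the integral may be taken
over the whole half line. -/
lemma lintegral_lorentz_eq (I : Set ℝ) (r : ℝ) {q : ℝ} (hq : 0 < q) (x : ℝ → ℝ) :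
    ∫⁻ t in {t : ℝ | 0 < t ∧ ENNReal.ofReal t < volume I},
        (ENNReal.ofReal t ^ r * rearr I x t) ^ q / ENNReal.ofReal t =
      ∑' k, ∫⁻ t in dyadicIco k,
        (ENNReal.ofReal t ^ r * rearr I x t) ^ q / ENNReal.ofReal t := by
  rw [← lintegral_iUnion measurableSet_dyadicIco pairwise_disjoint_dyadicIco, iUnion_dyadicIco]
  have hm : MeasurableSet {t : ℝ | 0 < t ∧ ENNReal.ofReal t < volume I} :=
    (measurableSet_lt measurable_const measurable_id).inter
      (measurableSet_lt ENNReal.measurable_ofReal measurable_const)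
  rw [← lintegral_indicator hm, ← lintegral_indicator measurableSet_Ioi]
  congr 1
  ext t
  by_cases h0 : 0 < t
  · by_cases hv : ENNReal.ofReal t < volume I
    · have hmem : t ∈ {t : ℝ | 0 < t ∧ ENNReal.ofReal t < volume I} := ⟨h0, hv⟩
      rw [indicator_of_mem (show t ∈ Ioi (0 : ℝ) from h0), indicator_of_mem hmem]
    · rw [indicator_of_mem (show t ∈ Ioi (0 : ℝ) from h0), indicator_of_notMem fun h => hv h.2,
        rearr_eq_zero x (not_lt.1 hv), mul_zero, ENNReal.zero_rpow_of_pos hq, ENNReal.zero_div]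
  · rw [indicator_of_notMem (show t ∉ Ioi (0 : ℝ) from h0), indicator_of_notMem fun h => h0 h.1]

/-- Dyadic description of Lorentz spaces. -/
lemma lorentzNorm_ne_top_iff (I : Set ℝ) (p : ℝ≥0∞) {q : ℝ≥0∞} (hq0 : 0 < q) (x : ℝ → ℝ) :
    lorentzNorm I p q x ≠ ⊤ ↔ seqSum q (dyadicSample I p⁻¹.toReal x) ≠ ⊤ := by
  set r := p⁻¹.toReal with hrdef
  have hr : 0 ≤ r := ENNReal.toReal_nonneg
  by_cases hq : q = ⊤
  · subst hq
    rw [lorentzNorm, if_pos rfl, seqSum_top]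
    constructor
    · refine fun h => ne_top_of_le_ne_top h (iSup_le fun k => ?_)
      have hpos : (0 : ℝ) < 2 ^ (k : ℝ) := Real.rpow_pos_of_pos two_pos _
      by_cases hv : ENNReal.ofReal (2 ^ (k : ℝ)) < volume I
      · refine le_trans (le_of_eq ?_) (le_iSup₂_of_le ((2 : ℝ) ^ (k : ℝ)) ⟨hpos, hv⟩ le_rfl)
        rw [dyadicSample, ofReal_two_rpow, ← ENNReal.rpow_mul]
      · rw [dyadicSample, rearr_eq_zero x (not_lt.1 hv), mul_zero]
        exact zero_le
    · refine fun h => ne_top_of_le_ne_top (ENNReal.mul_ne_top (two_rpow_ne_top r) h)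
        (iSup₂_le fun t ht => ?_)
      obtain ⟨k, hk⟩ := mem_iUnion.1 (iUnion_dyadicIco.symm ▸ ht.1 : t ∈ ⋃ k, dyadicIco k)
      refine (ofReal_rpow_mul_rearr_le hr x hk).trans ?_
      gcongr
      exact le_iSup (dyadicSample I r x) k
  · have hqr := toReal_pos_of_ne hq0 hq
    rw [lorentzNorm, if_neg hq, lintegral_lorentz_eq I r hqr x, Ne,
      ENNReal.rpow_eq_top_iff_of_pos (by rw [ENNReal.toReal_inv]; positivity)]
    constructor
    · intro h
      have hlow : seqSum q (fun k => (2 : ℝ≥0∞) ^ (-(r + q.toReal⁻¹)) *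
          dyadicSample I r x (k + 1)) ≠ ⊤ := by
        rw [seqSum_of_ne_top hq]
        refine ne_top_of_le_ne_top h (ENNReal.tsum_le_tsum fun k => ?_)
        calc ((2 : ℝ≥0∞) ^ (-(r + q.toReal⁻¹)) * dyadicSample I r x (k + 1)) ^ q.toReal
            = ((2 ^ (-r) * dyadicSample I r x (k + 1)) ^ q.toReal / 2 ^ ((k : ℝ) + 1)) *
                2 ^ (k : ℝ) := by
              rw [ENNReal.div_eq_inv_mul, ← ENNReal.rpow_neg, mul_right_comm, ← two_rpow_add,
                ENNReal.mul_rpow_of_nonneg _ _ hqr.le, ENNReal.mul_rpow_of_nonneg _ _ hqr.le,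
                ← mul_assoc, ← ENNReal.rpow_mul, ← ENNReal.rpow_mul, ← two_rpow_add]
              congr 2
              field_simp
              ring
          _ = ∫⁻ _ in dyadicIco k,
                ((2 ^ (-r) * dyadicSample I r x (k + 1)) ^ q.toReal / 2 ^ ((k : ℝ) + 1)) := by
              rw [setLIntegral_const, volume_dyadicIco]
          _ ≤ _ := by
              refine setLIntegral_mono' (measurableSet_dyadicIco k) fun t ht =>
                ENNReal.div_le_div (ENNReal.rpow_le_rpow ?_ hqr.le) ?_
              · calc 2 ^ (-r) * dyadicSample I r x (k + 1)
                    ≤ 2 ^ (-r) * (2 ^ r * (ENNReal.ofReal t ^ r * rearr I x t)) := by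
                      gcongr
                      exact dyadicSample_succ_le hr x ht
                  _ = _ := by
                      rw [← mul_assoc, mul_comm ((2 : ℝ≥0∞) ^ (-r)), two_rpow_mul_neg, one_mul]
              · rw [← ofReal_two_rpow]
                exact ENNReal.ofReal_le_ofReal ht.2.le
      refine seqSum_ne_top_of_le (c := (2 : ℝ≥0∞) ^ (r + q.toReal⁻¹)) (two_rpow_ne_top _) (-1)
        (fun k => ?_) hlow
      rw [← mul_assoc, two_rpow_mul_neg, one_mul, neg_add_cancel_right]
    · intro h
      have hup := seqSum_const_mul_ne_top (two_rpow_ne_top r) h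
      rw [seqSum_of_ne_top hq] at hup
      refine ne_top_of_le_ne_top hup (ENNReal.tsum_le_tsum fun k => ?_)
      calc _ ≤ ∫⁻ _ in dyadicIco k,
            ((2 ^ r * dyadicSample I r x k) ^ q.toReal / 2 ^ (k : ℝ)) := by
            refine setLIntegral_mono' (measurableSet_dyadicIco k) fun t ht =>
              ENNReal.div_le_div (ENNReal.rpow_le_rpow ?_ hqr.le) ?_
            · exact ofReal_rpow_mul_rearr_le hr x ht
            · rw [← ofReal_two_rpow]
              exact ENNReal.ofReal_le_ofReal ht.1
        _ = _ := by
            rw [setLIntegral_const, volume_dyadicIco,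
              ENNReal.div_mul_cancel (two_rpow_ne_zero _) (two_rpow_ne_top _)]

/-- The product of functions in `L^{p₃,q₃}` and `L^{p₁,q₁}` lies in `L^{p₂,q₂}`, in dyadic
form. -/
lemma seqSum_dyadicSample_mul_ne_top {I : Set ℝ} {r₁ r₃ : ℝ}
    {q₁ q₂ q₃ : ℝ≥0∞} (hq₁ : 0 < q₁) (hq₂ : 0 < q₂) (hq₃0 : 0 < q₃)
    (hq₃ : MultiplierExponent q₁ q₂ q₃) {x y : ℝ → ℝ}
    (hx : seqSum q₃ (dyadicSample I r₃ x) ≠ ⊤) (hy : seqSum q₁ (dyadicSample I r₁ y) ≠ ⊤) :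
    seqSum q₂ (dyadicSample I (r₃ + r₁) fun t => x t * y t) ≠ ⊤ := by
  refine seqSum_ne_top_of_le (c := (2 : ℝ≥0∞) ^ (r₃ + r₁)) (two_rpow_ne_top _) (-1)
    (fun k => ?_) (seqSum_mul_ne_top hq₁ hq₂ hq₃ hx hy)
  have hfin : ∀ {q : ℝ≥0∞} {r : ℝ} {z : ℝ → ℝ}, 0 < q → seqSum q (dyadicSample I r z) ≠ ⊤ →
      ∀ k : ℤ, rearr I z ((2 : ℝ) ^ (k : ℝ)) ≠ ⊤ := fun {q r z} hq h k => by
    rw [rearr_eq_two_rpow_mul_dyadicSample I r z k]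
    exact ENNReal.mul_ne_top (two_rpow_ne_top _) (ne_top_of_seqSum hq h k)
  obtain ⟨j, rfl⟩ : ∃ j, k = j + 1 := ⟨k - 1, by ring⟩
  rw [add_neg_cancel_right]
  have h2 : (2 : ℝ) ^ (((j + 1 : ℤ) : ℝ)) = 2 ^ (j : ℝ) + 2 ^ (j : ℝ) := by
    push_cast
    rw [two_rpow_succ, two_mul]
  have hpos : (0 : ℝ) ≤ 2 ^ (j : ℝ) := by positivity
  calc dyadicSample I (r₃ + r₁) (fun t => x t * y t) (j + 1)
      ≤ 2 ^ (((j + 1 : ℤ) : ℝ) * (r₃ + r₁)) *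
        (rearr I x (2 ^ (j : ℝ)) * rearr I y (2 ^ (j : ℝ))) := by
        rw [dyadicSample, h2]
        gcongr
        exact rearr_mul_le hpos hpos (hfin hq₃0 hx j) (hfin hq₁ hy j)
    _ = _ := by
        have : ((j + 1 : ℤ) : ℝ) * (r₃ + r₁) = (r₃ + r₁) + (j * r₃ + j * r₁) := by
          push_cast
          ring
        rw [this, two_rpow_add, two_rpow_add (j * r₃), dyadicSample, dyadicSample]
        ring

/-- A measurable subset of the line has measurable subsets of any smaller measure. -/
lemma exists_subset_volume_eq {A : Set ℝ} (hA : MeasurableSet A) {c : ℝ≥0∞}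
    (hc : c < volume A) : ∃ E ⊆ A, MeasurableSet E ∧ volume E = c := by
  have hmono : Monotone fun N : ℕ => A ∩ Ioc (-(N : ℝ)) N := fun m n h =>
    inter_subset_inter_right _ (Ioc_subset_Ioc (neg_le_neg (by exact_mod_cast h))
      (by exact_mod_cast h))
  have hU : ⋃ N : ℕ, A ∩ Ioc (-(N : ℝ)) N = A := by
    rw [← inter_iUnion, inter_eq_left]
    intro s _
    obtain ⟨N, hN⟩ := exists_nat_gt |s|
    exact mem_iUnion.2 ⟨N, (abs_lt.1 hN).1, (abs_lt.1 hN).2.le⟩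
  rw [← hU, hmono.measure_iUnion] at hc
  obtain ⟨N, hN⟩ := lt_iSup_iff.1 hc
  have hct : c ≠ ⊤ := hN.ne_top
  have hNN : -(N : ℝ) ≤ N := by linarith [(Nat.cast_nonneg N : (0 : ℝ) ≤ N)]
  set g : ℝ → ℝ := fun s => ∫ t in (-(N : ℝ))..s, A.indicator (fun _ => (1 : ℝ)) t with hg
  have hgval : ∀ s, -(N : ℝ) ≤ s → g s = (volume (A ∩ Ioc (-(N : ℝ)) s)).toReal := by
    intro s hs
    rw [hg]
    simp only
    rw [intervalIntegral.integral_of_le hs, integral_indicator hA, setIntegral_const,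
      smul_eq_mul, mul_one, measureReal_def, Measure.restrict_apply hA]
  have hcont : Continuous g := by
    refine intervalIntegral.continuous_primitive (fun a b => ?_) _
    refine (intervalIntegrable_const (c := (1 : ℝ))).mono_fun
      ((measurable_const.indicator hA).aestronglyMeasurable) (ae_of_all _ fun t => ?_)
    exact norm_indicator_le_norm_self _ _
  have hfin : ∀ s : ℝ, volume (A ∩ Ioc (-(N : ℝ)) s) ≠ ⊤ := fun s =>
    ne_top_of_le_ne_top measure_Ioc_lt_top.ne (measure_mono inter_subset_right)
  have hmem : c.toReal ∈ Icc (g (-(N : ℝ))) (g N) := by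
    rw [hgval _ le_rfl, hgval _ hNN]
    simp only [Ioc_self, inter_empty, measure_empty, ENNReal.toReal_zero]
    exact ⟨ENNReal.toReal_nonneg, ENNReal.toReal_mono (hfin _) hN.le⟩
  obtain ⟨s, hs, hgs⟩ := intermediate_value_Icc hNN hcont.continuousOn hmem
  refine ⟨A ∩ Ioc (-(N : ℝ)) s, inter_subset_left, hA.inter measurableSet_Ioc, ?_⟩
  rw [hgval _ hs.1] at hgs
  exact (ENNReal.toReal_eq_toReal_iff' (hfin s) hct).1 hgs

lemma exists_set_of_lt_rearr {I : Set ℝ} (hI : MeasurableSet I) {x : ℝ → ℝ} (hx : Measurable x)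
    {u : ℝ} {c : ℝ≥0∞} (hc0 : c ≠ 0) (hc : c < rearr I x ((2 : ℝ) ^ u)) :
    ∃ E ⊆ I, MeasurableSet E ∧ (∀ s ∈ E, c.toReal < |x s|) ∧ volume E = 2 ^ u := by
  have hct : c ≠ ⊤ := hc.ne_top
  have hvol : (2 : ℝ≥0∞) ^ u < volume {s : ℝ | s ∈ I ∧ c.toReal < |x s|} := by
    by_contra hcon
    rw [not_lt, ← ofReal_two_rpow] at hcon
    have := rearr_le (ENNReal.toReal_pos hc0 hct) hcon
    rw [ENNReal.ofReal_toReal hct] at this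
    exact this.not_gt hc
  have hm : MeasurableSet {s : ℝ | s ∈ I ∧ c.toReal < |x s|} :=
    hI.inter (measurableSet_lt measurable_const hx.abs)
  obtain ⟨E, hE, hEm, hEv⟩ := exists_subset_volume_eq hm hvol
  exact ⟨E, fun s hs => (hE hs).1, hEm, fun s hs => (hE hs).2, hEv⟩

/-- If the dyadic samples are not in `ℓ^q`, neither is some finite strict minorant. -/
lemma exists_finite_minorant {I : Set ℝ} {r : ℝ} {x : ℝ → ℝ} {q : ℝ≥0∞} (hq0 : 0 < q)
    (h : seqSum q (dyadicSample I r x) = ⊤) :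
    ∃ c : ℤ → ℝ≥0∞, (∀ k, c k ≠ ⊤) ∧
      (∀ k, c k ≠ 0 → c k < rearr I x ((2 : ℝ) ^ (k : ℝ))) ∧
      seqSum q (fun k => (2 : ℝ≥0∞) ^ ((k : ℝ) * r) * c k) = ⊤ := by
  by_cases hfin : ∀ k : ℤ, rearr I x ((2 : ℝ) ^ (k : ℝ)) ≠ ⊤
  · refine ⟨fun k => rearr I x ((2 : ℝ) ^ (k : ℝ)) / 2,
      fun k => ENNReal.div_ne_top (hfin k) two_ne_zero, fun k hk => ?_, ?_⟩
    · refine ENNReal.half_lt_self (fun h0 => hk ?_) (hfin k)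
      simp only [h0, ENNReal.zero_div]
    · by_contra hcon
      refine seqSum_ne_top_of_le (c := 2) ENNReal.ofNat_ne_top 0 (fun k => ?_) hcon h
      rw [add_zero, mul_left_comm, ENNReal.mul_div_cancel two_ne_zero ENNReal.ofNat_ne_top,
        dyadicSample]
  · push Not at hfin
    obtain ⟨k₀, hk₀⟩ := hfin
    refine ⟨fun k => if k ≤ k₀ then 2 ^ (-((k : ℝ) * r)) * (k.natAbs : ℝ≥0∞) else 0,
      fun k => ?_, fun k hk => ?_, ?_⟩
    · dsimp only
      split_ifs
      · exact ENNReal.mul_ne_top (two_rpow_ne_top _) (ENNReal.natCast_ne_top _)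
      · exact ENNReal.zero_ne_top
    · dsimp only at hk ⊢
      split_ifs at hk ⊢ with hle
      · have htop : rearr I x ((2 : ℝ) ^ (k : ℝ)) = ⊤ := top_le_iff.1 (hk₀ ▸ rearr_anti I x
          (Real.rpow_le_rpow_of_exponent_le one_le_two (by exact_mod_cast hle)))
        rw [htop]
        exact (ENNReal.mul_ne_top (two_rpow_ne_top _) (ENNReal.natCast_ne_top _)).lt_top
      · exact absurd rfl hk
    · by_contra hcon
      have hsup := iSup_ne_top_of_seqSum hq0 hcon
      refine hsup (ENNReal.eq_top_of_forall_nnreal_le fun b => ?_)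
      obtain ⟨n, hn⟩ := exists_nat_ge b
      set k : ℤ := -((k₀.natAbs + n : ℕ) : ℤ)
      refine le_trans ?_ (le_iSup _ k)
      have hk : k ≤ k₀ := by omega
      have hkn : n ≤ k.natAbs := by omega
      simp only [if_pos hk]
      rw [← mul_assoc, two_rpow_mul_neg, one_mul]
      calc (b : ℝ≥0∞) ≤ (n : ℝ≥0∞) := by exact_mod_cast hn
        _ ≤ _ := by exact_mod_cast hkn

/-- The upper envelope of the functions `v j · 1_{E j}`. -/
noncomputable def supIndicator (E : ℤ → Set ℝ) (v : ℤ → ℝ≥0∞) (s : ℝ) : ℝ≥0∞ :=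
  ⨆ j, (E j).indicator (fun _ => v j) s

lemma measurable_supIndicator {E : ℤ → Set ℝ} (hE : ∀ j, MeasurableSet (E j))
    (v : ℤ → ℝ≥0∞) : Measurable (supIndicator E v) :=
  Measurable.iSup fun j => measurable_const.indicator (hE j)

lemma le_supIndicator (E : ℤ → Set ℝ) (v : ℤ → ℝ≥0∞) {j : ℤ} {s : ℝ} (hs : s ∈ E j) :
    v j ≤ supIndicator E v s := by
  refine le_iSup_of_le j ?_
  rw [indicator_of_mem hs]

lemma supIndicator_le (E : ℤ → Set ℝ) (v : ℤ → ℝ≥0∞) {k : ℤ} {s : ℝ}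
    (hs : s ∉ ⋃ n : ℕ, E (k - 1 - n)) : supIndicator E v s ≤ ⨆ n : ℕ, v (k + n) := by
  refine iSup_le fun j => ?_
  by_cases hj : s ∈ E j
  swap
  · rw [indicator_of_notMem hj]
    exact zero_le
  rw [indicator_of_mem hj]
  have hkj : k ≤ j := by
    by_contra hlt
    refine hs (mem_iUnion.2 ⟨(k - 1 - j).toNat, ?_⟩)
    rwa [Int.toNat_of_nonneg (by omega), sub_sub_cancel]
  refine le_iSup_of_le (j - k).toNat ?_
  rw [Int.toNat_of_nonneg (by omega), add_sub_cancel]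

lemma volume_iUnion_le_two_rpow {E : ℤ → Set ℝ} (hE : ∀ j, volume (E j) ≤ 2 ^ (j : ℝ)) (k : ℤ) :
    volume (⋃ n : ℕ, E (k - 1 - n)) ≤ 2 ^ (k : ℝ) := by
  calc volume (⋃ n : ℕ, E (k - 1 - n)) ≤ ∑' n : ℕ, volume (E (k - 1 - n)) :=
        measure_iUnion_le _
    _ ≤ ∑' n : ℕ, (2 : ℝ≥0∞) ^ ((k : ℝ) - 1) * 2⁻¹ ^ n := by
        refine ENNReal.tsum_le_tsum fun n => (hE _).trans_eq ?_
        rw [← ENNReal.rpow_natCast, ENNReal.inv_rpow, ← ENNReal.rpow_neg, ← two_rpow_add]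
        push_cast
        rw [sub_eq_add_neg _ (n : ℝ)]
    _ = (2 : ℝ≥0∞) ^ ((k : ℝ) - 1) * 2 ^ (1 : ℝ) := by
        rw [ENNReal.tsum_mul_left, ENNReal.tsum_geometric, ENNReal.one_sub_inv_two, inv_inv,
          ENNReal.rpow_one]
    _ = 2 ^ (k : ℝ) := by rw [← two_rpow_add, sub_add_cancel]

lemma rearr_supIndicator_le (I : Set ℝ) {E : ℤ → Set ℝ} (hE : ∀ j, volume (E j) ≤ 2 ^ (j : ℝ))
    (v : ℤ → ℝ≥0∞) (k : ℤ) :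
    rearr I (fun s => (supIndicator E v s).toReal) ((2 : ℝ) ^ (k : ℝ)) ≤ ⨆ n : ℕ, v (k + n) := by
  refine ENNReal.le_of_forall_pos_le_add fun ε hε hV => ?_
  set V := ⨆ n : ℕ, v (k + n)
  have hpos : 0 < V.toReal + ε := add_pos_of_nonneg_of_pos ENNReal.toReal_nonneg hε
  have hle := rearr_le (I := I) (x := fun s => (supIndicator E v s).toReal)
    (t := (2 : ℝ) ^ (k : ℝ)) hpos (by
      rw [ofReal_two_rpow]
      refine (measure_mono ?_).trans (volume_iUnion_le_two_rpow hE k)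
      rintro s ⟨-, hs⟩
      by_contra hcon
      have h1 := ENNReal.toReal_mono hV.ne (supIndicator_le E v hcon)
      rw [abs_of_nonneg ENNReal.toReal_nonneg] at hs
      linarith [show (0 : ℝ) < ε from hε])
  rwa [ENNReal.ofReal_add ENNReal.toReal_nonneg (NNReal.coe_nonneg ε), ENNReal.ofReal_toReal hV.ne,
    ENNReal.ofReal_coe_nnreal] at hle

lemma volume_supIndicator_eq_top {E : ℤ → Set ℝ} (hE : ∀ j, volume (E j) ≤ 2 ^ (j : ℝ))
    {v : ℤ → ℝ≥0∞} (hv : ∀ k : ℤ, ⨆ n : ℕ, v (k + n) ≠ ⊤) :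
    volume {s | supIndicator E v s = ⊤} = 0 := by
  have hle : ∀ n : ℕ, volume {s | supIndicator E v s = ⊤} ≤ (2⁻¹ : ℝ≥0∞) ^ n := by
    intro n
    have h1 : volume {s | supIndicator E v s = ⊤} ≤ 2 ^ (((-n : ℤ)) : ℝ) := by
      refine (measure_mono fun s hs => ?_).trans (volume_iUnion_le_two_rpow hE (-n : ℤ))
      by_contra hcon
      have h2 := supIndicator_le E v hcon
      rw [show supIndicator E v s = ⊤ from hs] at h2
      exact hv _ (top_le_iff.1 h2)
    refine h1.trans_eq ?_
    rw [← ENNReal.rpow_natCast, ENNReal.inv_rpow, ← ENNReal.rpow_neg]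
    push_cast
    rfl
  exact le_antisymm (ge_of_tendsto' (ENNReal.tendsto_pow_atTop_nhds_zero_of_lt_one
    (by simp)) hle) zero_le

/-- A discrete Hardy-type inequality for the upper envelope of a weighted sequence. -/
lemma seqSum_weighted_iSup_ne_top {q : ℝ≥0∞} (hq0 : 0 < q) {r : ℝ} (hr : 0 < r)
    {b : ℤ → ℝ≥0∞} (hb : seqSum q b ≠ ⊤) :
    seqSum q (fun k => (2 : ℝ≥0∞) ^ ((k : ℝ) * r) *
      ⨆ n : ℕ, 2 ^ (-(((k + n : ℤ) : ℝ) * r)) * b (k + n)) ≠ ⊤ := by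
  have hrw : ∀ k : ℤ, (2 : ℝ≥0∞) ^ ((k : ℝ) * r) *
      ⨆ n : ℕ, 2 ^ (-(((k + n : ℤ) : ℝ) * r)) * b (k + n) =
      ⨆ n : ℕ, ((2 : ℝ≥0∞) ^ (-r)) ^ n * b (k + n) := by
    intro k
    rw [ENNReal.mul_iSup]
    refine iSup_congr fun n => ?_
    rw [← mul_assoc, ← two_rpow_add, ← ENNReal.rpow_natCast, ← ENNReal.rpow_mul]
    congr 2
    push_cast
    ring
  simp_rw [hrw]
  have hlt : (2 : ℝ≥0∞) ^ (-r) < 1 :=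
    ENNReal.rpow_lt_one_of_one_lt_of_neg (by norm_num) (neg_neg_of_pos hr)
  by_cases hq : q = ⊤
  · subst hq
    rw [seqSum_top] at hb ⊢
    refine ne_top_of_le_ne_top hb (iSup_le fun k => iSup_le fun n => ?_)
    calc _ ≤ 1 * b (k + n) := by
          gcongr
          exact pow_le_one₀ zero_le hlt.le
      _ ≤ _ := by
          rw [one_mul]
          exact le_iSup b _
  · have hqr := toReal_pos_of_ne hq0 hq
    rw [seqSum_of_ne_top hq]
    set ρ := ((2 : ℝ≥0∞) ^ (-r)) ^ q.toReal with hρ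
    have hρ1 : ρ < 1 := ENNReal.rpow_lt_one hlt hqr
    have hterm : ∀ k : ℤ, (⨆ n : ℕ, ((2 : ℝ≥0∞) ^ (-r)) ^ n * b (k + n)) ^ q.toReal ≤
        ∑' n : ℕ, ρ ^ n * b (k + n) ^ q.toReal := by
      intro k
      rw [← ENNReal.le_rpow_inv_iff hqr]
      refine iSup_le fun n => ?_
      rw [ENNReal.le_rpow_inv_iff hqr]
      refine le_trans (le_of_eq ?_) (ENNReal.le_tsum n)
      rw [ENNReal.mul_rpow_of_nonneg _ _ hqr.le, hρ, ← ENNReal.rpow_natCast,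
        ← ENNReal.rpow_natCast, ← ENNReal.rpow_mul, ← ENNReal.rpow_mul, ← ENNReal.rpow_mul,
        ← ENNReal.rpow_mul]
      congr 2
      ring
    refine ne_top_of_le_ne_top ?_ (ENNReal.tsum_le_tsum hterm)
    rw [ENNReal.tsum_comm]
    have hinner : ∀ n : ℕ, ∑' k : ℤ, ρ ^ n * b (k + n) ^ q.toReal = ρ ^ n * seqSum q b := by
      intro n
      rw [ENNReal.tsum_mul_left, ← seqSum_shift q b n, seqSum_of_ne_top hq]
    simp_rw [hinner]
    rw [ENNReal.tsum_mul_right, ENNReal.tsum_geometric]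
    exact ENNReal.mul_ne_top (ENNReal.inv_ne_top.2 (tsub_pos_of_lt hρ1).ne') hb

/-- If the dyadic samples of `x` are not in `ℓ^{q₃}`, then some `y` in `L^{p₁,q₁}` has a
product with `x` outside `L^{p₂,q₂}`. -/
lemma exists_multiplier_counterexample {I : Set ℝ} (hI : MeasurableSet I) {r₁ r₃ : ℝ}
    (hr₁ : 0 < r₁) {q₁ q₂ q₃ : ℝ≥0∞} (hq₁ : 0 < q₁) (hq₂ : 0 < q₂) (hq₃0 : 0 < q₃)
    (hq₃ : MultiplierExponent q₁ q₂ q₃) {x : ℝ → ℝ} (hx : Measurable x)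
    (hxt : seqSum q₃ (dyadicSample I r₃ x) = ⊤) :
    ∃ y : ℝ → ℝ, Measurable y ∧ seqSum q₁ (dyadicSample I r₁ y) ≠ ⊤ ∧
      seqSum q₂ (dyadicSample I (r₃ + r₁) fun t => x t * y t) = ⊤ := by
  obtain ⟨c, hct, hcx, hcs⟩ := exists_finite_minorant hq₃0 hxt
  obtain ⟨b, hb, hab⟩ := exists_seqSum_mul_eq_top hq₁ hq₂ hq₃
    (fun k => ENNReal.mul_ne_top (two_rpow_ne_top _) (hct k)) hcs
  have hset : ∀ k : ℤ, ∃ E : Set ℝ, E ⊆ I ∧ MeasurableSet E ∧ volume E ≤ 2 ^ (k : ℝ) ∧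
      (c k ≠ 0 → (∀ s ∈ E, (c k).toReal < |x s|) ∧ volume E = 2 ^ (k : ℝ)) := by
    intro k
    by_cases hk : c k = 0
    · exact ⟨∅, empty_subset _, MeasurableSet.empty, by simp, fun h => absurd hk h⟩
    · obtain ⟨E, hEI, hEm, hEx, hEv⟩ := exists_set_of_lt_rearr hI hx hk (hcx k hk)
      exact ⟨E, hEI, hEm, hEv.le, fun _ => ⟨hEx, hEv⟩⟩
  choose E hEI hEm hEv hE using hset
  set v : ℤ → ℝ≥0∞ := fun k => 2 ^ (-((k : ℝ) * r₁)) * b k with hvdef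
  set y : ℝ → ℝ := fun s => (supIndicator E v s).toReal with hy
  have hw := seqSum_weighted_iSup_ne_top hq₁ hr₁ hb
  have hvfin : ∀ k : ℤ, ⨆ n : ℕ, v (k + n) ≠ ⊤ := fun k htop =>
    ne_top_of_seqSum hq₁ hw k (by
      change _ * ⨆ n : ℕ, v (k + n) = ⊤
      rw [htop, ENNReal.mul_top (two_rpow_ne_zero _)])
  have hnull := volume_supIndicator_eq_top hEv hvfin
  refine ⟨y, (measurable_supIndicator hEm v).ennreal_toReal, ?_, ?_⟩
  · exact ne_top_of_le_ne_top hw (seqSum_mono _ fun k => by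
      rw [dyadicSample]
      gcongr
      exact rearr_supIndicator_le I hEv v k)
  · have hlow : ∀ k : ℤ, c k * v k ≤ rearr I (fun t => x t * y t) (2 ^ ((k - 1 : ℤ) : ℝ)) := by
      intro k
      by_cases hk : c k = 0
      · rw [hk, zero_mul]
        exact zero_le
      obtain ⟨hEx, hEk⟩ := hE k hk
      by_contra hcon
      obtain ⟨a, ha, hav, hac⟩ := exists_of_rearr_lt (not_le.1 hcon)
      rw [ofReal_two_rpow] at hav
      have hsub : E k \ {s | supIndicator E v s = ⊤} ⊆ {s | s ∈ I ∧ a < |x s * y s|} := by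
        rintro s ⟨hs, hst⟩
        refine ⟨hEI k hs, ?_⟩
        have hvk : (v k).toReal ≤ y s := ENNReal.toReal_mono hst (le_supIndicator E v hs)
        have hvt : v k ≠ ⊤ := ne_top_of_le_ne_top hst (le_supIndicator E v hs)
        have hac' : a < (c k).toReal * (v k).toReal := by
          rw [← ENNReal.toReal_mul]
          exact (ENNReal.ofReal_lt_iff_lt_toReal ha.le (ENNReal.mul_ne_top (hct k) hvt)).1 hac
        rw [abs_mul, abs_of_nonneg (show 0 ≤ y s from ENNReal.toReal_nonneg)]
        exact hac'.trans_le (mul_le_mul (hEx s hs).le hvk ENNReal.toReal_nonneg (abs_nonneg _))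
      have hle := (measure_mono hsub).trans hav
      rw [measure_sdiff_null hnull, hEk] at hle
      refine hle.not_gt (ENNReal.rpow_lt_rpow_of_exponent_lt (by norm_num)
        ENNReal.ofNat_ne_top ?_)
      push_cast
      linarith
    by_contra hcon
    refine seqSum_ne_top_of_le (c := (2 : ℝ≥0∞) ^ (r₃ + r₁)) (two_rpow_ne_top _) (-1)
      (fun k => ?_) hcon hab
    calc 2 ^ ((k : ℝ) * r₃) * c k * b k
        = 2 ^ (r₃ + r₁) * (2 ^ (((k - 1 : ℤ) : ℝ) * (r₃ + r₁)) * (c k * v k)) := by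
          have hexp : (2 : ℝ≥0∞) ^ ((k : ℝ) * r₃) = 2 ^ (r₃ + r₁) *
              (2 ^ (((k - 1 : ℤ) : ℝ) * (r₃ + r₁)) * 2 ^ (-((k : ℝ) * r₁))) := by
            rw [← two_rpow_add, ← two_rpow_add]
            congr 1
            push_cast
            ring
          rw [hexp, hvdef]
          ring
      _ ≤ _ := by
          gcongr 2 ^ (r₃ + r₁) * ?_
          exact mul_le_mul_right (hlow k) _

/-- if `p₁ > p₂`, or `p₁ = p₂` and `q₁ ≤ q₂`, then
`M(L^{p₁,q₁}(I), L^{p₂,q₂}(I)) = L^{p₃,q₃}(I)` where `1/p₃ = 1/p₂ − 1/p₁` and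
`1/q₃ = 1/q₂ − 1/q₁` if `q₁ > q₂`, `q₃ = ∞` if `q₁ ≤ q₂`. -/
theorem stmt13 (I : Set ℝ) (hI : I = Ioo (0:ℝ) 1 ∨ I = Ioi (0:ℝ))
    (p₁ p₂ q₁ q₂ p₃ q₃ : ℝ≥0∞)
    (hp₁ : 0 < p₁) (hp₁' : p₁ ≠ ⊤) (hp₂ : 0 < p₂) (hp₂' : p₂ ≠ ⊤)
    (hq₁ : 0 < q₁) (hq₂ : 0 < q₂)
    (hcase : p₂ < p₁ ∨ (p₁ = p₂ ∧ q₁ ≤ q₂))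
    (hp₃ : p₃⁻¹ = p₂⁻¹ - p₁⁻¹)
    (hq₃ : (q₂ < q₁ ∧ q₃⁻¹ = q₂⁻¹ - q₁⁻¹) ∨ (q₁ ≤ q₂ ∧ q₃ = ⊤))
    (x : ℝ → ℝ) (hx : Measurable x) :
    (∀ y : ℝ → ℝ, Measurable y → lorentzNorm I p₁ q₁ y ≠ ⊤ →
        lorentzNorm I p₂ q₂ (fun t => x t * y t) ≠ ⊤) ↔
      lorentzNorm I p₃ q₃ x ≠ ⊤ := by
  have hIm : MeasurableSet I := by
    rcases hI with rfl | rfl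
    · exact measurableSet_Ioo
    · exact measurableSet_Ioi
  have hle : p₁⁻¹ ≤ p₂⁻¹ := ENNReal.inv_le_inv.2 (hcase.elim le_of_lt fun h => h.1.ge)
  have hr₁ : 0 < p₁⁻¹.toReal :=
    ENNReal.toReal_pos (ENNReal.inv_ne_zero.2 hp₁') (ENNReal.inv_ne_top.2 hp₁.ne')
  have hr : p₂⁻¹.toReal = p₃⁻¹.toReal + p₁⁻¹.toReal := by
    rw [hp₃, ENNReal.toReal_sub_of_le hle (ENNReal.inv_ne_top.2 hp₂.ne'), sub_add_cancel]
  have hq₃0 : 0 < q₃ := by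
    rcases hq₃ with ⟨-, h⟩ | ⟨-, rfl⟩
    · exact exponent_pos hq₂ h
    · exact ENNReal.zero_lt_top
  simp only [lorentzNorm_ne_top_iff I _ hq₁, lorentzNorm_ne_top_iff I _ hq₂,
    lorentzNorm_ne_top_iff I _ hq₃0, hr]
  constructor
  · intro h hxt
    obtain ⟨y, hym, hy, hxy⟩ :=
      exists_multiplier_counterexample hIm hr₁ hq₁ hq₂ hq₃0 hq₃ hx hxt
    exact h y hym hy hxy
  · exact fun h y _ hy => seqSum_dyadicSample_mul_ne_top hq₁ hq₂ hq₃0 hq₃ h hy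
end
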